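/- There exist constants k₀ ≥ 1, δ₀ > 0 and C > 0 with the following property. Let ν ∈ (0,1], k ∈ ℤ with |k| ≥ 1, λ ∈ ℝ, ε ∈ [0, δ₀), and set L = (|k|/ν)^{1/3}. Assume L ≥ 6|k| or L ≥ |k| ≥ k₀. Let φ₁, φ₂ : [−1,1] → ℂ be four times continuously differentiable with: φ₁(±1) = 0, φ₁'(1) = 1, φ₁'(−1) = 0; φ₂(±1) = 0, φ₂'(−1) = 1, φ₂'(1) = 0; and, with w_i = φ_i'' − k²φ_i (i = 1,2), −ν(w_i'' − k²w_i) + ik(y−λ)w_i − ε·ν^{1/3}|k|^{2/3}w_i = 0 on [−1,1]. Then (∫_{−1}^{1} ρ_k(y)^{−1/2}|w₁(y)|²dy)^{1/2} ≤ C·ν^{−7/24}|k|^{−1/12}(1+|k(λ−1)|)^{3/8}, (∫_{−1}^{1} ρ_k(y)^{−1/2}|w₂(y)|²dy)^{1/2} ≤ C·ν^{−7/24}|k|^{−1/12}(1+|k(λ+1)|)^{3/8}, and (∫_{−1}^{1} ρ_k(y)|w₁(y)|²dy)^{1/2} + (∫_{−1}^{1} ρ_k(y)|w₂(y)|²dy)^{1/2}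 ≤ C·L^{1/2}. -/

import Mathlib

/-- The boundary-layer weight `ρ_k` (depending on `L = (|k|/ν)^{1/3}`) on `[-1,1]`. -/
noncomputable def rhoW (L : ℝ) (y : ℝ) : ℝ :=
  if y ≤ -1 + 1/L then L * (y + 1) else if y ≤ 1 - 1/L then 1 else L * (1 - y)

section Part1

open Set

/-- Simultaneous first-exit (trapping) lemma. -/
theorem trap {ι : Type} [Finite ι] {a b : ℝ} (g g' : ι → ℝ → ℝ)
    (hd : ∀ i, ∀ t ∈ Icc a b, HasDerivAt (g i) (g' i t) t) (h0 : ∀ i, 0 < g i a)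
    (hstep : ∀ t ∈ Ioc a b, (∀ i, 0 ≤ g i t) → (∃ i, g i t = 0) →
      ∃ j, g j t = 0 ∧ 0 < g' j t) :
    ∀ t ∈ Icc a b, ∀ i, 0 < g i t := by
  classical
  by_contra hcon
  push Not at hcon
  obtain ⟨t₁, ht₁, i₁, hi₁⟩ := hcon
  have hfin := Fintype.ofFinite ι
  -- the bad set
  let Z : Set ℝ := ⋃ i, (Icc a b ∩ {t | g i t ≤ 0})
  have hcont : ∀ i, ContinuousOn (g i) (Icc a b) := fun i t ht =>
    (hd i t ht).continuousAt.continuousWithinAt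
  have hZc : IsClosed Z := by
    refine isClosed_iUnion_of_finite fun i => ?_
    have := (hcont i).preimage_isClosed_of_isClosed isClosed_Icc (isClosed_Iic (a := (0:ℝ)))
    simpa [Set.preimage, Set.mem_Iic] using this
  have hZne : Z.Nonempty := ⟨t₁, mem_iUnion.2 ⟨i₁, ht₁, hi₁⟩⟩
  have hZb : BddBelow Z := ⟨a, fun x hx => by
    obtain ⟨i, hx, _⟩ := mem_iUnion.1 hx; exact hx.1⟩
  have hτ := hZc.csInf_mem hZne hZb
  set τ := sInf Z with hτdef
  obtain ⟨i₀, hτI, hi₀⟩ := mem_iUnion.1 hτ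
  have hbefore : ∀ s ∈ Ico a τ, ∀ i, 0 < g i s := by
    intro s hs i
    by_contra h
    have : s ∈ Z := mem_iUnion.2 ⟨i, ⟨hs.1, hs.2.le.trans hτI.2⟩, not_lt.1 h⟩
    exact absurd (csInf_le hZb this) (not_le.2 hs.2)
  have haτ : a < τ := by
    rcases hτI.1.lt_or_eq with h | h
    · exact h
    · exfalso; have := h0 i₀; rw [h] at this; exact absurd this (not_lt.2 hi₀)
  have hge : ∀ i, 0 ≤ g i τ := by
    intro i
    have hc : ContinuousAt (g i) τ := (hd i τ hτI).continuousAt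
    by_contra hneg
    push Not at hneg
    have hev := hc.eventually (gt_mem_nhds hneg)
    have hev2 : ∀ᶠ s in nhdsWithin τ (Iio τ), g i s < 0 ∧ a < s ∧ s < τ := by
      filter_upwards [nhdsWithin_le_nhds hev, nhdsWithin_le_nhds (lt_mem_nhds haτ),
        self_mem_nhdsWithin] with s h1 h2 h3 using ⟨h1, h2, h3⟩
    obtain ⟨s, h1, h2, h3⟩ := hev2.exists
    exact absurd (hbefore s ⟨h2.le, h3⟩ i) (not_lt.2 h1.le)
  obtain ⟨j, hj0, hj1⟩ := hstep τ ⟨haτ, hτI.2⟩ hge ⟨i₀, le_antisymm hi₀ (hge i₀)⟩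
  have hdj := hd j τ hτI
  have hsl := hdj.tendsto_slope
  have hev := hsl.eventually (lt_mem_nhds hj1)
  have hev' : ∀ᶠ s in nhdsWithin τ (Iio τ), 0 < slope (g j) τ s ∧ a < s ∧ s < τ := by
    have hle : nhdsWithin τ (Iio τ) ≤ nhdsWithin τ {τ}ᶜ :=
      nhdsWithin_mono _ (fun x hx => ne_of_lt hx)
    filter_upwards [hle hev, nhdsWithin_le_nhds (lt_mem_nhds haτ),
      self_mem_nhdsWithin] with s h1 h2 h3 using ⟨h1, h2, h3⟩
  obtain ⟨s, h1, h2, h3⟩ := hev'.exists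
  have hpos := hbefore s ⟨h2.le, h3⟩ j
  rw [slope_def_field, hj0, sub_zero] at h1
  have : g j s / (s - τ) < 0 := div_neg_of_pos_of_neg hpos (by linarith)
  linarith

/-- One-function strict trap. -/
theorem trap1 {a b : ℝ} {f f' : ℝ → ℝ} (hd : ∀ t ∈ Icc a b, HasDerivAt f (f' t) t)
    (h0 : 0 < f a) (hs : ∀ t ∈ Ioc a b, f t = 0 → 0 < f' t) : ∀ t ∈ Icc a b, 0 < f t := by
  have := trap (ι := Unit) (fun _ => f) (fun _ => f') (fun _ => hd) (fun _ => h0)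
    (fun t ht _ ⟨_, h⟩ => ⟨(), h, hs t ht h⟩)
  exact fun t ht => this t ht ()

/-- Non-strict barrier. -/
theorem barrier_nonneg {a b : ℝ} {f f' : ℝ → ℝ} (hd : ∀ t ∈ Icc a b, HasDerivAt f (f' t) t)
    (h0 : 0 ≤ f a) (hs : ∀ t ∈ Ico a b, f t = 0 → 0 < f' t) : ∀ t ∈ Icc a b, 0 ≤ f t := by
  intro t ht
  have := image_le_of_deriv_right_lt_deriv_boundary (f := fun t => - f t)
    (f' := fun t => - f' t) (a := a) (b := b) (B := fun _ => (0:ℝ)) (B' := fun _ => 0)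
    (fun x hx => (hd x hx).neg.continuousAt.continuousWithinAt)
    (fun x hx => (hd x ⟨hx.1, hx.2.le⟩).neg.hasDerivWithinAt)
    (by simpa using h0) (fun x => hasDerivAt_const x 0)
    (fun x hx h => by have := hs x hx (by simpa using h); simpa using this) ht
  simpa using this

/-- Nonneg derivative implies monotone on an interval. -/
theorem mono_of_deriv {a b : ℝ} {f f' : ℝ → ℝ} (hd : ∀ t ∈ Icc a b, HasDerivAt f (f' t) t)
    (hs : ∀ t ∈ Icc a b, 0 ≤ f' t) : ∀ s ∈ Icc a b, ∀ t ∈ Icc a b, s ≤ t → f s ≤ f t := by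
  intro s hs' t ht hst
  have hm : MonotoneOn f (Icc a b) := by
    refine monotoneOn_of_deriv_nonneg (convex_Icc a b)
      (fun x hx => (hd x hx).continuousAt.continuousWithinAt)
      (fun x hx => (hd x (interior_subset hx)).differentiableAt.differentiableWithinAt) ?_
    intro x hx
    rw [(hd x (interior_subset hx)).deriv]
    exact hs x (interior_subset hx)
  exact hm hs' ht hst

/-- History version of the first-exit argument. -/
theorem first_exit {a b : ℝ} {f : ℝ → ℝ} (hc : ContinuousOn f (Icc a b))
    (hs : ∀ t ∈ Icc a b, (∀ s ∈ Icc a t, 0 ≤ f s) → 0 < f t) (h0 : 0 < f a) :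
    ∀ t ∈ Icc a b, 0 < f t := by
  by_contra hcon
  push Not at hcon
  obtain ⟨t₁, ht₁, hi₁⟩ := hcon
  let Z : Set ℝ := Icc a b ∩ {t | f t ≤ 0}
  have hZc : IsClosed Z := by
    have := hc.preimage_isClosed_of_isClosed isClosed_Icc (isClosed_Iic (a := (0:ℝ)))
    simpa [Set.preimage, Set.mem_Iic] using this
  have hZne : Z.Nonempty := ⟨t₁, ht₁, hi₁⟩
  have hZb : BddBelow Z := ⟨a, fun x hx => hx.1.1⟩
  have hτ := hZc.csInf_mem hZne hZb
  set τ := sInf Z with hτdef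
  obtain ⟨hτI, hτ0⟩ := hτ
  have hbefore : ∀ s ∈ Ico a τ, 0 < f s := by
    intro s hs
    by_contra h
    have : s ∈ Z := ⟨⟨hs.1, hs.2.le.trans hτI.2⟩, not_lt.1 h⟩
    exact absurd (csInf_le hZb this) (not_le.2 hs.2)
  have haτ : a < τ := by
    rcases hτI.1.lt_or_eq with h | h
    · exact h
    · exfalso; rw [h] at h0; exact absurd h0 (not_lt.2 hτ0)
  have hge : 0 ≤ f τ := by
    have hcl : τ ∈ closure (Ico a τ) := by
      rw [closure_Ico haτ.ne]; exact ⟨haτ.le, le_rfl⟩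
    have hcw : ContinuousWithinAt f (Ico a τ) τ :=
      (hc τ hτI).mono (fun x hx => ⟨hx.1, hx.2.le.trans hτI.2⟩)
    have hmem := hcw.mem_closure hcl (t := Ici 0) (fun s hs => (hbefore s hs).le)
    simpa using hmem
  have := hs τ hτI (fun s hs' => by
    rcases hs'.2.lt_or_eq with h | h
    · exact (hbefore s ⟨hs'.1, h⟩).le
    · rw [h]; exact hge)
  exact absurd this (not_lt.2 hτ0)

end Part1

section Part2

open Set

/-- Disc barrier for a complex-valued function. -/
theorem disc_barrier {a b : ℝ} {z r p : ℝ → ℂ} {e e' : ℝ → ℝ}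
    (hz : ∀ t ∈ Icc a b, HasDerivAt z (r t - p t * z t) t)
    (he : ∀ t ∈ Icc a b, HasDerivAt e (e' t) t) (hpos : ∀ t ∈ Icc a b, 0 < e t)
    (h0 : ‖z a‖ < e a)
    (hs : ∀ t ∈ Ioc a b, ‖z t‖ = e t → ‖r t‖ - (p t).re * e t < e' t) :
    ∀ t ∈ Icc a b, ‖z t‖ < e t := by
  by_cases hab : a ≤ b
  swap
  · intro t ht; exact absurd (ht.1.trans ht.2) hab
  have hre : ∀ t ∈ Icc a b, HasDerivAt (fun s => (z s).re) (r t - p t * z t).re t := by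
    intro t ht
    exact (Complex.reCLM.hasFDerivAt.comp_hasDerivAt t (hz t ht))
  have him : ∀ t ∈ Icc a b, HasDerivAt (fun s => (z s).im) (r t - p t * z t).im t := by
    intro t ht
    exact (Complex.imCLM.hasFDerivAt.comp_hasDerivAt t (hz t ht))
  have key := trap1 (a := a) (b := b) (f := fun t => e t ^ 2 - ((z t).re ^ 2 + (z t).im ^ 2))
    (f' := fun t => 2 * e t * e' t - (2 * (z t).re * (r t - p t * z t).re
      + 2 * (z t).im * (r t - p t * z t).im))
    (fun t ht => by
      have h1 := ((he t ht).pow 2).sub (((hre t ht).pow 2).add ((him t ht).pow 2))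
      exact h1.congr_deriv (by norm_num)) ?_ ?_
  · intro t ht
    have h := key t ht
    have h2 : ‖z t‖ ^ 2 = (z t).re ^ 2 + (z t).im ^ 2 := by
      rw [Complex.sq_norm, Complex.normSq_apply]; ring
    have := hpos t ht
    have : ‖z t‖ ^ 2 < e t ^ 2 := by rw [h2]; linarith
    exact lt_of_pow_lt_pow_left₀ 2 (hpos t ht).le this
  · have h2 : ‖z a‖ ^ 2 = (z a).re ^ 2 + (z a).im ^ 2 := by
      rw [Complex.sq_norm, Complex.normSq_apply]; ring
    have : ‖z a‖ ^ 2 < e a ^ 2 := by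
      have := norm_nonneg (z a)
      exact pow_lt_pow_left₀ h0 this two_ne_zero
    linarith
  · intro t ht hf
    have htI : t ∈ Icc a b := ⟨ht.1.le, ht.2⟩
    have h2 : ‖z t‖ ^ 2 = (z t).re ^ 2 + (z t).im ^ 2 := by
      rw [Complex.sq_norm, Complex.normSq_apply]; ring
    have hp := hpos t htI
    have hzn : ‖z t‖ = e t := by
      have : ‖z t‖ ^ 2 = e t ^ 2 := by rw [h2]; linarith
      exact (pow_left_inj₀ (norm_nonneg _) hp.le two_ne_zero).1 this
    have h3 := hs t ht hzn
    have h4 : (z t).re * (r t).re + (z t).im * (r t).im ≤ e t * ‖r t‖ := by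
      have := Complex.re_le_norm (starRingEnd ℂ (z t) * r t)
      rw [norm_mul, Complex.norm_conj, hzn] at this
      simpa [Complex.mul_re] using this
    have h5 : (z t).re ^ 2 + (z t).im ^ 2 = e t ^ 2 := by rw [← h2, hzn]
    have h6 : e t * (‖r t‖ - (p t).re * e t) < e t * e' t := mul_lt_mul_of_pos_left h3 hp
    simp only [Complex.sub_re, Complex.sub_im, Complex.mul_re, Complex.mul_im]
    have h7 : (p t).re * ((z t).re ^ 2 + (z t).im ^ 2) = (p t).re * e t ^ 2 := by rw [h5]
    nlinarith

/-- Upper barrier for a real-valued function. -/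
theorem upper_barrier {a b : ℝ} {z z' : ℝ → ℝ} {e e' : ℝ → ℝ}
    (hz : ∀ t ∈ Icc a b, HasDerivAt z (z' t) t)
    (he : ∀ t ∈ Icc a b, HasDerivAt e (e' t) t) 
    (h0 : z a < e a)
    (hs : ∀ t ∈ Ioc a b, z t = e t → z' t < e' t) :
    ∀ t ∈ Icc a b, z t < e t := by
  intro t ht
  have := trap1 (f := fun t => e t - z t) (f' := fun t => e' t - z' t)
    (fun t ht => (he t ht).sub (hz t ht)) (by linarith)
    (fun t ht h => by have := hs t ht (by linarith); linarith) t ht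
  linarith

/-- The system of Riccati type satisfied by the quotients. -/
structure Sys (κ ε : ℝ) (m Q : ℝ → ℂ) (N0 N1 : ℝ → ℝ) (a b : ℝ) : Prop where
  hm : ∀ t ∈ Icc a b, HasDerivAt m ((κ : ℂ) ^ 2 - ε + t * Complex.I - m t ^ 2) t
  hQ : ∀ t ∈ Icc a b, HasDerivAt Q (1 - (m t + κ) * Q t) t
  hN0 : ∀ t ∈ Icc a b, HasDerivAt N0 (1 - (m t).re * N0 t) t
  hN1 : ∀ t ∈ Icc a b, HasDerivAt N1 (N0 t - (m t).re * N1 t) t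

theorem Sys.mono {κ ε : ℝ} {m Q : ℝ → ℂ} {N0 N1 : ℝ → ℝ} {a b a' b' : ℝ}
    (h : Sys κ ε m Q N0 N1 a b) (ha : a ≤ a') (hb : b' ≤ b) : Sys κ ε m Q N0 N1 a' b' :=
  ⟨fun t ht => h.hm t ⟨ha.trans ht.1, ht.2.trans hb⟩,
   fun t ht => h.hQ t ⟨ha.trans ht.1, ht.2.trans hb⟩,
   fun t ht => h.hN0 t ⟨ha.trans ht.1, ht.2.trans hb⟩,
   fun t ht => h.hN1 t ⟨ha.trans ht.1, ht.2.trans hb⟩⟩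

theorem hasDerivAt_lerp (x y p : ℝ) (t : ℝ) :
    HasDerivAt (fun s : ℝ => x + 16 * (s - p) * (y - x)) (16 * (y - x)) t := by
  have h := ((((hasDerivAt_id t).sub_const p).const_mul 16).mul_const (y - x)).const_add x
  simpa using h

theorem hasDerivAt_clerp (x y : ℂ) (p : ℝ) (t : ℝ) :
    HasDerivAt (fun s : ℝ => x + 16 * ((s : ℂ) - p) * (y - x)) (16 * (y - x)) t := by
  have h0 : HasDerivAt (fun s : ℝ => (s : ℂ)) 1 t := Complex.ofRealCLM.hasDerivAt
  have h := (((h0.sub_const (p : ℂ)).const_mul 16).mul_const (y - x)).const_add x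
  simpa using h

/-- residual bound for a product of linear interpolants -/
theorem lerp_res (A0 A1 d2 : ℂ) (u r D : ℝ) (hu0 : 0 ≤ u) (hu1 : u ≤ 1)
    (h0 : ‖A0‖ ≤ r) (h1 : ‖A1‖ ≤ r) (hd : ‖d2‖ ≤ D) :
    ‖(1 - (u : ℂ)) * A0 + u * A1 + u * (1 - u) * d2‖ ≤ r + D / 4 := by
  have e1 : ‖(1 - (u : ℂ))‖ = 1 - u := by
    rw [← Complex.ofReal_one, ← Complex.ofReal_sub, Complex.norm_real]
    exact abs_of_nonneg (by linarith)
  have e2 : ‖(u : ℂ)‖ = u := by rw [Complex.norm_real]; exact abs_of_nonneg hu0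
  calc _ ≤ ‖(1 - (u : ℂ)) * A0‖ + ‖(u : ℂ) * A1‖ + ‖(u : ℂ) * (1 - u) * d2‖ := norm_add₃_le
    _ = (1 - u) * ‖A0‖ + u * ‖A1‖ + u * (1 - u) * ‖d2‖ := by
      simp only [norm_mul, e1, e2]
    _ ≤ (1 - u) * r + u * r + (1 / 4) * D := by
      have : u * (1 - u) ≤ 1 / 4 := by nlinarith [sq_nonneg (u - 1 / 2)]
      have hD : 0 ≤ D := (norm_nonneg _).trans hd
      have h3 : u * (1 - u) * ‖d2‖ ≤ (1 / 4) * D := by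
        apply mul_le_mul this hd (norm_nonneg _) (by norm_num)
      have := mul_le_mul_of_nonneg_left h0 (show 0 ≤ 1 - u by linarith)
      have := mul_le_mul_of_nonneg_left h1 hu0
      linarith
    _ = _ := by ring

end Part2

section Part3

open Set

theorem lerp_mem {x y l u : ℝ} (hu0 : 0 ≤ u) (hu1 : u ≤ 1) (hx : l ≤ x) (hy : l ≤ y) :
    l ≤ x + u * (y - x) := by nlinarith
theorem lerp_le {x y l u : ℝ} (hu0 : 0 ≤ u) (hu1 : u ≤ 1) (hx : x ≤ l) (hy : y ≤ l) :
    x + u * (y - x) ≤ l := by nlinarith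
theorem lerp_lt {x y l u : ℝ} (hu0 : 0 ≤ u) (hu1 : u ≤ 1) (hx : x < l) (hy : y < l) :
    x + u * (y - x) < l := by
  rcases hu0.eq_or_lt with h | h
  · rw [← h]; linarith
  · nlinarith

theorem lerp_pos {x y u : ℝ} (hu0 : 0 ≤ u) (hu1 : u ≤ 1) (hx : 0 < x) (hy : 0 < y) :
    0 < x + u * (y - x) := by
  have := lerp_mem hu0 hu1 (min_le_left x y) (min_le_right x y)
  exact (lt_min hx hy).trans_le this

theorem cell_u {p t b : ℝ} (hb : b ≤ p + 1/16) (ht : t ∈ Icc p b) : 0 ≤ 16 * (t - p) ∧ 16 * (t - p) ≤ 1 := by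
  constructor <;> linarith [ht.1, ht.2]

theorem cell_m {κ ε p kc da b : ℝ} (hb : b ≤ p + 1/16) {m Q : ℝ → ℂ} {N0 N1 : ℝ → ℝ}
    (hS : Sys κ ε m Q N0 N1 p b)
    {M0 M1 : ℂ} {e0 e1 r mu E : ℝ} (hda : |κ ^ 2 - ε - kc ^ 2| ≤ da)
    (hr0 : ‖(kc : ℂ) ^ 2 + p * Complex.I - M0 ^ 2 - 16 * (M1 - M0)‖ ≤ r)
    (hr1 : ‖(kc : ℂ) ^ 2 + (p + 1/16) * Complex.I - M1 ^ 2 - 16 * (M1 - M0)‖ ≤ r)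
    (he0 : 0 < e0) (he1 : 0 < e1) (hE0 : e0 ≤ E) (hE1 : e1 ≤ E)
    (hmu0 : mu ≤ M0.re) (hmu1 : mu ≤ M1.re)
    (hc0 : r + ‖M1 - M0‖ ^ 2 / 4 + da - (2 * mu - E) * e0 < 16 * (e1 - e0))
    (hc1 : r + ‖M1 - M0‖ ^ 2 / 4 + da - (2 * mu - E) * e1 < 16 * (e1 - e0))
    (hi : ‖m p - M0‖ < e0) :
    ∀ t ∈ Icc p b, ‖m t - (M0 + 16 * ((t : ℂ) - p) * (M1 - M0))‖
      < e0 + 16 * (t - p) * (e1 - e0) := by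
  refine disc_barrier (z := fun t => m t - (M0 + 16 * ((t : ℂ) - p) * (M1 - M0)))
    (r := fun t => (κ : ℂ) ^ 2 - ε + t * Complex.I
      - (M0 + 16 * ((t : ℂ) - p) * (M1 - M0)) ^ 2 - 16 * (M1 - M0))
    (p := fun t => m t + (M0 + 16 * ((t : ℂ) - p) * (M1 - M0)))
    (e := fun t => e0 + 16 * (t - p) * (e1 - e0)) (e' := fun _ => 16 * (e1 - e0)) ?_ ?_ ?_ ?_ ?_
  · intro t ht
    refine ((hS.hm t ht).sub (hasDerivAt_clerp M0 M1 p t)).congr_deriv ?_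
    ring
  · intro t _; exact hasDerivAt_lerp e0 e1 p t
  · intro t ht
    obtain ⟨h0, h1⟩ := cell_u hb ht
    exact lerp_pos h0 h1 he0 he1
  · simpa using hi
  · intro t ht hz
    obtain ⟨hu0, hu1⟩ := cell_u hb ⟨ht.1.le, ht.2⟩
    set u := 16 * (t - p) with hu
    have hres : ‖(κ : ℂ) ^ 2 - ε + t * Complex.I
      - (M0 + 16 * ((t : ℂ) - p) * (M1 - M0)) ^ 2 - 16 * (M1 - M0)‖ ≤ r + ‖M1 - M0‖ ^ 2 / 4 + da := by
      have heq : (κ : ℂ) ^ 2 - ε + t * Complex.I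
          - (M0 + 16 * ((t : ℂ) - p) * (M1 - M0)) ^ 2 - 16 * (M1 - M0)
          = ((1 - (u : ℂ)) * ((kc : ℂ) ^ 2 + p * Complex.I - M0 ^ 2 - 16 * (M1 - M0))
            + u * ((kc : ℂ) ^ 2 + (p + 1/16) * Complex.I - M1 ^ 2 - 16 * (M1 - M0))
            + u * (1 - u) * (M1 - M0) ^ 2) + ((κ ^ 2 - ε - kc ^ 2 : ℝ) : ℂ) := by
        rw [hu]; push_cast; ring
      rw [heq]
      refine (norm_add_le _ _).trans (add_le_add ?_ ?_)
      · exact lerp_res _ _ _ u r _ hu0 hu1 hr0 hr1 (by rw [norm_pow])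
      · rw [Complex.norm_real]; exact hda
    have hEt : e0 + u * (e1 - e0) ≤ E := lerp_le hu0 hu1 hE0 hE1
    have hpos : 0 < e0 + u * (e1 - e0) := lerp_pos hu0 hu1 he0 he1
    have hmh : mu ≤ (M0 + 16 * ((t : ℂ) - p) * (M1 - M0)).re := by
      have : (M0 + 16 * ((t : ℂ) - p) * (M1 - M0)).re = M0.re + u * (M1.re - M0.re) := by
        have h : (16 * ((t : ℂ) - p)) = ((u : ℝ) : ℂ) := by rw [hu]; push_cast; ring
        rw [h]; simp [Complex.add_re]
      rw [this]; exact lerp_mem hu0 hu1 hmu0 hmu1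
    have hmr := (abs_le.1 ((Complex.abs_re_le_norm (m t - (M0 + 16 * ((t : ℂ) - p) * (M1 - M0)))).trans_eq hz)).1
    rw [Complex.sub_re] at hmr
    have hrate : 2 * mu - E ≤ (m t + (M0 + 16 * ((t : ℂ) - p) * (M1 - M0))).re := by
      rw [Complex.add_re]; linarith
    have hlin : (r + ‖M1 - M0‖ ^ 2 / 4 + da - (2 * mu - E) * e0) + u * ((r + ‖M1 - M0‖ ^ 2 / 4 + da - (2 * mu - E) * e1)
      - (r + ‖M1 - M0‖ ^ 2 / 4 + da - (2 * mu - E) * e0)) < 16 * (e1 - e0) := lerp_lt hu0 hu1 hc0 hc1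
    have := mul_le_mul_of_nonneg_right hrate hpos.le
    nlinarith

theorem cell_Q {κ ε p kc dk kl b : ℝ} (hb : b ≤ p + 1/16) {m Q : ℝ → ℂ} {N0 N1 : ℝ → ℝ}
    (hS : Sys κ ε m Q N0 N1 p b) (hkl : kl ≤ κ)
    {M0 M1 Q0 Q1 : ℂ} {e0 e1 g0 g1 r mu E V : ℝ} (hdk : |κ - kc| ≤ dk)
    (hr0 : ‖1 - (M0 + kc) * Q0 - 16 * (Q1 - Q0)‖ ≤ r)
    (hr1 : ‖1 - (M1 + kc) * Q1 - 16 * (Q1 - Q0)‖ ≤ r)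
    (hg0 : 0 < g0) (hg1 : 0 < g1) (hE0 : e0 ≤ E) (hE1 : e1 ≤ E)
    (hmu0 : mu ≤ M0.re) (hmu1 : mu ≤ M1.re) (hV0 : ‖Q0‖ ≤ V) (hV1 : ‖Q1‖ ≤ V)
    (hm : ∀ t ∈ Icc p b, ‖m t - (M0 + 16 * ((t : ℂ) - p) * (M1 - M0))‖
      < e0 + 16 * (t - p) * (e1 - e0))
    (hc0 : r + (‖M1 - M0‖ ^ 2 + ‖Q1 - Q0‖ ^ 2) / 8 + (E + dk) * V - (mu - E + kl) * g0
      < 16 * (g1 - g0))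
    (hc1 : r + (‖M1 - M0‖ ^ 2 + ‖Q1 - Q0‖ ^ 2) / 8 + (E + dk) * V - (mu - E + kl) * g1
      < 16 * (g1 - g0))
    (hi : ‖Q p - Q0‖ < g0) :
    ∀ t ∈ Icc p b, ‖Q t - (Q0 + 16 * ((t : ℂ) - p) * (Q1 - Q0))‖
      < g0 + 16 * (t - p) * (g1 - g0) := by
  refine disc_barrier (z := fun t => Q t - (Q0 + 16 * ((t : ℂ) - p) * (Q1 - Q0)))
    (r := fun t => 1 - (m t + κ) * (Q0 + 16 * ((t : ℂ) - p) * (Q1 - Q0)) - 16 * (Q1 - Q0))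
    (p := fun t => m t + κ)
    (e := fun t => g0 + 16 * (t - p) * (g1 - g0)) (e' := fun _ => 16 * (g1 - g0)) ?_ ?_ ?_ ?_ ?_
  · intro t ht
    refine ((hS.hQ t ht).sub (hasDerivAt_clerp Q0 Q1 p t)).congr_deriv ?_
    ring
  · intro t _; exact hasDerivAt_lerp g0 g1 p t
  · intro t ht
    obtain ⟨h0, h1⟩ := cell_u hb ht
    exact lerp_pos h0 h1 hg0 hg1
  · simpa using hi
  · intro t ht hz
    have htI : t ∈ Icc p b := ⟨ht.1.le, ht.2⟩
    obtain ⟨hu0, hu1⟩ := cell_u hb htI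
    have hmt := hm t htI
    set u := 16 * (t - p) with hu
    have hc : (16 * ((t : ℂ) - p)) = ((u : ℝ) : ℂ) := by rw [hu]; push_cast; ring
    have hEt : e0 + u * (e1 - e0) ≤ E := lerp_le hu0 hu1 hE0 hE1
    have hpos : 0 < g0 + u * (g1 - g0) := lerp_pos hu0 hu1 hg0 hg1
    simp only [hc] at hmt ⊢
    have hQn : ‖Q0 + (u : ℂ) * (Q1 - Q0)‖ ≤ V := by
      have h := lerp_res Q0 Q1 0 u V 0 hu0 hu1 hV0 hV1 (by simp)
      have heq : (1 - (u : ℂ)) * Q0 + u * Q1 + u * (1 - u) * 0 = Q0 + (u : ℂ) * (Q1 - Q0) := by ring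
      rw [heq] at h; linarith
    have hE : 0 ≤ E := (norm_nonneg _).trans (hmt.le.trans hEt)
    have hdk0 : 0 ≤ dk := (abs_nonneg _).trans hdk
    have hres : ‖1 - (m t + κ) * (Q0 + (u : ℂ) * (Q1 - Q0)) - 16 * (Q1 - Q0)‖
        ≤ r + (‖M1 - M0‖ ^ 2 + ‖Q1 - Q0‖ ^ 2) / 8 + (E + dk) * V := by
      have heq : 1 - (m t + κ) * (Q0 + (u : ℂ) * (Q1 - Q0)) - 16 * (Q1 - Q0)
          = ((1 - (u : ℂ)) * (1 - (M0 + kc) * Q0 - 16 * (Q1 - Q0))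
            + u * (1 - (M1 + kc) * Q1 - 16 * (Q1 - Q0))
            + u * (1 - u) * ((M1 - M0) * (Q1 - Q0)))
            - ((m t - (M0 + (u : ℂ) * (M1 - M0))) + ((κ - kc : ℝ) : ℂ))
              * (Q0 + (u : ℂ) * (Q1 - Q0)) := by
        push_cast; ring
      rw [heq]
      refine (norm_sub_le _ _).trans (add_le_add ?_ ?_)
      · refine (lerp_res _ _ _ u r ((‖M1 - M0‖ ^ 2 + ‖Q1 - Q0‖ ^ 2) / 2) hu0 hu1 hr0 hr1 ?_).trans
          (by linarith)
        rw [norm_mul]; nlinarith [sq_nonneg (‖M1 - M0‖ - ‖Q1 - Q0‖)]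
      · rw [norm_mul]
        apply mul_le_mul _ hQn (norm_nonneg _) (by linarith)
        refine (norm_add_le _ _).trans (add_le_add (by linarith) ?_)
        rw [Complex.norm_real]; exact hdk
    have hmh : mu ≤ (M0 + (u : ℂ) * (M1 - M0)).re := by
      have : (M0 + (u : ℂ) * (M1 - M0)).re = M0.re + u * (M1.re - M0.re) := by
        simp [Complex.add_re]
      rw [this]; exact lerp_mem hu0 hu1 hmu0 hmu1
    have hmr := (abs_le.1 ((Complex.abs_re_le_norm (m t - (M0 + (u : ℂ) * (M1 - M0)))).trans hmt.le)).1
    rw [Complex.sub_re] at hmr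
    have hrate : mu - E + kl ≤ (m t + κ).re := by
      rw [Complex.add_re, Complex.ofReal_re]; linarith
    have hlin := lerp_lt hu0 hu1 hc0 hc1
    have := mul_le_mul_of_nonneg_right hrate hpos.le
    nlinarith

theorem cell_re {p b : ℝ} (hb : b ≤ p + 1/16) {m : ℝ → ℂ} {M0 M1 : ℂ} {e0 e1 mu E : ℝ} (hE0 : e0 ≤ E) (hE1 : e1 ≤ E)
    (hmu0 : mu ≤ M0.re) (hmu1 : mu ≤ M1.re)
    (hm : ∀ t ∈ Icc p b, ‖m t - (M0 + 16 * ((t : ℂ) - p) * (M1 - M0))‖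
      < e0 + 16 * (t - p) * (e1 - e0)) :
    ∀ t ∈ Icc p b, mu - E ≤ (m t).re := by
  intro t htI
  obtain ⟨hu0, hu1⟩ := cell_u hb htI
  have hmt := hm t htI
  set u := 16 * (t - p) with hu
  have hc : (16 * ((t : ℂ) - p)) = ((u : ℝ) : ℂ) := by rw [hu]; push_cast; ring
  have hEt : e0 + u * (e1 - e0) ≤ E := lerp_le hu0 hu1 hE0 hE1
  simp only [hc] at hmt
  have hmh : mu ≤ (M0 + (u : ℂ) * (M1 - M0)).re := by
    have : (M0 + (u : ℂ) * (M1 - M0)).re = M0.re + u * (M1.re - M0.re) := by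
      simp [Complex.add_re]
    rw [this]; exact lerp_mem hu0 hu1 hmu0 hmu1
  have hmr := (abs_le.1 ((Complex.abs_re_le_norm (m t - (M0 + (u : ℂ) * (M1 - M0)))).trans hmt.le)).1
  rw [Complex.sub_re] at hmr
  linarith

/-- cell lemma for the scalar comparison -/
theorem cell_N {p b : ℝ} (hb : b ≤ p + 1/16) {N S μ : ℝ → ℝ}
    (hN : ∀ t ∈ Icc p b, HasDerivAt N (S t - μ t * N t) t)
    {n0 n1 s rate : ℝ} (hn0 : 0 < n0) (hn1 : 0 < n1)
    (hS : ∀ t ∈ Icc p b, S t ≤ s) (hr : ∀ t ∈ Icc p b, rate ≤ μ t)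
    (hc0 : s - rate * n0 < 16 * (n1 - n0)) (hc1 : s - rate * n1 < 16 * (n1 - n0))
    (hi : N p < n0) :
    ∀ t ∈ Icc p b, N t < n0 + 16 * (t - p) * (n1 - n0) := by
  refine upper_barrier (e := fun t => n0 + 16 * (t - p) * (n1 - n0))
    (e' := fun _ => 16 * (n1 - n0)) hN (fun t _ => hasDerivAt_lerp n0 n1 p t) (by simpa using hi) ?_
  intro t ht hz
  have htI : t ∈ Icc p b := ⟨ht.1.le, ht.2⟩
  obtain ⟨hu0, hu1⟩ := cell_u hb htI
  have h1 := hS t htI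
  have h2 := hr t htI
  simp only [hz]
  set u := 16 * (t - p) with hu
  have hlin := lerp_lt hu0 hu1 hc0 hc1
  have hpos : 0 < n0 + u * (n1 - n0) := lerp_pos hu0 hu1 hn0 hn1
  have := mul_le_mul_of_nonneg_right h2 hpos.le
  nlinarith

end Part3

section Part4

open Set

/-- One row of the numerical enclosure; all entries are scaled by `10000`. -/
structure Row where
  a : ℤ
  b : ℤ
  c : ℤ
  d : ℤ
  e : ℤ
  g : ℤ
  n0 : ℤ
  n1 : ℤ
  V : ℤ
  r : ℤ
  rq : ℤ

def okM (K p : ℤ) (x y : Row) : Bool :=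
  decide ((K*K - (x.a*x.a - x.b*x.b) - 160000*(y.a - x.a))^2
      + (6250000*p - 2*x.a*x.b - 160000*(y.b - x.b))^2 ≤ (10000*x.r)^2) &&
  decide ((K*K - (y.a*y.a - y.b*y.b) - 160000*(y.a - x.a))^2
      + (6250000*(p+1) - 2*y.a*y.b - 160000*(y.b - x.b))^2 ≤ (10000*x.r)^2) &&
  decide (0 ≤ x.r) && decide (0 < x.e) && decide (0 < y.e) &&
  decide (40000*x.r + ((y.a - x.a)^2 + (y.b - x.b)^2) + 4*(1000*(2*K+1000)+10000)
    - 4*(2 * min x.a y.a - max x.e y.e)*x.e < 640000*(y.e - x.e)) &&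
  decide (40000*x.r + ((y.a - x.a)^2 + (y.b - x.b)^2) + 4*(1000*(2*K+1000)+10000)
    - 4*(2 * min x.a y.a - max x.e y.e)*y.e < 640000*(y.e - x.e))

def okQ (K : ℤ) (x y : Row) : Bool :=
  decide ((100000000 - ((x.a+K)*x.c - x.b*x.d) - 160000*(y.c - x.c))^2
      + (-((x.a+K)*x.d + x.b*x.c) - 160000*(y.d - x.d))^2 ≤ (10000*x.rq)^2) &&
  decide ((100000000 - ((y.a+K)*y.c - y.b*y.d) - 160000*(y.c - x.c))^2
      + (-((y.a+K)*y.d + y.b*y.c) - 160000*(y.d - x.d))^2 ≤ (10000*x.rq)^2) &&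
  decide (0 ≤ x.rq) && decide (0 < x.g) && decide (0 < y.g) &&
  decide (0 ≤ x.V) && decide (0 ≤ y.V) && decide (x.c^2 + x.d^2 ≤ x.V^2) &&
  decide (y.c^2 + y.d^2 ≤ y.V^2) &&
  decide (80000*x.rq + ((y.a - x.a)^2 + (y.b - x.b)^2) + ((y.c - x.c)^2 + (y.d - x.d)^2)
    + 8*(max x.e y.e + 1000)*max x.V y.V
    - 8*(min x.a y.a - max x.e y.e + (K - 1000))*x.g < 1280000*(y.g - x.g)) &&
  decide (80000*x.rq + ((y.a - x.a)^2 + (y.b - x.b)^2) + ((y.c - x.c)^2 + (y.d - x.d)^2)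
    + 8*(max x.e y.e + 1000)*max x.V y.V
    - 8*(min x.a y.a - max x.e y.e + (K - 1000))*y.g < 1280000*(y.g - x.g))

def okN (x y : Row) : Bool :=
  decide (0 < x.n0) && decide (0 < y.n0) && decide (0 < x.n1) && decide (0 < y.n1) &&
  decide (100000000 - (min x.a y.a - max x.e y.e)*x.n0 < 160000*(y.n0 - x.n0)) &&
  decide (100000000 - (min x.a y.a - max x.e y.e)*y.n0 < 160000*(y.n0 - x.n0)) &&
  decide (10000*max x.n0 y.n0 - (min x.a y.a - max x.e y.e)*x.n1 < 160000*(y.n1 - x.n1)) &&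
  decide (10000*max x.n0 y.n0 - (min x.a y.a - max x.e y.e)*y.n1 < 160000*(y.n1 - x.n1))

def okG (x y : Row) : Bool :=
  decide (3000 ≤ min x.a y.a - max x.e y.e) && decide (3000 ≤ max x.n1 y.n1) &&
  decide ((max x.V y.V + max x.g y.g)^2 ≤ 100000*(min x.c y.c - max x.g y.g)) &&
  decide (4*(max x.n1 y.n1 + 6*max x.g y.g)^2
    ≤ 36*(4*(x.c^2 + x.d^2) - ((y.c - x.c)^2 + (y.d - x.d)^2))) &&
  decide (4*(max x.n1 y.n1 + 6*max x.g y.g)^2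
    ≤ 36*(4*(y.c^2 + y.d^2) - ((y.c - x.c)^2 + (y.d - x.d)^2)))

def okStart (K : ℤ) (x : Row) : Bool :=
  decide ((K*K - (x.a*x.a - x.b*x.b))^2 + (-600000000 - 2*x.a*x.b)^2 ≤ 1000000^2) &&
  decide (7100*10000 + (1000*(2*K+1000)+10000) < x.e*(15100 + x.a)) && decide (0 < x.a) &&
  decide ((100000000 - ((x.a+K)*x.c - x.b*x.d))^2 + ((x.a+K)*x.d + x.b*x.c)^2 ≤ 1000000^2) &&
  decide (2800*10000 + (x.e+1000)*x.V < x.g*23000) && decide (7350 ≤ x.n0) &&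
  decide (5834 ≤ x.n1) && decide (0 ≤ x.V) && decide (x.c^2 + x.d^2 ≤ x.V^2)

def okEnd (K : ℤ) (x : Row) : Bool :=
  decide ((x.a*x.a - x.b*x.b - K*K)^2 + (2*x.a*x.b - 600000000)^2 ≤ (10000*x.r)^2) &&
  decide (0 ≤ x.r) && decide (x.a^2 + x.b^2 ≤ 26000^2) &&
  decide (10000*x.r + x.e*(52000 + x.e) + (1000*(2*K+1000)+10000) < 70000000) &&
  decide ((100000000 - ((x.a+K)*x.c - x.b*x.d))^2 + ((x.a+K)*x.d + x.b*x.c)^2 ≤ (10000*x.rq)^2) &&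
  decide (0 ≤ x.rq) && decide (0 ≤ x.V) && decide (x.c^2 + x.d^2 ≤ x.V^2) &&
  decide (10000*x.rq + (x.e+1000)*x.V + x.g*(26000 + x.e + K + 1000) < 27000000) &&
  decide (x.n0 ≤ 7340) && decide (x.n1 ≤ 5833)

def chainOK (K : ℤ) : ℤ → List Row → Bool
  | _, [] => false
  | p, [x] => decide (p = 96) && okEnd K x
  | p, x :: y :: l => okM K p x y && okQ K x y && okN x y && okG x y && chainOK K (p+1) (y :: l)

def tableOK (K : ℤ) : List Row → Bool
  | [] => false
  | x :: l => okStart K x && chainOK K (-96) (x :: l)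

def tbl1000 : List Row := [
  ⟨17335,-17306,2884,2722,2283,1785,7350,5834,3966,289,9⟩,
  ⟨17334,-17288,2884,2722,1930,1707,7290,5753,3966,236,16⟩,
  ⟨17326,-17239,2885,2722,1631,1625,7221,5664,3967,188,15⟩,
  ⟨17308,-17167,2887,2721,1378,1541,7146,5570,3968,152,22⟩,
  ⟨17278,-17079,2891,2719,1165,1457,7069,5473,3969,133,27⟩,
  ⟨17235,-16979,2896,2717,987,1375,6992,5375,3972,99,25⟩,
  ⟨17181,-16873,2904,2714,838,1295,6917,5278,3975,77,20⟩,
  ⟨17117,-16764,2914,2712,713,1219,6846,5183,3981,70,22⟩,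
  ⟨17045,-16653,2926,2711,610,1147,6780,5092,3989,60,19⟩,
  ⟨16965,-16543,2940,2710,524,1079,6719,5005,3999,47,25⟩,
  ⟨16881,-16434,2955,2710,452,1016,6663,4922,4010,36,20⟩,
  ⟨16792,-16326,2972,2711,392,957,6613,4844,4023,28,27⟩,
  ⟨16701,-16221,2991,2714,343,902,6569,4771,4039,28,26⟩,
  ⟨16607,-16116,3010,2717,302,852,6531,4704,4055,21,20⟩,
  ⟨16513,-16014,3031,2722,268,805,6498,4642,4074,15,12⟩,
  ⟨16417,-15912,3052,2728,240,762,6470,4586,4094,7,12⟩,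
  ⟨16321,-15811,3074,2735,216,723,6448,4535,4115,11,13⟩,
  ⟨16225,-15711,3096,2743,197,687,6430,4489,4137,17,16⟩,
  ⟨16128,-15610,3118,2752,181,655,6417,4448,4159,13,8⟩,
  ⟨16032,-15510,3141,2762,168,625,6408,4412,4183,14,9⟩,
  ⟨15935,-15410,3164,2773,157,598,6403,4381,4208,8,13⟩,
  ⟨15838,-15309,3187,2785,148,574,6401,4355,4233,15,9⟩,
  ⟨15741,-15207,3210,2797,141,552,6403,4333,4258,8,15⟩,
  ⟨15644,-15105,3234,2810,135,532,6408,4316,4285,21,11⟩,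
  ⟨15547,-15003,3257,2823,131,514,6416,4303,4311,15,13⟩,
  ⟨15449,-14899,3281,2837,127,498,6427,4294,4338,13,12⟩,
  ⟨15351,-14795,3304,2851,124,484,6441,4289,4365,11,9⟩,
  ⟨15252,-14690,3328,2865,121,471,6458,4288,4392,11,8⟩,
  ⟨15153,-14584,3352,2880,119,460,6477,4290,4420,17,6⟩,
  ⟨15053,-14478,3376,2895,117,450,6498,4296,4448,16,11⟩,
  ⟨14953,-14370,3401,2910,116,442,6521,4306,4477,11,18⟩,
  ⟨14852,-14262,3425,2925,115,435,6546,4319,4505,17,9⟩,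
  ⟨14751,-14153,3450,2941,114,429,6573,4335,4534,11,14⟩,
  ⟨14649,-14043,3476,2957,113,424,6601,4354,4564,13,9⟩,
  ⟨14546,-13932,3502,2973,113,419,6631,4376,4594,14,7⟩,
  ⟨14443,-13820,3528,2989,113,415,6663,4401,4624,21,15⟩,
  ⟨14339,-13708,3554,3005,113,412,6696,4429,4655,16,10⟩,
  ⟨14234,-13594,3581,3022,113,410,6731,4459,4686,22,15⟩,
  ⟨14129,-13480,3609,3038,114,409,6767,4492,4718,25,6⟩,
  ⟨14022,-13364,3637,3055,115,408,6804,4527,4750,25,11⟩,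
  ⟨13916,-13248,3666,3072,116,407,6843,4565,4783,22,11⟩,
  ⟨13808,-13130,3695,3089,117,407,6883,4605,4817,18,13⟩,
  ⟨13700,-13012,3725,3107,118,408,6924,4647,4851,18,18⟩,
  ⟨13591,-12893,3755,3124,119,409,6966,4692,4885,20,9⟩,
  ⟨13481,-12772,3786,3142,120,410,7010,4739,4920,17,8⟩,
  ⟨13371,-12650,3818,3160,120,412,7055,4788,4957,21,13⟩,
  ⟨13259,-12528,3851,3178,121,414,7101,4839,4993,15,15⟩,
  ⟨13147,-12404,3884,3197,122,417,7148,4892,5031,14,15⟩,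
  ⟨13034,-12279,3918,3215,122,420,7197,4948,5069,24,8⟩,
  ⟨12921,-12153,3953,3234,123,423,7247,5006,5108,23,10⟩,
  ⟨12806,-12025,3989,3253,124,427,7298,5066,5148,16,12⟩,
  ⟨12691,-11896,4026,3272,125,431,7350,5128,5188,18,17⟩,
  ⟨12575,-11766,4064,3292,126,436,7404,5192,5231,20,24⟩,
  ⟨12457,-11635,4102,3311,127,442,7459,5259,5272,18,13⟩,
  ⟨12339,-11502,4142,3331,128,447,7515,5328,5316,16,13⟩,
  ⟨12220,-11368,4183,3351,129,452,7573,5399,5360,25,25⟩,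
  ⟨12101,-11232,4224,3372,131,458,7632,5473,5405,18,16⟩,
  ⟨11980,-11095,4267,3392,132,464,7692,5549,5451,19,23⟩,
  ⟨11858,-10956,4312,3413,133,471,7754,5627,5500,21,18⟩,
  ⟨11735,-10816,4357,3434,134,478,7817,5708,5548,17,20⟩,
  ⟨11611,-10674,4404,3456,135,485,7882,5792,5599,21,16⟩,
  ⟨11486,-10530,4452,3477,136,492,7948,5878,5649,26,20⟩,
  ⟨11361,-10384,4501,3499,138,500,8016,5967,5702,26,14⟩,
  ⟨11234,-10237,4552,3521,140,508,8086,6059,5755,26,22⟩,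
  ⟨11106,-10088,4605,3543,142,517,8157,6154,5811,34,17⟩,
  ⟨10976,-9936,4659,3565,144,526,8230,6252,5867,27,27⟩,
  ⟨10846,-9783,4714,3588,146,535,8305,6353,5925,25,25⟩,
  ⟨10715,-9627,4772,3610,148,545,8382,6458,5984,31,21⟩,
  ⟨10582,-9470,4831,3633,150,555,8461,6566,6045,23,20⟩,
  ⟨10448,-9310,4892,3656,151,565,8542,6678,6108,32,29⟩,
  ⟨10313,-9147,4956,3679,153,576,8625,6794,6173,25,26⟩,
  ⟨10177,-8982,5021,3703,155,587,8710,6913,6239,34,27⟩,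
  ⟨10040,-8815,5088,3726,157,599,8797,7036,6307,25,22⟩,
  ⟨9901,-8645,5158,3749,159,611,8887,7164,6377,27,25⟩,
  ⟨9761,-8472,5230,3772,161,623,8979,7296,6449,28,27⟩,
  ⟨9620,-8296,5305,3796,163,636,9074,7432,6524,32,32⟩,
  ⟨9477,-8117,5383,3819,165,650,9171,7573,6601,30,27⟩,
  ⟨9333,-7935,5463,3842,167,664,9271,7719,6679,36,29⟩,
  ⟨9188,-7750,5546,3864,170,678,9374,7870,6760,37,33⟩,
  ⟨9041,-7561,5632,3887,173,693,9480,8027,6844,37,35⟩,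
  ⟨8893,-7369,5722,3909,176,709,9589,8189,6930,38,33⟩,
  ⟨8744,-7173,5815,3930,179,725,9701,8357,7019,35,39⟩,
  ⟨8593,-6973,5911,3951,182,742,9817,8532,7110,41,42⟩,
  ⟨8441,-6769,6012,3972,185,760,9936,8713,7206,42,38⟩,
  ⟨8288,-6560,6116,3991,188,779,10058,8901,7303,42,46⟩,
  ⟨8133,-6347,6224,4010,191,799,10184,9096,7404,42,41⟩,
  ⟨7977,-6129,6337,4027,194,819,10314,9299,7509,47,47⟩,
  ⟨7820,-5906,6455,4043,198,841,10448,9510,7617,55,53⟩,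
  ⟨7661,-5677,6577,4058,202,864,10586,9729,7729,48,50⟩,
  ⟨7501,-5443,6705,4071,206,887,10729,9956,7845,54,53⟩,
  ⟨7341,-5203,6838,4081,210,912,10876,10193,7964,57,67⟩,
  ⟨7179,-4957,6976,4090,214,938,11028,10439,8087,57,63⟩,
  ⟨7016,-4704,7121,4095,219,965,11185,10695,8215,60,63⟩,
  ⟨6853,-4444,7272,4098,224,993,11347,10962,8348,67,67⟩,
  ⟨6689,-4177,7430,4097,229,1023,11514,11240,8485,67,75⟩,
  ⟨6524,-3902,7594,4092,234,1055,11687,11529,8627,75,77⟩,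
  ⟨6359,-3619,7766,4082,240,1088,11866,11830,8774,86,90⟩,
  ⟨6195,-3326,7945,4068,247,1123,12050,12144,8926,83,83⟩,
  ⟨6031,-3025,8132,4047,253,1159,12240,12471,9084,86,100⟩,
  ⟨5867,-2714,8328,4019,260,1198,12437,12812,9248,94,106⟩,
  ⟨5705,-2392,8531,3984,267,1239,12640,13167,9416,99,110⟩,
  ⟨5545,-2060,8744,3940,275,1282,12849,13537,9591,98,112⟩,
  ⟨5387,-1716,8965,3886,283,1327,13065,13922,9771,106,129⟩,
  ⟨5232,-1360,9195,3822,291,1375,13287,14323,9958,115,131⟩,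
  ⟨5080,-991,9433,3744,300,1425,13516,14740,10149,121,139⟩,
  ⟨4934,-609,9681,3653,309,1478,13751,15174,10348,127,164⟩,
  ⟨4794,-213,9937,3547,319,1535,13992,15625,10552,138,173⟩,
  ⟨4660,198,10202,3422,329,1594,14239,16092,10761,151,176⟩,
  ⟨4536,624,10474,3278,340,1656,14491,16576,10975,162,201⟩,
  ⟨4421,1065,10752,3113,352,1722,14748,17077,11194,169,214⟩,
  ⟨4319,1522,11036,2924,364,1791,15009,17593,11417,190,224⟩,
  ⟨4230,1994,11324,2708,377,1863,15273,18124,11644,195,251⟩,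
  ⟨4158,2483,11613,2464,390,1939,15539,18669,11872,213,264⟩,
  ⟨4104,2986,11900,2188,404,2018,15805,19226,12100,214,286⟩,
  ⟨4072,3504,12184,1879,418,2100,16070,19792,12329,228,314⟩,
  ⟨4064,4035,12459,1535,432,2185,16331,20364,12554,246,330⟩,
  ⟨4083,4578,12721,1153,446,2273,16587,20941,12774,263,357⟩,
  ⟨4131,5130,12965,733,461,2363,16837,21520,12986,274,384⟩,
  ⟨4212,5688,13184,275,475,2456,17078,22096,13187,292,405⟩,
  ⟨4327,6248,13373,-222,490,2550,17306,22664,13375,302,441⟩,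
  ⟨4479,6807,13524,-754,504,2645,17518,23218,13546,322,462⟩,
  ⟨4668,7359,13630,-1319,517,2739,17710,23750,13694,332,493⟩,
  ⟨4896,7899,13685,-1913,529,2832,17877,24253,13819,345,513⟩,
  ⟨5161,8422,13681,-2527,540,2922,18016,24719,13913,346,542⟩,
  ⟨5461,8920,13614,-3155,548,3008,18122,25139,13975,361,555⟩,
  ⟨5794,9390,13479,-3787,555,3088,18192,25506,14001,361,573⟩,
  ⟨6154,9824,13274,-4412,559,3160,18222,25811,13989,370,583⟩,
  ⟨6537,10221,13000,-5019,561,3224,18211,26048,13936,366,595⟩,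
  ⟨6936,10575,12659,-5596,560,3278,18158,26214,13841,360,609⟩,
  ⟨7344,10887,12257,-6134,556,3321,18064,26305,13707,347,595⟩,
  ⟨7754,11155,11799,-6622,549,3352,17929,26319,13531,342,588⟩,
  ⟨8158,11381,11296,-7052,540,3370,17755,26258,13317,318,577⟩,
  ⟨8551,11569,10756,-7420,528,3375,17545,26124,13068,302,566⟩,
  ⟨8928,11722,10192,-7721,513,3367,17303,25921,12787,286,544⟩,
  ⟨9284,11845,9614,-7955,497,3347,17033,25654,12479,275,525⟩,
  ⟨9616,11943,9032,-8123,480,3315,16739,25328,12148,250,505⟩,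
  ⟨9923,12022,8456,-8227,461,3273,16427,24950,11798,238,478⟩,
  ⟨10205,12088,7893,-8272,442,3221,16100,24527,11434,215,457⟩,
  ⟨10461,12143,7352,-8263,422,3161,15764,24065,11061,193,430⟩,
  ⟨10693,12194,6837,-8206,402,3093,15422,23572,10681,176,403⟩,
  ⟨10903,12244,6353,-8108,382,3018,15078,23054,10301,150,386⟩,
  ⟨11094,12295,5902,-7974,362,2939,14735,22516,9921,135,362⟩,
  ⟨11268,12350,5486,-7811,343,2855,14395,21964,9546,120,333⟩,
  ⟨11427,12410,5105,-7625,325,2768,14060,21403,9177,109,319⟩,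
  ⟨11574,12477,4760,-7420,308,2679,13733,20836,8816,96,295⟩,
  ⟨11712,12550,4449,-7202,292,2588,13414,20268,8466,77,271⟩,
  ⟨11842,12630,4172,-6975,276,2496,13104,19701,8128,71,265⟩,
  ⟨11966,12717,3928,-6743,262,2404,12804,19137,7804,59,245⟩,
  ⟨12086,12810,3713,-6508,248,2312,12514,18579,7493,51,237⟩,
  ⟨12204,12909,3528,-6274,235,2222,12234,18028,7198,41,218⟩,
  ⟨12320,13012,3368,-6042,223,2132,11965,17485,6918,36,195⟩,
  ⟨12436,13119,3233,-5816,212,2043,11706,16952,6655,32,190⟩,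
  ⟨12551,13230,3121,-5596,202,1956,11456,16429,6408,19,182⟩,
  ⟨12667,13343,3028,-5384,193,1872,11216,15917,6178,21,177⟩,
  ⟨12784,13457,2955,-5182,185,1790,10985,15417,5966,15,155⟩,
  ⟨12901,13573,2897,-4989,177,1710,10763,14929,5770,10,144⟩,
  ⟨13019,13689,2854,-4807,170,1632,10550,14453,5591,12,133⟩,
  ⟨13137,13805,2824,-4635,164,1557,10345,13989,5428,14,128⟩,
  ⟨13256,13921,2805,-4475,158,1485,10148,13538,5282,19,114⟩,
  ⟨13375,14035,2795,-4326,153,1415,9958,13100,5151,18,107⟩,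
  ⟨13495,14149,2793,-4188,149,1348,9776,12675,5034,16,103⟩,
  ⟨13614,14262,2798,-4061,145,1284,9601,12264,4932,17,98⟩,
  ⟨13733,14373,2808,-3945,142,1223,9433,11866,4843,17,87⟩,
  ⟨13851,14483,2822,-3839,139,1165,9271,11481,4765,15,82⟩,
  ⟨13969,14592,2839,-3743,136,1110,9115,11109,4698,17,82⟩,
  ⟨14086,14700,2857,-3656,133,1058,8965,10750,4640,20,71⟩,
  ⟨14202,14806,2878,-3578,131,1008,8821,10404,4592,31,69⟩,
  ⟨14318,14912,2898,-3508,129,961,8683,10070,4551,16,61⟩,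
  ⟨14432,15016,2919,-3446,127,916,8550,9749,4517,16,58⟩,
  ⟨14545,15119,2938,-3391,125,874,8423,9440,4487,16,57⟩,
  ⟨14657,15221,2957,-3342,123,834,8300,9143,4463,17,52⟩,
  ⟨14768,15323,2973,-3299,121,797,8182,8858,4441,20,42⟩,
  ⟨14878,15423,2988,-3261,120,762,8069,8584,4423,11,46⟩,
  ⟨14987,15523,3001,-3228,118,729,7960,8321,4408,17,42⟩,
  ⟨15095,15623,3012,-3199,117,698,7856,8069,4394,19,37⟩,
  ⟨15202,15721,3021,-3173,116,669,7756,7828,4382,19,32⟩,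
  ⟨15308,15820,3027,-3150,115,642,7659,7597,4369,21,32⟩,
  ⟨15414,15917,3031,-3129,114,616,7566,7376,4357,13,33⟩,
  ⟨15518,16014,3033,-3110,113,592,7477,7164,4345,19,36⟩,
  ⟨15622,16111,3032,-3094,112,570,7391,6962,4332,12,31⟩,
  ⟨15725,16207,3030,-3078,111,549,7308,6768,4320,12,28⟩,
  ⟨15827,16302,3025,-3064,110,530,7228,6583,4306,11,20⟩,
  ⟨15928,16397,3019,-3050,109,511,7151,6406,4292,19,18⟩,
  ⟨16029,16492,3011,-3037,108,494,7077,6237,4277,9,16⟩,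
  ⟨16129,16586,3002,-3024,107,478,7005,6075,4262,15,20⟩,
  ⟨16228,16679,2992,-3012,106,463,6936,5920,4246,13,17⟩,
  ⟨16327,16772,2980,-2999,105,449,6869,5772,4228,12,16⟩,
  ⟨16425,16864,2967,-2987,104,436,6805,5631,4211,11,13⟩,
  ⟨16522,16956,2954,-2974,103,423,6743,5496,4192,14,16⟩,
  ⟨16619,17048,2940,-2962,102,411,6683,5367,4174,10,11⟩,
  ⟨16715,17139,2925,-2949,101,400,6625,5244,4154,16,14⟩,
  ⟨16811,17230,2910,-2935,101,390,6568,5126,4134,8,12⟩,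
  ⟨16906,17320,2895,-2922,100,380,6513,5013,4114,2090,328⟩]

def tbl3000 : List Row := [
  ⟨17451,-17191,2865,2408,2398,1772,7350,5834,3743,289,8⟩,
  ⟨17450,-17173,2865,2408,2045,1674,7290,5753,3743,236,15⟩,
  ⟨17442,-17124,2866,2408,1746,1575,7221,5664,3744,189,15⟩,
  ⟨17424,-17052,2868,2407,1493,1478,7146,5570,3745,148,18⟩,
  ⟨17394,-16964,2871,2405,1280,1383,7069,5473,3746,118,21⟩,
  ⟨17352,-16865,2876,2402,1102,1292,6992,5375,3748,107,18⟩,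
  ⟨17298,-16759,2883,2400,954,1206,6917,5278,3752,79,20⟩,
  ⟨17235,-16649,2892,2397,830,1125,6846,5183,3757,67,28⟩,
  ⟨17163,-16539,2902,2395,727,1050,6779,5092,3763,57,25⟩,
  ⟨17085,-16428,2915,2394,641,980,6718,5005,3773,45,16⟩,
  ⟨17001,-16319,2929,2393,570,915,6662,4922,3783,40,20⟩,
  ⟨16914,-16211,2944,2393,511,856,6612,4844,3794,33,17⟩,
  ⟨16823,-16105,2961,2394,462,802,6568,4771,3808,26,16⟩,
  ⟨16731,-16000,2979,2396,421,753,6530,4704,3823,20,15⟩,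
  ⟨16637,-15897,2997,2399,387,708,6497,4642,3839,21,11⟩,
  ⟨16542,-15794,3016,2403,359,667,6469,4586,3857,12,20⟩,
  ⟨16447,-15693,3036,2407,336,630,6446,4535,3875,8,13⟩,
  ⟨16352,-15592,3056,2413,317,597,6428,4489,3894,9,15⟩,
  ⟨16256,-15491,3076,2419,301,567,6415,4448,3914,13,9⟩,
  ⟨16161,-15390,3097,2426,289,540,6406,4412,3935,9,11⟩,
  ⟨16065,-15289,3118,2434,279,516,6400,4381,3956,9,8⟩,
  ⟨15969,-15187,3139,2442,270,494,6398,4355,3978,8,10⟩,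
  ⟨15873,-15085,3160,2451,263,475,6400,4333,4000,10,7⟩,
  ⟨15777,-14982,3181,2460,258,458,6405,4315,4022,14,14⟩,
  ⟨15680,-14879,3203,2469,254,443,6413,4302,4045,9,11⟩,
  ⟨15583,-14775,3224,2479,251,430,6424,4293,4067,11,7⟩,
  ⟨15486,-14670,3246,2489,248,418,6438,4288,4091,13,5⟩,
  ⟨15388,-14564,3268,2499,246,407,6454,4286,4114,18,9⟩,
  ⟨15290,-14458,3290,2509,245,398,6473,4288,4138,18,11⟩,
  ⟨15191,-14350,3312,2520,245,390,6494,4294,4162,14,14⟩,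
  ⟨15092,-14242,3335,2530,245,384,6517,4303,4187,9,7⟩,
  ⟨14992,-14133,3358,2541,245,378,6542,4316,4212,15,5⟩,
  ⟨14892,-14023,3381,2552,245,373,6569,4332,4237,11,11⟩,
  ⟨14791,-13912,3404,2563,245,369,6597,4351,4262,19,6⟩,
  ⟨14689,-13801,3428,2574,246,366,6627,4373,4287,14,8⟩,
  ⟨14587,-13688,3452,2585,247,364,6659,4398,4313,17,10⟩,
  ⟨14484,-13575,3477,2596,248,362,6692,4425,4340,21,12⟩,
  ⟨14380,-13460,3502,2608,249,361,6726,4455,4367,15,14⟩,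
  ⟨14276,-13345,3527,2619,250,361,6762,4488,4394,13,11⟩,
  ⟨14171,-13229,3553,2631,251,361,6799,4523,4422,20,15⟩,
  ⟨14066,-13111,3580,2642,253,362,6838,4560,4450,17,10⟩,
  ⟨13960,-12993,3607,2654,255,363,6878,4600,4479,16,17⟩,
  ⟨13853,-12874,3634,2665,257,365,6919,4642,4507,21,8⟩,
  ⟨13745,-12753,3662,2677,259,366,6961,4686,4537,21,11⟩,
  ⟨13637,-12632,3691,2689,261,368,7005,4733,4567,16,10⟩,
  ⟨13528,-12509,3720,2701,263,370,7050,4782,4598,22,17⟩,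
  ⟨13418,-12386,3750,2712,265,373,7096,4833,4628,18,12⟩,
  ⟨13307,-12261,3781,2724,267,376,7143,4886,4661,16,18⟩,
  ⟨13196,-12135,3812,2737,269,380,7191,4941,4693,18,8⟩,
  ⟨13084,-12008,3844,2749,271,383,7241,4998,4726,19,19⟩,
  ⟨12971,-11879,3876,2761,273,387,7292,5058,4759,18,15⟩,
  ⟨12857,-11749,3910,2773,275,391,7344,5120,4794,22,13⟩,
  ⟨12743,-11618,3944,2785,277,396,7397,5184,4829,21,14⟩,
  ⟨12627,-11486,3979,2798,279,401,7452,5250,4865,15,10⟩,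
  ⟨12511,-11352,4015,2810,281,406,7508,5318,4901,22,13⟩,
  ⟨12394,-11216,4052,2823,284,411,7565,5389,4939,17,14⟩,
  ⟨12276,-11079,4090,2835,286,416,7624,5462,4977,20,21⟩,
  ⟨12157,-10941,4128,2848,289,422,7684,5538,5016,18,15⟩,
  ⟨12037,-10801,4168,2860,292,428,7745,5616,5055,22,15⟩,
  ⟨11917,-10659,4209,2873,295,434,7808,5697,5097,20,16⟩,
  ⟨11795,-10516,4251,2885,298,441,7872,5780,5138,20,26⟩,
  ⟨11672,-10371,4293,2898,301,448,7938,5866,5180,22,14⟩,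
  ⟨11549,-10224,4337,2910,304,455,8006,5955,5223,24,23⟩,
  ⟨11424,-10075,4383,2923,307,463,8075,6046,5269,33,20⟩,
  ⟨11299,-9925,4429,2935,311,471,8146,6140,5314,26,17⟩,
  ⟨11172,-9772,4477,2948,314,479,8219,6238,5361,24,14⟩,
  ⟨11045,-9617,4526,2960,317,487,8293,6339,5408,23,20⟩,
  ⟨10916,-9460,4577,2972,320,495,8369,6443,5458,21,29⟩,
  ⟨10786,-9301,4628,2984,323,504,8447,6550,5507,36,20⟩,
  ⟨10656,-9140,4682,2996,327,513,8527,6661,5559,23,16⟩,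
  ⟨10524,-8976,4737,3008,330,522,8609,6775,5612,31,20⟩,
  ⟨10391,-8809,4794,3019,334,532,8693,6893,5666,24,22⟩,
  ⟨10257,-8640,4852,3030,338,542,8780,7015,5721,33,21⟩,
  ⟨10121,-8469,4912,3041,342,552,8869,7141,5778,33,31⟩,
  ⟨9985,-8294,4975,3051,347,563,8960,7271,5837,36,18⟩,
  ⟨9848,-8117,5039,3061,352,574,9054,7406,5896,33,22⟩,
  ⟨9709,-7937,5105,3071,357,586,9150,7545,5958,35,23⟩,
  ⟨9569,-7753,5173,3080,362,598,9249,7689,6021,32,29⟩,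
  ⟨9428,-7566,5244,3088,367,611,9351,7838,6086,36,35⟩,
  ⟨9286,-7376,5316,3096,372,625,9456,7993,6152,32,32⟩,
  ⟨9143,-7182,5392,3103,377,639,9563,8153,6222,40,26⟩,
  ⟨8998,-6984,5470,3109,382,653,9674,8319,6292,48,31⟩,
  ⟨8853,-6783,5550,3114,388,668,9788,8491,6364,40,29⟩,
  ⟨8706,-6577,5633,3118,394,683,9905,8669,6439,44,30⟩,
  ⟨8559,-6367,5719,3121,400,699,10025,8854,6516,43,42⟩,
  ⟨8410,-6152,5809,3122,406,716,10149,9046,6595,49,35⟩,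
  ⟨8260,-5932,5901,3122,413,734,10277,9245,6676,49,37⟩,
  ⟨8109,-5708,5997,3120,420,752,10409,9452,6761,48,41⟩,
  ⟨7958,-5478,6096,3117,427,771,10545,9667,6847,52,43⟩,
  ⟨7806,-5243,6198,3111,434,791,10685,9890,6935,51,44⟩,
  ⟨7652,-5002,6305,3103,441,812,10829,10122,7028,57,40⟩,
  ⟨7499,-4755,6415,3092,449,834,10977,10363,7122,58,43⟩,
  ⟨7345,-4501,6529,3078,457,857,11130,10613,7219,65,50⟩,
  ⟨7190,-4241,6647,3061,466,881,11288,10873,7318,65,54⟩,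
  ⟨7036,-3973,6770,3040,475,906,11451,11143,7422,66,60⟩,
  ⟨6881,-3698,6897,3016,484,933,11619,11424,7528,67,55⟩,
  ⟨6727,-3415,7029,2987,493,960,11792,11716,7638,79,65⟩,
  ⟨6574,-3123,7165,2952,503,989,11970,12020,7750,77,70⟩,
  ⟨6422,-2823,7306,2913,514,1020,12154,12336,7866,86,69⟩,
  ⟨6271,-2514,7452,2867,525,1052,12343,12665,7985,86,70⟩,
  ⟨6122,-2195,7602,2814,536,1085,12538,13007,8107,94,79⟩,
  ⟨5975,-1865,7758,2754,548,1120,12738,13362,8233,93,86⟩,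
  ⟨5832,-1525,7918,2686,560,1157,12944,13731,8362,103,98⟩,
  ⟨5692,-1174,8082,2609,573,1196,13155,14114,8493,106,96⟩,
  ⟨5557,-811,8251,2521,586,1236,13372,14512,8628,112,102⟩,
  ⟨5427,-436,8424,2422,600,1278,13594,14924,8766,123,106⟩,
  ⟨5304,-49,8600,2311,615,1322,13821,15351,8906,128,117⟩,
  ⟨5188,352,8780,2187,630,1368,14053,15793,9049,136,125⟩,
  ⟨5082,765,8961,2048,646,1416,14289,16249,9193,141,139⟩,
  ⟨4986,1192,9144,1894,662,1466,14528,16718,9339,154,148⟩,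
  ⟨4902,1632,9326,1723,678,1518,14770,17200,9484,164,158⟩,
  ⟨4832,2086,9507,1533,695,1572,15014,17694,9630,170,164⟩,
  ⟨4778,2552,9685,1324,712,1628,15258,18198,9776,185,179⟩,
  ⟨4741,3031,9857,1095,729,1686,15501,18711,9918,195,201⟩,
  ⟨4725,3521,10022,845,746,1746,15741,19230,10058,218,208⟩,
  ⟨4730,4020,10176,572,764,1807,15977,19753,10193,214,220⟩,
  ⟨4760,4529,10316,278,781,1869,16208,20279,10320,230,232⟩,
  ⟨4817,5043,10439,-38,798,1932,16432,20804,10440,247,245⟩,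
  ⟨4901,5561,10542,-376,814,1995,16646,21324,10549,250,273⟩,
  ⟨5016,6079,10621,-733,829,2059,16848,21835,10647,260,283⟩,
  ⟨5162,6594,10671,-1109,842,2122,17034,22331,10729,276,301⟩,
  ⟨5339,7102,10690,-1499,854,2183,17201,22805,10795,277,303⟩,
  ⟨5548,7598,10673,-1900,864,2241,17345,23252,10841,283,317⟩,
  ⟨5788,8078,10618,-2308,871,2295,17463,23664,10866,291,331⟩,
  ⟨6057,8537,10523,-2717,876,2345,17552,24035,10869,294,347⟩,
  ⟨6352,8971,10386,-3121,878,2390,17609,24358,10845,299,361⟩,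
  ⟨6670,9377,10209,-3515,877,2429,17632,24627,10798,299,357⟩,
  ⟨7006,9751,9991,-3891,872,2461,17620,24838,10722,300,359⟩,
  ⟨7355,10090,9736,-4244,864,2485,17572,24988,10621,292,358⟩,
  ⟨7713,10395,9447,-4568,853,2500,17488,25073,10494,286,361⟩,
  ⟨8073,10664,9129,-4858,839,2506,17369,25091,10342,274,351⟩,
  ⟨8431,10899,8788,-5111,822,2503,17216,25045,10167,260,354⟩,
  ⟨8781,11102,8429,-5325,802,2492,17032,24936,9971,250,339⟩,
  ⟨9119,11276,8060,-5497,780,2472,16819,24766,9757,233,332⟩,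
  ⟨9442,11424,7686,-5628,757,2444,16580,24539,9527,226,321⟩,
  ⟨9748,11549,7313,-5720,733,2409,16320,24259,9285,207,312⟩,
  ⟨10034,11657,6946,-5773,707,2367,16042,23931,9032,186,288⟩,
  ⟨10300,11752,6591,-5792,681,2318,15749,23561,8775,178,273⟩,
  ⟨10547,11836,6251,-5780,655,2264,15446,23154,8514,162,263⟩,
  ⟨10774,11913,5928,-5740,629,2205,15136,22716,8252,142,249⟩,
  ⟨10983,11987,5626,-5676,603,2143,14822,22252,7992,135,231⟩,
  ⟨11175,12060,5345,-5592,579,2077,14506,21767,7736,115,214⟩,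
  ⟨11353,12134,5086,-5492,555,2009,14192,21266,7486,104,202⟩,
  ⟨11518,12210,4849,-5379,532,1940,13881,20753,7242,100,195⟩,
  ⟨11671,12290,4635,-5257,511,1870,13574,20232,7009,81,180⟩,
  ⟨11816,12374,4442,-5128,490,1800,13274,19706,6785,72,161⟩,
  ⟨11953,12463,4269,-4995,471,1730,12981,19179,6571,65,155⟩,
  ⟨12085,12556,4115,-4860,453,1661,12695,18652,6369,50,150⟩,
  ⟨12212,12654,3980,-4725,436,1593,12418,18128,6178,50,132⟩,
  ⟨12335,12756,3861,-4592,421,1526,12149,17609,6000,33,125⟩,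
  ⟨12456,12861,3757,-4461,406,1461,11889,17096,5833,32,114⟩,
  ⟨12576,12969,3667,-4334,392,1397,11638,16590,5678,27,110⟩,
  ⟨12694,13080,3590,-4212,379,1335,11396,16092,5535,18,98⟩,
  ⟨12813,13193,3524,-4095,367,1275,11162,15604,5403,12,94⟩,
  ⟨12931,13307,3468,-3984,356,1218,10937,15126,5282,7,98⟩,
  ⟨13049,13422,3420,-3878,346,1163,10720,14658,5171,10,78⟩,
  ⟨13167,13538,3380,-3779,337,1110,10511,14201,5071,10,81⟩,
  ⟨13285,13653,3347,-3687,329,1060,10310,13755,4980,17,68⟩,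
  ⟨13403,13769,3320,-3600,322,1012,10116,13321,4898,20,64⟩,
  ⟨13522,13883,3297,-3520,315,966,9930,12899,4823,8,63⟩,
  ⟨13640,13997,3278,-3445,308,922,9751,12489,4756,11,60⟩,
  ⟨13758,14110,3262,-3377,302,881,9578,12091,4696,12,56⟩,
  ⟨13875,14222,3249,-3313,297,842,9412,11706,4641,13,46⟩,
  ⟨13992,14333,3237,-3255,292,805,9252,11333,4591,13,49⟩,
  ⟨14108,14443,3228,-3202,287,770,9098,10972,4547,21,40⟩,
  ⟨14224,14552,3219,-3153,283,737,8950,10623,4506,16,39⟩,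
  ⟨14339,14659,3211,-3108,279,706,8808,10287,4469,22,43⟩,
  ⟨14453,14766,3203,-3068,276,677,8672,9963,4436,26,40⟩,
  ⟨14565,14871,3196,-3030,273,650,8541,9650,4405,19,27⟩,
  ⟨14677,14975,3188,-2996,270,624,8415,9349,4375,14,27⟩,
  ⟨14788,15079,3180,-2965,267,600,8294,9060,4348,11,26⟩,
  ⟨14898,15182,3172,-2936,264,577,8177,8782,4323,26,25⟩,
  ⟨15008,15284,3163,-2910,262,556,8065,8515,4298,12,23⟩,
  ⟨15116,15385,3154,-2886,259,536,7957,8258,4276,16,20⟩,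
  ⟨15223,15486,3144,-2863,256,517,7853,8012,4253,21,18⟩,
  ⟨15329,15585,3134,-2842,254,499,7753,7776,4231,17,18⟩,
  ⟨15434,15685,3123,-2822,252,482,7657,7550,4210,18,18⟩,
  ⟨15539,15783,3111,-2804,250,467,7565,7333,4189,15,19⟩,
  ⟨15643,15881,3099,-2786,248,453,7476,7125,4168,17,18⟩,
  ⟨15746,15979,3086,-2770,246,439,7390,6926,4147,8,14⟩,
  ⟨15848,16076,3072,-2754,243,426,7308,6736,4126,16,23⟩,
  ⟨15949,16172,3059,-2738,241,414,7229,6554,4106,14,16⟩,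
  ⟨16050,16268,3044,-2723,239,403,7152,6380,4085,18,13⟩,
  ⟨16150,16364,3030,-2709,237,392,7078,6214,4065,20,8⟩,
  ⟨16249,16458,3015,-2695,235,382,7007,6055,4044,20,4⟩,
  ⟨16348,16553,3000,-2681,234,372,6938,5903,4024,17,8⟩,
  ⟨16446,16646,2985,-2667,232,363,6872,5757,4003,16,13⟩,
  ⟨16543,16740,2970,-2653,230,355,6808,5618,3983,11,12⟩,
  ⟨16640,16833,2954,-2640,228,347,6746,5485,3962,13,8⟩,
  ⟨16736,16925,2939,-2627,226,339,6686,5358,3942,13,12⟩,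
  ⟨16832,17017,2923,-2614,225,332,6628,5236,3922,11,6⟩,
  ⟨16927,17108,2908,-2601,223,325,6571,5119,3902,13,5⟩,
  ⟨17021,17199,2893,-2588,222,318,6516,5007,3882,2094,319⟩]

def tbl5000 : List Row := [
  ⟨17685,-16963,2827,2114,2503,1757,7350,5834,3531,291,8⟩,
  ⟨17684,-16945,2827,2114,2149,1639,7284,5748,3531,226,16⟩,
  ⟨17676,-16897,2828,2113,1849,1524,7210,5655,3531,186,16⟩,
  ⟨17659,-16825,2830,2112,1596,1413,7131,5557,3532,152,29⟩,
  ⟨17629,-16737,2832,2110,1384,1309,7050,5456,3532,117,21⟩,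
  ⟨17588,-16638,2837,2108,1206,1211,6970,5355,3535,107,18⟩,
  ⟨17535,-16532,2843,2105,1058,1119,6892,5255,3538,82,16⟩,
  ⟨17473,-16422,2851,2102,935,1034,6818,5157,3543,61,22⟩,
  ⟨17403,-16312,2861,2100,832,957,6749,5063,3549,54,14⟩,
  ⟨17326,-16201,2872,2098,747,886,6685,4973,3557,41,23⟩,
  ⟨17244,-16091,2884,2096,676,822,6627,4887,3566,38,14⟩,
  ⟨17159,-15983,2898,2095,618,763,6575,4807,3576,30,15⟩,
  ⟨17070,-15876,2913,2095,570,710,6529,4732,3589,28,15⟩,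
  ⟨16980,-15770,2929,2095,530,662,6489,4662,3602,19,18⟩,
  ⟨16888,-15666,2945,2096,497,619,6455,4598,3615,17,9⟩,
  ⟨16795,-15562,2962,2098,470,580,6426,4540,3630,16,15⟩,
  ⟨16702,-15460,2980,2101,448,546,6402,4487,3647,15,11⟩,
  ⟨16608,-15357,2998,2104,430,515,6383,4439,3663,6,8⟩,
  ⟨16514,-15255,3016,2108,415,488,6368,4397,3680,18,13⟩,
  ⟨16421,-15153,3035,2112,404,464,6358,4359,3698,8,15⟩,
  ⟨16327,-15050,3053,2117,394,443,6351,4326,3716,14,7⟩,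
  ⟨16232,-14947,3072,2122,387,424,6348,4298,3734,14,10⟩,
  ⟨16138,-14844,3091,2128,381,407,6349,4275,3753,14,14⟩,
  ⟨16044,-14740,3111,2134,377,393,6353,4256,3773,10,8⟩,
  ⟨15949,-14635,3130,2140,373,380,6360,4241,3792,14,10⟩,
  ⟨15854,-14529,3150,2146,371,369,6370,4230,3812,12,16⟩,
  ⟨15758,-14423,3169,2152,369,360,6383,4223,3831,21,9⟩,
  ⟨15663,-14316,3189,2159,368,352,6398,4220,3852,16,8⟩,
  ⟨15566,-14208,3209,2166,368,345,6416,4221,3872,19,16⟩,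
  ⟨15470,-14099,3230,2172,368,339,6436,4225,3893,20,12⟩,
  ⟨15372,-13990,3250,2179,369,334,6458,4233,3913,18,7⟩,
  ⟨15275,-13879,3271,2186,370,330,6482,4244,3935,16,15⟩,
  ⟨15176,-13768,3292,2192,371,327,6508,4259,3956,12,10⟩,
  ⟨15077,-13656,3313,2199,372,324,6535,4277,3977,21,8⟩,
  ⟨14978,-13542,3335,2206,374,322,6564,4297,3999,9,5⟩,
  ⟨14878,-13428,3357,2213,375,320,6595,4320,4021,18,11⟩,
  ⟨14778,-13313,3379,2220,377,319,6627,4346,4044,19,8⟩,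
  ⟨14676,-13197,3402,2227,379,319,6660,4374,4067,20,15⟩,
  ⟨14575,-13080,3425,2233,381,319,6695,4405,4089,17,10⟩,
  ⟨14472,-12962,3449,2240,383,320,6731,4438,4113,24,5⟩,
  ⟨14369,-12844,3473,2247,386,321,6768,4474,4137,17,12⟩,
  ⟨14266,-12724,3497,2254,389,323,6807,4512,4161,14,13⟩,
  ⟨14162,-12603,3522,2260,391,325,6847,4552,4185,13,14⟩,
  ⟨14057,-12481,3548,2267,393,327,6888,4594,4211,25,20⟩,
  ⟨13951,-12357,3573,2274,396,330,6930,4638,4236,17,17⟩,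
  ⟨13845,-12233,3600,2280,399,333,6973,4685,4262,18,8⟩,
  ⟨13738,-12108,3627,2287,402,336,7017,4734,4288,16,15⟩,
  ⟨13631,-11981,3654,2294,405,339,7062,4785,4315,14,10⟩,
  ⟨13523,-11853,3682,2300,408,342,7109,4838,4342,15,14⟩,
  ⟨13414,-11724,3711,2307,411,346,7157,4893,4370,22,11⟩,
  ⟨13304,-11593,3740,2313,414,350,7206,4950,4398,28,10⟩,
  ⟨13194,-11462,3770,2319,418,354,7256,5009,4427,24,20⟩,
  ⟨13083,-11328,3800,2326,422,359,7307,5070,4456,21,19⟩,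
  ⟨12971,-11194,3832,2332,425,364,7360,5133,4486,19,21⟩,
  ⟨12858,-11058,3863,2338,428,369,7414,5198,4516,22,12⟩,
  ⟨12745,-10920,3896,2344,432,373,7469,5265,4547,15,12⟩,
  ⟨12631,-10781,3929,2350,435,378,7525,5334,4579,22,10⟩,
  ⟨12516,-10641,3963,2356,439,383,7583,5406,4611,24,14⟩,
  ⟨12401,-10499,3998,2361,443,388,7642,5480,4644,22,14⟩,
  ⟨12284,-10355,4034,2367,447,393,7702,5556,4678,22,16⟩,
  ⟨12167,-10209,4070,2372,451,399,7764,5635,4711,22,17⟩,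
  ⟨12049,-10062,4108,2377,455,405,7827,5716,4747,19,12⟩,
  ⟨11930,-9913,4146,2382,459,411,7891,5800,4782,25,13⟩,
  ⟨11811,-9762,4185,2387,463,417,7957,5886,4818,34,13⟩,
  ⟨11690,-9608,4225,2391,468,423,8024,5975,4855,22,12⟩,
  ⟨11569,-9453,4266,2395,472,429,8093,6067,4893,23,21⟩,
  ⟨11447,-9296,4309,2399,477,436,8164,6162,4932,26,16⟩,
  ⟨11324,-9137,4352,2403,482,443,8236,6260,4972,26,16⟩,
  ⟨11200,-8975,4396,2406,487,450,8310,6361,5012,23,17⟩,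
  ⟨11075,-8811,4442,2409,492,458,8386,6465,5054,32,22⟩,
  ⟨10950,-8645,4488,2411,498,466,8464,6572,5095,27,11⟩,
  ⟨10823,-8476,4536,2413,503,474,8544,6683,5138,30,25⟩,
  ⟨10696,-8304,4586,2414,509,483,8626,6797,5183,27,21⟩,
  ⟨10568,-8130,4636,2415,514,492,8709,6915,5228,25,20⟩,
  ⟨10439,-7953,4688,2416,520,501,8795,7037,5274,27,18⟩,
  ⟨10309,-7773,4741,2415,526,510,8883,7162,5321,41,16⟩,
  ⟨10178,-7591,4796,2414,533,519,8973,7292,5370,40,19⟩,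
  ⟨10047,-7404,4852,2412,540,529,9065,7426,5419,33,19⟩,
  ⟨9914,-7215,4910,2409,546,539,9160,7564,5470,33,21⟩,
  ⟨9781,-7022,4970,2406,553,550,9257,7707,5522,35,18⟩,
  ⟨9647,-6826,5031,2401,560,561,9357,7855,5575,36,21⟩,
  ⟨9513,-6626,5094,2395,567,573,9459,8007,5629,37,29⟩,
  ⟨9377,-6422,5158,2388,574,585,9564,8165,5684,39,23⟩,
  ⟨9242,-6214,5225,2380,582,597,9672,8328,5742,38,33⟩,
  ⟨9105,-6002,5293,2371,590,611,9783,8497,5800,43,35⟩,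
  ⟨8968,-5785,5364,2359,598,625,9897,8672,5860,43,28⟩,
  ⟨8831,-5564,5436,2346,606,639,10014,8853,5921,40,29⟩,
  ⟨8693,-5338,5511,2332,614,654,10134,9040,5985,43,32⟩,
  ⟨8555,-5107,5587,2315,623,669,10257,9233,6048,49,28⟩,
  ⟨8417,-4871,5666,2296,632,684,10383,9433,6114,49,32⟩,
  ⟨8278,-4629,5747,2275,642,700,10513,9640,6181,55,37⟩,
  ⟨8140,-4381,5831,2251,652,717,10646,9855,6251,60,35⟩,
  ⟨8003,-4128,5916,2224,663,735,10783,10077,6321,54,42⟩,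
  ⟨7865,-3868,6004,2195,673,754,10924,10307,6393,62,40⟩,
  ⟨7729,-3602,6095,2162,684,773,11069,10545,6468,67,39⟩,
  ⟨7593,-3328,6187,2125,696,793,11217,10792,6542,68,44⟩,
  ⟨7459,-3048,6282,2084,708,814,11369,11048,6619,66,55⟩,
  ⟨7327,-2760,6379,2040,720,836,11525,11313,6698,68,53⟩,
  ⟨7196,-2464,6479,1990,732,859,11685,11587,6778,72,57⟩,
  ⟨7068,-2160,6580,1936,745,883,11849,11870,6859,78,51⟩,
  ⟨6943,-1848,6684,1876,758,907,12016,12163,6943,80,52⟩,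
  ⟨6821,-1527,6789,1810,772,932,12187,12465,7027,84,58⟩,
  ⟨6703,-1197,6896,1738,786,958,12362,12777,7112,95,60⟩,
  ⟨6590,-857,7004,1659,801,985,12540,13099,7198,106,70⟩,
  ⟨6482,-509,7113,1572,816,1013,12721,13431,7285,104,70⟩,
  ⟨6381,-150,7223,1478,831,1042,12905,13772,7373,102,75⟩,
  ⟨6286,219,7333,1375,846,1072,13092,14123,7461,110,85⟩,
  ⟨6200,597,7442,1264,861,1103,13281,14482,7549,118,81⟩,
  ⟨6123,985,7550,1143,877,1135,13471,14850,7637,121,85⟩,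
  ⟨6056,1384,7656,1012,893,1167,13662,15225,7723,134,98⟩,
  ⟨6001,1791,7759,870,909,1201,13853,15607,7808,130,98⟩,
  ⟨5959,2208,7858,718,924,1235,14043,15994,7891,138,106⟩,
  ⟨5931,2634,7952,555,939,1269,14230,16385,7972,149,121⟩,
  ⟨5919,3068,8040,381,954,1304,14414,16778,8050,152,120⟩,
  ⟨5924,3508,8119,195,968,1339,14593,17171,8122,163,121⟩,
  ⟨5947,3954,8189,-2,982,1374,14768,17564,8190,166,136⟩,
  ⟨5990,4404,8248,-209,995,1409,14936,17954,8251,173,138⟩,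
  ⟨6054,4856,8294,-427,1007,1443,15096,18339,8305,184,150⟩,
  ⟨6140,5309,8325,-654,1018,1477,15246,18715,8351,187,162⟩,
  ⟨6248,5759,8341,-888,1028,1510,15384,19079,8389,193,163⟩,
  ⟨6379,6205,8338,-1129,1036,1541,15508,19427,8415,200,173⟩,
  ⟨6533,6644,8317,-1373,1042,1570,15616,19755,8430,204,169⟩,
  ⟨6709,7072,8275,-1620,1046,1596,15706,20060,8433,212,174⟩,
  ⟨6908,7488,8212,-1867,1048,1619,15776,20337,8422,211,180⟩,
  ⟨7126,7888,8128,-2110,1047,1639,15824,20582,8398,209,186⟩,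
  ⟨7362,8269,8022,-2347,1044,1656,15848,20791,8359,214,195⟩,
  ⟨7615,8631,7896,-2576,1038,1669,15848,20961,8306,210,188⟩,
  ⟨7880,8970,7750,-2792,1029,1677,15823,21090,8238,214,187⟩,
  ⟨8156,9285,7586,-2994,1018,1680,15773,21176,8156,203,188⟩,
  ⟨8438,9576,7405,-3180,1004,1678,15698,21218,8059,196,187⟩,
  ⟨8723,9843,7212,-3346,988,1672,15599,21214,7951,190,187⟩,
  ⟨9009,10086,7008,-3492,970,1661,15476,21166,7830,185,187⟩,
  ⟨9292,10306,6795,-3618,950,1646,15331,21075,7699,173,180⟩,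
  ⟨9569,10505,6579,-3722,928,1626,15166,20942,7559,168,177⟩,
  ⟨9839,10684,6360,-3804,905,1602,14982,20769,7411,159,169⟩,
  ⟨10098,10847,6142,-3866,881,1574,14782,20558,7258,146,161⟩,
  ⟨10347,10994,5927,-3908,856,1543,14568,20312,7100,138,159⟩,
  ⟨10583,11129,5718,-3931,831,1509,14343,20035,6939,133,144⟩,
  ⟨10807,11253,5517,-3938,806,1472,14109,19729,6779,120,138⟩,
  ⟨11019,11370,5325,-3930,781,1432,13868,19399,6619,111,141⟩,
  ⟨11218,11481,5143,-3908,757,1391,13622,19047,6460,94,123⟩,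
  ⟨11406,11588,4972,-3876,733,1348,13373,18678,6305,88,116⟩,
  ⟨11583,11693,4812,-3834,710,1305,13123,18294,6153,83,109⟩,
  ⟨11751,11796,4664,-3785,688,1261,12874,17898,6007,69,107⟩,
  ⟨11910,11900,4527,-3730,667,1217,12626,17494,5866,61,97⟩,
  ⟨12061,12004,4402,-3671,647,1173,12382,17083,5732,60,96⟩,
  ⟨12205,12109,4287,-3608,628,1130,12141,16668,5604,47,82⟩,
  ⟨12344,12215,4183,-3544,610,1087,11905,16251,5483,41,81⟩,
  ⟨12478,12323,4089,-3479,593,1045,11674,15834,5369,39,74⟩,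
  ⟨12609,12433,4004,-3414,577,1004,11449,15419,5262,35,66⟩,
  ⟨12736,12545,3927,-3350,562,964,11230,15007,5162,22,64⟩,
  ⟨12861,12658,3858,-3287,548,925,11017,14599,5069,18,67⟩,
  ⟨12984,12772,3795,-3226,534,888,10811,14196,4981,20,56⟩,
  ⟨13105,12887,3739,-3168,522,852,10611,13799,4901,21,57⟩,
  ⟨13226,13003,3689,-3112,511,818,10417,13408,4827,12,44⟩,
  ⟨13345,13119,3643,-3059,500,785,10230,13025,4757,15,51⟩,
  ⟨13463,13235,3601,-3008,490,754,10049,12649,4693,9,43⟩,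
  ⟨13581,13351,3564,-2960,481,724,9874,12282,4633,27,38⟩,
  ⟨13699,13468,3530,-2915,473,696,9705,11923,4579,20,34⟩,
  ⟨13815,13583,3498,-2873,465,669,9542,11573,4527,10,33⟩,
  ⟨13931,13698,3469,-2833,457,643,9385,11233,4479,11,25⟩,
  ⟨14047,13812,3442,-2796,450,618,9233,10902,4435,19,33⟩,
  ⟨14162,13926,3417,-2762,444,595,9086,10580,4394,17,25⟩,
  ⟨14277,14038,3393,-2730,438,573,8945,10268,4355,18,35⟩,
  ⟨14390,14150,3370,-2699,433,553,8809,9966,4318,18,19⟩,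
  ⟨14503,14260,3348,-2671,428,534,8678,9673,4283,14,27⟩,
  ⟨14615,14370,3328,-2645,423,516,8551,9390,4252,20,28⟩,
  ⟨14727,14478,3307,-2620,418,499,8429,9116,4220,14,19⟩,
  ⟨14837,14586,3288,-2597,413,483,8311,8852,4190,17,21⟩,
  ⟨14947,14693,3269,-2576,409,468,8198,8597,4162,15,22⟩,
  ⟨15056,14799,3250,-2555,405,454,8089,8351,4135,12,12⟩,
  ⟨15164,14904,3231,-2536,401,440,7984,8114,4108,12,13⟩,
  ⟨15271,15008,3213,-2518,397,427,7882,7886,4083,15,11⟩,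
  ⟨15377,15112,3195,-2501,393,415,7784,7666,4058,13,19⟩,
  ⟨15482,15215,3177,-2484,389,404,7689,7455,4033,16,14⟩,
  ⟨15587,15317,3159,-2469,386,394,7598,7252,4010,21,8⟩,
  ⟨15690,15418,3141,-2454,383,384,7510,7057,3986,12,12⟩,
  ⟨15793,15519,3123,-2440,380,375,7425,6870,3964,13,10⟩,
  ⟨15895,15619,3106,-2426,377,366,7343,6690,3942,18,16⟩,
  ⟨15997,15718,3089,-2412,374,358,7264,6517,3920,16,15⟩,
  ⟨16098,15817,3071,-2399,371,350,7188,6351,3897,9,13⟩,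
  ⟨16198,15915,3054,-2387,368,343,7114,6192,3877,11,8⟩,
  ⟨16297,16013,3037,-2375,365,336,7043,6040,3856,16,5⟩,
  ⟨16395,16110,3020,-2363,362,329,6974,5894,3835,13,14⟩,
  ⟨16493,16207,3004,-2351,359,323,6907,5754,3815,18,15⟩,
  ⟨16591,16303,2987,-2339,357,317,6843,5620,3794,19,8⟩,
  ⟨16687,16398,2971,-2328,355,311,6781,5491,3775,23,5⟩,
  ⟨16784,16493,2955,-2317,353,305,6721,5367,3756,14,6⟩,
  ⟨16879,16587,2939,-2306,351,299,6662,5249,3736,10,11⟩,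
  ⟨16974,16681,2923,-2296,348,294,6605,5135,3717,13,13⟩,
  ⟨17068,16774,2907,-2285,346,289,6550,5026,3698,11,11⟩,
  ⟨17162,16867,2892,-2275,344,285,6497,4922,3680,12,15⟩,
  ⟨17255,16959,2876,-2265,342,281,6445,4822,3661,2095,292⟩]

def tbl7000 : List Row := [
  ⟨18042,-16628,2771,1840,2597,1739,7350,5834,3327,290,8⟩,
  ⟨18040,-16610,2771,1840,2241,1600,7274,5740,3327,228,16⟩,
  ⟨18033,-16562,2772,1840,1940,1469,7190,5639,3328,189,18⟩,
  ⟨18016,-16490,2773,1838,1687,1346,7102,5533,3327,153,18⟩,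
  ⟨17987,-16402,2776,1836,1475,1232,7013,5425,3329,120,16⟩,
  ⟨17947,-16303,2780,1834,1298,1127,6926,5317,3331,93,21⟩,
  ⟨17896,-16198,2785,1831,1150,1031,6842,5210,3333,79,13⟩,
  ⟨17836,-16088,2792,1828,1028,943,6762,5106,3338,59,20⟩,
  ⟨17768,-15978,2801,1825,926,864,6688,5005,3344,48,14⟩,
  ⟨17694,-15867,2811,1822,842,793,6620,4909,3350,44,11⟩,
  ⟨17615,-15756,2822,1820,773,729,6558,4818,3358,29,13⟩,
  ⟨17532,-15647,2834,1818,716,672,6502,4733,3367,25,11⟩,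
  ⟨17446,-15539,2847,1817,669,621,6453,4653,3378,19,10⟩,
  ⟨17358,-15432,2861,1816,630,576,6410,4579,3389,16,15⟩,
  ⟨17269,-15326,2876,1816,599,536,6373,4511,3402,21,12⟩,
  ⟨17179,-15222,2891,1816,574,501,6341,4449,3415,18,13⟩,
  ⟨17089,-15117,2906,1817,553,470,6315,4392,3428,6,9⟩,
  ⟨16998,-15013,2922,1818,536,442,6294,4341,3442,2,9⟩,
  ⟨16907,-14909,2938,1820,522,418,6277,4295,3457,5,10⟩,
  ⟨16816,-14805,2955,1822,511,397,6265,4255,3472,12,11⟩,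
  ⟨16725,-14701,2972,1824,503,379,6257,4220,3488,13,17⟩,
  ⟨16633,-14596,2988,1827,497,363,6252,4189,3503,15,5⟩,
  ⟨16542,-14491,3005,1830,492,349,6251,4163,3519,9,15⟩,
  ⟨16450,-14385,3023,1833,488,337,6253,4141,3536,12,7⟩,
  ⟨16358,-14278,3040,1836,485,326,6258,4124,3552,15,11⟩,
  ⟨16266,-14171,3057,1839,484,317,6266,4111,3568,22,13⟩,
  ⟨16173,-14062,3075,1843,484,310,6277,4102,3586,21,8⟩,
  ⟨16081,-13953,3093,1846,484,304,6291,4096,3602,24,9⟩,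
  ⟨15987,-13844,3111,1849,485,299,6307,4094,3619,15,10⟩,
  ⟨15894,-13733,3129,1853,485,295,6325,4096,3637,13,12⟩,
  ⟨15800,-13621,3147,1856,486,291,6345,4101,3654,16,12⟩,
  ⟨15705,-13509,3166,1860,487,288,6367,4109,3672,18,8⟩,
  ⟨15610,-13395,3185,1863,489,286,6391,4121,3690,18,8⟩,
  ⟨15515,-13281,3204,1866,491,284,6416,4136,3708,13,16⟩,
  ⟨15419,-13166,3223,1870,493,283,6443,4153,3727,13,9⟩,
  ⟨15322,-13050,3243,1873,495,282,6471,4173,3746,10,5⟩,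
  ⟨15225,-12933,3263,1876,497,282,6501,4196,3764,16,8⟩,
  ⟨15128,-12815,3283,1879,500,282,6532,4221,3783,11,9⟩,
  ⟨15030,-12696,3304,1882,503,283,6564,4249,3803,15,5⟩,
  ⟨14931,-12576,3325,1885,506,284,6598,4279,3823,11,8⟩,
  ⟨14832,-12455,3346,1888,509,285,6633,4311,3842,22,9⟩,
  ⟨14733,-12332,3368,1891,513,287,6669,4345,3863,15,13⟩,
  ⟨14633,-12209,3390,1893,516,289,6706,4381,3883,16,13⟩,
  ⟨14532,-12085,3412,1896,519,291,6744,4419,3904,18,10⟩,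
  ⟨14431,-11959,3435,1899,523,293,6783,4459,3925,21,9⟩,
  ⟨14329,-11833,3458,1901,527,295,6823,4501,3947,13,11⟩,
  ⟨14227,-11705,3482,1903,530,298,6864,4545,3969,12,6⟩,
  ⟨14124,-11576,3506,1905,533,301,6906,4591,3991,22,14⟩,
  ⟨14021,-11445,3530,1907,537,304,6949,4639,4013,21,6⟩,
  ⟨13917,-11314,3555,1909,541,307,6994,4689,4036,17,13⟩,
  ⟨13812,-11181,3581,1911,545,311,7040,4741,4060,16,9⟩,
  ⟨13707,-11047,3607,1913,549,314,7087,4795,4083,18,12⟩,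
  ⟨13602,-10911,3633,1914,553,318,7135,4850,4107,19,7⟩,
  ⟨13495,-10774,3660,1915,557,322,7184,4907,4131,22,13⟩,
  ⟨13389,-10635,3687,1916,561,326,7234,4966,4156,17,20⟩,
  ⟨13281,-10495,3716,1917,565,331,7285,5027,4182,24,16⟩,
  ⟨13173,-10354,3744,1918,570,335,7337,5090,4207,24,9⟩,
  ⟨13065,-10211,3773,1918,575,339,7390,5155,4233,22,10⟩,
  ⟨12955,-10066,3803,1918,580,343,7444,5222,4260,23,12⟩,
  ⟨12845,-9919,3833,1918,585,348,7499,5291,4287,22,11⟩,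
  ⟨12735,-9771,3864,1918,590,353,7555,5362,4314,17,14⟩,
  ⟨12624,-9621,3896,1917,595,358,7613,5435,4343,22,10⟩,
  ⟨12513,-9469,3928,1916,600,363,7672,5510,4371,24,11⟩,
  ⟨12400,-9315,3961,1915,605,368,7732,5588,4400,23,14⟩,
  ⟨12288,-9159,3995,1913,610,373,7793,5668,4430,24,13⟩,
  ⟨12174,-9001,4029,1911,615,378,7856,5750,4460,21,12⟩,
  ⟨12060,-8841,4064,1908,620,384,7920,5834,4490,24,10⟩,
  ⟨11946,-8679,4100,1905,626,390,7985,5921,4521,26,20⟩,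
  ⟨11831,-8515,4136,1902,632,396,8052,6010,4553,26,17⟩,
  ⟨11715,-8348,4174,1898,638,402,8120,6102,4586,22,14⟩,
  ⟨11599,-8179,4212,1893,644,408,8190,6197,4618,29,10⟩,
  ⟨11482,-8008,4251,1888,650,414,8261,6294,4652,24,18⟩,
  ⟨11365,-7834,4291,1883,656,421,8334,6394,4686,27,20⟩,
  ⟨11247,-7657,4332,1876,663,428,8408,6497,4721,32,20⟩,
  ⟨11129,-7478,4373,1869,670,435,8484,6603,4756,36,17⟩,
  ⟨11010,-7295,4416,1861,677,442,8562,6712,4793,28,24⟩,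
  ⟨10891,-7110,4459,1853,684,450,8641,6824,4829,31,22⟩,
  ⟨10772,-6922,4504,1843,691,458,8722,6940,4867,36,22⟩,
  ⟨10652,-6730,4549,1833,699,466,8805,7059,4905,39,16⟩,
  ⟨10532,-6536,4596,1822,707,474,8890,7182,4944,31,18⟩,
  ⟨10412,-6338,4643,1809,714,483,8977,7308,4983,34,19⟩,
  ⟨10292,-6136,4692,1796,722,492,9066,7438,5024,36,20⟩,
  ⟨10171,-5931,4741,1781,730,501,9157,7572,5065,35,17⟩,
  ⟨10051,-5722,4792,1765,738,510,9250,7710,5107,35,25⟩,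
  ⟨9930,-5509,4844,1747,746,520,9345,7852,5150,48,28⟩,
  ⟨9810,-5291,4897,1729,755,530,9442,7998,5194,40,24⟩,
  ⟨9690,-5070,4951,1708,764,540,9541,8149,5238,41,19⟩,
  ⟨9570,-4844,5006,1686,773,550,9642,8304,5283,42,18⟩,
  ⟨9451,-4614,5062,1662,783,561,9745,8464,5328,41,19⟩,
  ⟨9332,-4379,5119,1636,793,572,9850,8628,5375,47,21⟩,
  ⟨9215,-4139,5177,1608,803,583,9958,8797,5421,43,25⟩,
  ⟨9098,-3894,5236,1578,813,595,10068,8971,5469,49,33⟩,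
  ⟨8982,-3644,5297,1545,823,608,10180,9150,5518,53,24⟩,
  ⟨8868,-3388,5358,1510,834,621,10294,9334,5567,54,35⟩,
  ⟨8755,-3127,5420,1473,845,635,10411,9524,5617,54,32⟩,
  ⟨8645,-2860,5483,1432,856,649,10530,9719,5667,56,39⟩,
  ⟨8536,-2587,5546,1389,867,663,10651,9919,5718,57,33⟩,
  ⟨8430,-2308,5611,1342,878,677,10774,10125,5770,64,33⟩,
  ⟨8327,-2023,5676,1292,890,692,10899,10336,5822,60,33⟩,
  ⟨8227,-1731,5741,1238,902,707,11026,10552,5873,70,37⟩,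
  ⟨8131,-1432,5806,1180,914,722,11154,10774,5925,68,39⟩,
  ⟨8039,-1127,5871,1118,926,738,11284,11001,5977,71,51⟩,
  ⟨7952,-815,5936,1053,938,755,11415,11233,6029,74,46⟩,
  ⟨7870,-496,6001,982,950,772,11547,11469,6081,91,40⟩,
  ⟨7793,-171,6065,907,963,788,11680,11710,6133,80,43⟩,
  ⟨7723,162,6128,827,975,805,11813,11955,6184,86,46⟩,
  ⟨7661,501,6189,742,988,822,11946,12204,6234,84,47⟩,
  ⟨7606,847,6248,652,1000,839,12078,12456,6282,99,53⟩,
  ⟨7559,1199,6305,557,1013,857,12209,12710,6330,97,55⟩,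
  ⟨7522,1558,6359,456,1025,875,12339,12966,6376,96,57⟩,
  ⟨7495,1922,6409,350,1036,893,12466,13222,6419,99,67⟩,
  ⟨7479,2291,6456,239,1047,911,12590,13478,6461,110,70⟩,
  ⟨7474,2665,6497,122,1058,929,12711,13732,6499,109,66⟩,
  ⟨7482,3043,6534,0,1068,946,12828,13984,6534,111,65⟩,
  ⟨7503,3424,6564,-126,1077,963,12940,14233,6566,119,71⟩,
  ⟨7538,3807,6588,-257,1085,979,13046,14478,6594,118,74⟩,
  ⟨7587,4190,6605,-393,1092,995,13146,14717,6617,134,79⟩,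
  ⟨7650,4574,6613,-532,1099,1010,13238,14948,6635,125,80⟩,
  ⟨7729,4956,6613,-673,1104,1024,13322,15170,6648,128,82⟩,
  ⟨7823,5335,6604,-817,1108,1037,13396,15380,6655,131,80⟩,
  ⟨7932,5709,6585,-962,1110,1048,13459,15576,6655,131,83⟩,
  ⟨8056,6077,6556,-1107,1110,1058,13511,15757,6649,134,85⟩,
  ⟨8195,6438,6517,-1251,1109,1066,13550,15920,6636,133,95⟩,
  ⟨8347,6789,6467,-1393,1106,1073,13575,16064,6616,137,94⟩,
  ⟨8512,7130,6408,-1532,1102,1078,13586,16187,6589,136,94⟩,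
  ⟨8689,7459,6338,-1667,1096,1081,13582,16287,6554,133,100⟩,
  ⟨8876,7775,6260,-1796,1088,1082,13564,16363,6513,135,92⟩,
  ⟨9072,8077,6172,-1919,1079,1080,13531,16415,6464,134,102⟩,
  ⟨9275,8365,6076,-2033,1068,1077,13483,16441,6408,136,102⟩,
  ⟨9483,8637,5974,-2140,1056,1072,13420,16441,6346,128,95⟩,
  ⟨9695,8895,5865,-2237,1042,1064,13343,16416,6278,123,88⟩,
  ⟨9909,9138,5751,-2325,1027,1054,13252,16365,6204,118,90⟩,
  ⟨10123,9366,5634,-2403,1010,1042,13148,16290,6126,114,93⟩,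
  ⟨10337,9580,5514,-2470,992,1028,13031,16190,6042,109,90⟩,
  ⟨10547,9781,5394,-2528,974,1012,12903,16067,5958,100,89⟩,
  ⟨10754,9970,5273,-2575,955,995,12765,15921,5869,95,90⟩,
  ⟨10956,10148,5153,-2614,935,977,12618,15754,5779,89,74⟩,
  ⟨11153,10316,5035,-2643,915,956,12463,15568,5687,85,81⟩,
  ⟨11344,10475,4920,-2663,895,935,12301,15364,5595,85,70⟩,
  ⟨11529,10627,4808,-2676,876,912,12134,15144,5503,75,69⟩,
  ⟨11707,10772,4701,-2682,856,889,11963,14910,5413,74,62⟩,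
  ⟨11878,10912,4598,-2682,837,865,11789,14664,5324,68,62⟩,
  ⟨12044,11048,4500,-2677,818,841,11613,14407,5237,62,56⟩,
  ⟨12203,11180,4407,-2667,800,817,11436,14141,5152,51,55⟩,
  ⟨12357,11309,4319,-2653,782,793,11259,13868,5069,48,53⟩,
  ⟨12506,11436,4237,-2636,765,769,11083,13589,4991,43,53⟩,
  ⟨12650,11562,4160,-2616,749,745,10908,13306,4915,45,50⟩,
  ⟨12789,11686,4087,-2594,734,722,10735,13020,4841,37,45⟩,
  ⟨12925,11810,4019,-2571,719,699,10565,12732,4771,31,40⟩,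
  ⟨13057,11933,3956,-2548,705,676,10397,12444,4706,30,37⟩,
  ⟨13186,12055,3897,-2523,692,654,10233,12156,4643,28,45⟩,
  ⟨13313,12177,3843,-2498,679,633,10072,11869,4584,21,43⟩,
  ⟨13437,12299,3791,-2474,667,613,9915,11584,4527,20,39⟩,
  ⟨13559,12421,3744,-2449,655,594,9761,11302,4474,21,30⟩,
  ⟨13680,12542,3699,-2426,644,575,9611,11024,4424,14,31⟩,
  ⟨13799,12663,3657,-2402,634,557,9465,10749,4376,16,28⟩,
  ⟨13917,12783,3618,-2380,624,539,9323,10479,4331,17,22⟩,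
  ⟨14033,12903,3581,-2358,615,522,9185,10214,4288,19,21⟩,
  ⟨14149,13022,3546,-2337,607,506,9051,9954,4247,19,17⟩,
  ⟨14263,13140,3513,-2317,599,490,8921,9699,4209,20,20⟩,
  ⟨14377,13258,3482,-2298,591,475,8795,9450,4172,17,14⟩,
  ⟨14489,13375,3452,-2280,584,461,8673,9207,4137,12,18⟩,
  ⟨14601,13491,3423,-2263,577,448,8555,8970,4104,19,21⟩,
  ⟨14712,13607,3396,-2247,571,436,8441,8739,4073,18,22⟩,
  ⟨14822,13721,3369,-2231,565,425,8330,8515,4041,23,15⟩,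
  ⟨14932,13835,3344,-2216,559,414,8223,8297,4012,23,14⟩,
  ⟨15040,13947,3319,-2202,554,403,8119,8085,3984,14,19⟩,
  ⟨15148,14059,3296,-2188,548,393,8019,7880,3957,10,21⟩,
  ⟨15255,14170,3272,-2175,542,384,7922,7681,3929,22,17⟩,
  ⟨15362,14280,3250,-2163,537,375,7828,7488,3904,15,7⟩,
  ⟨15467,14389,3228,-2151,532,366,7737,7301,3880,13,14⟩,
  ⟨15572,14497,3207,-2139,527,358,7649,7120,3855,19,6⟩,
  ⟨15676,14605,3186,-2128,523,350,7563,6946,3832,17,14⟩,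
  ⟨15779,14711,3165,-2118,519,343,7480,6777,3809,13,16⟩,
  ⟨15881,14817,3145,-2107,514,336,7400,6614,3786,12,10⟩,
  ⟨15983,14922,3125,-2097,510,329,7322,6457,3764,13,15⟩,
  ⟨16084,15026,3106,-2088,506,323,7247,6305,3743,12,14⟩,
  ⟨16184,15130,3087,-2078,502,317,7174,6159,3722,16,9⟩,
  ⟨16284,15233,3068,-2069,498,311,7103,6018,3701,9,8⟩,
  ⟨16383,15335,3050,-2060,494,305,7035,5882,3681,16,13⟩,
  ⟨16481,15437,3032,-2052,491,300,6969,5751,3662,17,12⟩,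
  ⟨16579,15537,3014,-2043,488,295,6905,5625,3642,20,11⟩,
  ⟨16675,15637,2997,-2035,485,290,6842,5504,3623,22,7⟩,
  ⟨16772,15737,2980,-2027,482,285,6781,5387,3605,16,4⟩,
  ⟨16867,15836,2963,-2019,479,280,6722,5274,3586,22,9⟩,
  ⟨16963,15934,2946,-2011,476,276,6665,5166,3567,11,9⟩,
  ⟨17057,16032,2930,-2003,472,272,6609,5062,3550,8,11⟩,
  ⟨17151,16129,2914,-1996,468,268,6555,4961,3533,14,12⟩,
  ⟨17244,16226,2898,-1988,465,264,6503,4864,3515,8,11⟩,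
  ⟨17337,16322,2882,-1981,462,260,6452,4771,3498,17,9⟩,
  ⟨17430,16417,2867,-1974,459,256,6402,4681,3481,16,17⟩,
  ⟨17521,16512,2852,-1966,456,253,6354,4594,3464,18,5⟩,
  ⟨17613,16606,2837,-1959,454,249,6307,4511,3448,2092,261⟩]

def tbl9000 : List Row := [
  ⟨18526,-16193,2699,1588,2678,1720,7350,5834,3132,291,6⟩,
  ⟨18525,-16175,2699,1588,2318,1560,7257,5727,3132,223,14⟩,
  ⟨18518,-16127,2699,1587,2014,1413,7158,5613,3132,182,19⟩,
  ⟨18501,-16056,2701,1586,1760,1278,7056,5495,3133,148,13⟩,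
  ⟨18474,-15968,2703,1584,1548,1155,6955,5375,3133,116,20⟩,
  ⟨18435,-15870,2706,1581,1372,1044,6857,5256,3135,98,14⟩,
  ⟨18387,-15765,2711,1578,1226,944,6763,5139,3137,82,14⟩,
  ⟨18329,-15655,2717,1575,1106,855,6675,5025,3141,58,20⟩,
  ⟨18264,-15545,2725,1572,1006,776,6593,4916,3146,47,19⟩,
  ⟨18193,-15433,2733,1569,924,706,6518,4812,3152,36,14⟩,
  ⟨18117,-15322,2743,1566,857,644,6450,4713,3159,35,20⟩,
  ⟨18037,-15212,2753,1564,802,590,6389,4621,3167,21,17⟩,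
  ⟨17955,-15103,2765,1561,757,542,6335,4535,3176,29,11⟩,
  ⟨17872,-14995,2777,1559,721,500,6288,4455,3185,24,13⟩,
  ⟨17786,-14888,2790,1558,691,463,6247,4381,3196,14,7⟩,
  ⟨17700,-14781,2803,1557,667,431,6212,4313,3207,14,10⟩,
  ⟨17614,-14675,2817,1556,647,403,6183,4251,3219,3,19⟩,
  ⟨17527,-14569,2830,1556,631,379,6159,4195,3230,6,15⟩,
  ⟨17440,-14463,2845,1556,618,358,6140,4145,3243,12,10⟩,
  ⟨17352,-14357,2859,1556,609,340,6125,4100,3255,15,11⟩,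
  ⟨17265,-14251,2874,1556,602,324,6114,4061,3269,10,16⟩,
  ⟨17177,-14144,2888,1557,596,311,6107,4027,3281,15,8⟩,
  ⟨17090,-14036,2903,1558,592,299,6103,3997,3295,8,14⟩,
  ⟨17002,-13928,2918,1558,589,289,6103,3972,3308,9,6⟩,
  ⟨16914,-13819,2933,1559,587,280,6106,3951,3322,20,12⟩,
  ⟨16825,-13710,2949,1560,587,273,6112,3934,3337,18,10⟩,
  ⟨16737,-13599,2964,1561,587,267,6121,3921,3350,9,8⟩,
  ⟨16648,-13488,2980,1562,587,262,6132,3912,3365,8,7⟩,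
  ⟨16559,-13376,2996,1563,587,258,6145,3907,3380,13,22⟩,
  ⟨16470,-13263,3011,1563,588,256,6161,3905,3393,12,15⟩,
  ⟨16380,-13149,3028,1564,590,254,6178,3906,3409,20,9⟩,
  ⟨16290,-13035,3044,1565,593,252,6197,3911,3423,17,15⟩,
  ⟨16199,-12919,3060,1565,596,251,6218,3919,3437,16,9⟩,
  ⟨16108,-12803,3077,1566,599,250,6241,3930,3453,17,9⟩,
  ⟨16017,-12685,3094,1566,602,249,6265,3943,3468,14,13⟩,
  ⟨15925,-12567,3111,1567,605,249,6291,3959,3484,14,13⟩,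
  ⟨15833,-12448,3129,1567,608,249,6318,3978,3500,19,13⟩,
  ⟨15741,-12327,3146,1567,611,250,6346,3999,3515,14,4⟩,
  ⟨15648,-12206,3164,1567,614,250,6375,4022,3531,19,6⟩,
  ⟨15555,-12083,3182,1567,618,251,6405,4047,3547,16,12⟩,
  ⟨15461,-11960,3201,1567,621,253,6436,4074,3564,18,18⟩,
  ⟨15367,-11836,3219,1566,625,255,6469,4103,3580,15,10⟩,
  ⟨15273,-11710,3238,1566,628,257,6502,4134,3597,14,15⟩,
  ⟨15178,-11583,3258,1565,632,259,6536,4167,3615,12,19⟩,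
  ⟨15083,-11455,3277,1565,635,261,6571,4202,3632,12,5⟩,
  ⟨14987,-11326,3297,1564,639,263,6607,4239,3650,15,16⟩,
  ⟨14891,-11196,3317,1562,643,266,6644,4277,3667,19,10⟩,
  ⟨14795,-11064,3338,1561,647,268,6682,4317,3685,24,9⟩,
  ⟨14698,-10932,3359,1560,652,270,6721,4359,3704,16,8⟩,
  ⟨14601,-10798,3380,1558,656,273,6761,4402,3722,21,12⟩,
  ⟨14503,-10662,3401,1556,660,276,6802,4447,3741,16,5⟩,
  ⟨14405,-10525,3423,1554,664,278,6843,4493,3760,18,10⟩,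
  ⟨14307,-10387,3445,1552,669,281,6885,4541,3779,22,14⟩,
  ⟨14208,-10248,3468,1549,674,284,6928,4590,3799,16,15⟩,
  ⟨14109,-10107,3491,1547,678,287,6972,4641,3819,21,9⟩,
  ⟨14009,-9964,3514,1544,683,290,7017,4694,3839,14,15⟩,
  ⟨13909,-9820,3538,1540,687,294,7063,4748,3859,27,13⟩,
  ⟨13809,-9675,3562,1537,692,298,7109,4804,3880,24,13⟩,
  ⟨13708,-9527,3586,1533,697,302,7156,4861,3900,15,7⟩,
  ⟨13607,-9378,3611,1529,702,305,7204,4920,3922,29,17⟩,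
  ⟨13506,-9228,3637,1524,708,309,7253,4980,3944,23,18⟩,
  ⟨13404,-9075,3662,1519,713,313,7303,5042,3965,20,15⟩,
  ⟨13302,-8921,3689,1514,718,317,7354,5106,3988,20,20⟩,
  ⟨13199,-8765,3715,1509,723,321,7406,5171,4010,22,8⟩,
  ⟨13097,-8607,3742,1503,729,325,7459,5238,4033,18,16⟩,
  ⟨12994,-8447,3770,1496,734,329,7513,5307,4056,20,8⟩,
  ⟨12891,-8285,3798,1489,740,333,7568,5377,4080,22,17⟩,
  ⟨12787,-8121,3826,1482,746,338,7624,5449,4103,30,8⟩,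
  ⟨12684,-7954,3855,1474,752,342,7681,5523,4128,27,12⟩,
  ⟨12580,-7786,3885,1466,758,347,7739,5599,4153,22,8⟩,
  ⟨12476,-7615,3915,1457,764,351,7798,5677,4178,22,13⟩,
  ⟨12372,-7442,3945,1447,770,356,7858,5757,4203,29,9⟩,
  ⟨12267,-7266,3976,1437,777,361,7919,5839,4228,23,15⟩,
  ⟨12163,-7088,4008,1426,783,366,7981,5923,4255,32,14⟩,
  ⟨12059,-6908,4040,1415,790,371,8044,6009,4281,29,16⟩,
  ⟨11954,-6725,4072,1403,797,376,8109,6097,4307,24,8⟩,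
  ⟨11850,-6539,4105,1390,804,381,8175,6188,4334,27,16⟩,
  ⟨11746,-6350,4139,1376,811,387,8242,6281,4362,30,15⟩,
  ⟨11642,-6158,4173,1361,818,393,8310,6376,4390,35,21⟩,
  ⟨11538,-5964,4207,1346,826,399,8379,6473,4418,32,17⟩,
  ⟨11435,-5766,4242,1330,834,405,8449,6573,4446,30,20⟩,
  ⟨11332,-5565,4278,1312,842,412,8521,6675,4475,30,18⟩,
  ⟨11230,-5361,4314,1294,850,418,8594,6780,4504,35,16⟩,
  ⟨11128,-5154,4350,1274,858,424,8668,6887,4533,31,15⟩,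
  ⟨11026,-4943,4387,1253,866,431,8743,6997,4563,35,18⟩,
  ⟨10926,-4729,4425,1231,874,438,8819,7109,4594,33,22⟩,
  ⟨10826,-4511,4462,1208,882,445,8896,7224,4623,39,25⟩,
  ⟨10728,-4289,4501,1184,890,452,8975,7341,4655,45,17⟩,
  ⟨10630,-4064,4539,1158,899,459,9055,7461,4685,42,21⟩,
  ⟨10534,-3834,4578,1130,908,467,9136,7584,4716,45,15⟩,
  ⟨10439,-3601,4617,1101,917,474,9218,7709,4747,42,19⟩,
  ⟨10346,-3363,4656,1070,926,482,9301,7837,4778,42,22⟩,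
  ⟨10255,-3121,4696,1038,935,490,9385,7968,4810,40,20⟩,
  ⟨10166,-2875,4736,1004,944,498,9470,8101,4842,48,21⟩,
  ⟨10079,-2625,4775,968,953,506,9555,8237,4873,47,19⟩,
  ⟨9995,-2370,4815,930,962,514,9641,8375,4904,52,21⟩,
  ⟨9913,-2111,4855,890,971,522,9728,8515,4936,51,31⟩,
  ⟨9835,-1847,4894,847,980,531,9815,8658,4967,51,25⟩,
  ⟨9760,-1579,4933,803,989,540,9902,8803,4998,53,27⟩,
  ⟨9688,-1306,4971,756,998,549,9990,8950,5029,51,21⟩,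
  ⟨9620,-1028,5009,707,1007,557,10078,9099,5059,54,26⟩,
  ⟨9557,-746,5046,656,1016,566,10166,9249,5089,54,26⟩,
  ⟨9498,-459,5082,602,1025,575,10253,9401,5118,61,27⟩,
  ⟨9444,-168,5117,546,1034,584,10340,9554,5147,59,25⟩,
  ⟨9396,127,5151,487,1042,592,10426,9707,5174,68,37⟩,
  ⟨9354,427,5184,426,1051,601,10510,9861,5202,70,32⟩,
  ⟨9317,731,5214,362,1059,610,10593,10015,5227,68,31⟩,
  ⟨9288,1038,5243,295,1067,619,10674,10168,5252,71,34⟩,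
  ⟨9265,1349,5269,226,1074,627,10753,10320,5274,67,45⟩,
  ⟨9250,1663,5294,155,1081,636,10829,10470,5297,72,36⟩,
  ⟨9243,1980,5315,81,1087,644,10902,10618,5316,71,36⟩,
  ⟨9244,2299,5333,5,1093,652,10972,10763,5334,83,44⟩,
  ⟨9253,2620,5349,-73,1099,660,11039,10906,5350,82,38⟩,
  ⟨9272,2943,5361,-154,1104,667,11102,11045,5364,79,41⟩,
  ⟨9300,3266,5369,-235,1108,674,11161,11179,5375,79,40⟩,
  ⟨9337,3589,5373,-319,1111,680,11215,11308,5383,83,40⟩,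
  ⟨9384,3912,5373,-403,1114,685,11264,11431,5389,88,48⟩,
  ⟨9440,4234,5368,-489,1116,690,11307,11547,5391,82,39⟩,
  ⟨9506,4553,5359,-575,1117,694,11344,11656,5390,83,48⟩,
  ⟨9582,4870,5346,-661,1117,698,11375,11756,5387,87,46⟩,
  ⟨9667,5183,5328,-746,1116,701,11399,11847,5380,87,53⟩,
  ⟨9762,5492,5304,-832,1114,704,11415,11928,5369,87,47⟩,
  ⟨9866,5796,5276,-915,1111,705,11424,11998,5355,86,55⟩,
  ⟨9978,6094,5244,-998,1107,706,11424,12056,5339,86,44⟩,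
  ⟨10098,6385,5207,-1078,1102,705,11417,12102,5318,84,44⟩,
  ⟨10225,6669,5165,-1156,1096,704,11401,12136,5293,89,42⟩,
  ⟨10359,6946,5119,-1231,1089,701,11377,12157,5265,85,51⟩,
  ⟨10499,7214,5069,-1302,1081,698,11345,12164,5234,80,43⟩,
  ⟨10644,7474,5016,-1370,1072,694,11305,12158,5200,79,43⟩,
  ⟨10793,7725,4960,-1434,1062,689,11257,12139,5164,84,42⟩,
  ⟨10946,7968,4901,-1494,1052,683,11201,12107,5124,80,44⟩,
  ⟨11101,8201,4839,-1550,1041,676,11138,12062,5082,74,39⟩,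
  ⟨11258,8426,4776,-1601,1029,668,11068,12004,5038,75,48⟩,
  ⟨11417,8642,4711,-1647,1017,660,10991,11933,4991,67,39⟩,
  ⟨11575,8850,4646,-1689,1004,651,10908,11850,4944,63,44⟩,
  ⟨11733,9050,4580,-1727,990,642,10819,11756,4895,68,37⟩,
  ⟨11890,9242,4514,-1760,977,632,10724,11650,4845,68,37⟩,
  ⟨12046,9428,4448,-1789,963,621,10625,11534,4795,59,36⟩,
  ⟨12200,9607,4383,-1814,949,610,10522,11408,4744,59,32⟩,
  ⟨12352,9779,4319,-1835,935,598,10415,11273,4693,50,35⟩,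
  ⟨12501,9946,4256,-1852,921,586,10305,11130,4642,51,32⟩,
  ⟨12647,10108,4195,-1866,907,574,10193,10980,4592,49,31⟩,
  ⟨12791,10266,4135,-1877,893,562,10079,10823,4542,46,32⟩,
  ⟨12932,10420,4078,-1886,880,550,9964,10661,4494,49,36⟩,
  ⟨13070,10569,4022,-1891,867,538,9848,10494,4445,45,30⟩,
  ⟨13206,10716,3968,-1895,854,526,9731,10323,4398,37,29⟩,
  ⟨13338,10860,3917,-1897,841,514,9614,10148,4353,34,27⟩,
  ⟨13468,11001,3867,-1897,829,502,9498,9971,4308,29,25⟩,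
  ⟨13596,11140,3820,-1896,817,490,9382,9792,4265,33,30⟩,
  ⟨13722,11277,3774,-1894,806,479,9267,9611,4223,26,29⟩,
  ⟨13845,11412,3731,-1890,795,468,9154,9430,4183,22,24⟩,
  ⟨13966,11546,3689,-1886,784,457,9042,9248,4144,27,20⟩,
  ⟨14086,11678,3649,-1881,774,446,8932,9067,4106,25,17⟩,
  ⟨14203,11809,3611,-1876,764,435,8823,8886,4070,24,20⟩,
  ⟨14319,11938,3575,-1870,755,425,8716,8707,4035,17,16⟩,
  ⟨14434,12066,3540,-1864,746,415,8612,8529,4001,24,17⟩,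
  ⟨14548,12193,3507,-1858,737,405,8510,8353,3969,13,13⟩,
  ⟨14660,12319,3475,-1852,728,396,8410,8179,3938,16,14⟩,
  ⟨14771,12444,3444,-1846,720,387,8312,8008,3908,17,20⟩,
  ⟨14881,12568,3414,-1839,712,379,8216,7840,3878,20,17⟩,
  ⟨14990,12690,3386,-1833,705,371,8122,7674,3851,17,16⟩,
  ⟨15098,12812,3358,-1827,698,363,8031,7512,3823,17,18⟩,
  ⟨15205,12933,3332,-1821,691,356,7942,7353,3798,21,21⟩,
  ⟨15311,13052,3306,-1814,685,349,7855,7197,3771,23,8⟩,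
  ⟨15417,13171,3281,-1808,679,342,7770,7045,3747,16,16⟩,
  ⟨15521,13289,3257,-1803,673,335,7687,6896,3723,19,15⟩,
  ⟨15625,13405,3233,-1797,667,329,7607,6751,3699,14,12⟩,
  ⟨15728,13521,3210,-1791,661,323,7529,6609,3676,22,12⟩,
  ⟨15831,13636,3188,-1786,656,317,7453,6471,3655,24,16⟩,
  ⟨15932,13749,3166,-1780,651,311,7379,6336,3633,11,7⟩,
  ⟨16033,13862,3145,-1775,645,305,7307,6205,3612,13,14⟩,
  ⟨16133,13974,3125,-1770,640,300,7237,6078,3592,14,18⟩,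
  ⟨16233,14085,3104,-1765,635,295,7168,5954,3571,22,15⟩,
  ⟨16332,14196,3085,-1760,630,290,7101,5834,3552,16,16⟩,
  ⟨16430,14305,3065,-1755,625,285,7036,5717,3532,16,7⟩,
  ⟨16528,14413,3046,-1750,620,280,6973,5604,3513,12,11⟩,
  ⟨16625,14521,3028,-1745,615,276,6911,5494,3495,13,12⟩,
  ⟨16721,14628,3010,-1741,611,272,6851,5387,3478,11,9⟩,
  ⟨16817,14734,2992,-1736,607,268,6793,5284,3460,16,16⟩,
  ⟨16912,14840,2974,-1731,603,264,6736,5184,3442,17,9⟩,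
  ⟨17007,14944,2957,-1727,599,260,6681,5087,3425,8,11⟩,
  ⟨17101,15048,2940,-1723,595,256,6627,4993,3408,16,13⟩,
  ⟨17195,15151,2924,-1718,591,253,6574,4902,3392,18,9⟩,
  ⟨17287,15254,2908,-1714,587,250,6523,4814,3376,17,13⟩,
  ⟨17380,15356,2892,-1709,584,247,6473,4729,3360,9,9⟩,
  ⟨17472,15457,2876,-1705,580,244,6424,4646,3344,15,10⟩,
  ⟨17563,15557,2861,-1701,577,241,6376,4566,3329,11,17⟩,
  ⟨17654,15657,2845,-1697,573,238,6330,4489,3313,13,21⟩,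
  ⟨17744,15756,2831,-1692,570,236,6285,4414,3299,13,8⟩,
  ⟨17834,15855,2816,-1688,567,233,6241,4341,3284,11,13⟩,
  ⟨17923,15953,2801,-1684,564,230,6198,4271,3269,16,4⟩,
  ⟨18012,16051,2787,-1680,561,227,6156,4203,3255,19,3⟩,
  ⟨18101,16147,2773,-1676,558,224,6115,4137,3241,2091,231⟩]

set_option maxRecDepth 100000 in
theorem tbl1000_ok : tableOK 1000 tbl1000 = true := by decide +kernel
set_option maxRecDepth 100000 in
theorem tbl3000_ok : tableOK 3000 tbl3000 = true := by decide +kernel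
set_option maxRecDepth 100000 in
theorem tbl5000_ok : tableOK 5000 tbl5000 = true := by decide +kernel
set_option maxRecDepth 100000 in
theorem tbl7000_ok : tableOK 7000 tbl7000 = true := by decide +kernel
set_option maxRecDepth 100000 in
theorem tbl9000_ok : tableOK 9000 tbl9000 = true := by decide +kernel

end Part4

section Part5

open Set

noncomputable def Row.M (x : Row) : ℂ := ⟨(x.a : ℝ)/10000, (x.b : ℝ)/10000⟩
noncomputable def Row.Q (x : Row) : ℂ := ⟨(x.c : ℝ)/10000, (x.d : ℝ)/10000⟩

theorem norm_le_of_sq {z : ℂ} {r : ℝ} (hr : 0 ≤ r) (h : z.re ^ 2 + z.im ^ 2 ≤ r ^ 2) : ‖z‖ ≤ r := by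
  have h2 : ‖z‖ ^ 2 = z.re ^ 2 + z.im ^ 2 := by
    rw [Complex.sq_norm, Complex.normSq_apply]; ring
  exact le_of_sq_le_sq (by rw [h2]; exact h) hr
  where le_of_sq_le_sq {a b : ℝ} (h : a ^ 2 ≤ b ^ 2) (hb : 0 ≤ b) : a ≤ b := abs_le_of_sq_le_sq' h hb |>.2

theorem norm_sq_eq (z : ℂ) : ‖z‖ ^ 2 = z.re ^ 2 + z.im ^ 2 := by
  rw [Complex.sq_norm, Complex.normSq_apply]; ring

/-- Enclosure at a grid time. -/
structure EncInv (m Q : ℝ → ℂ) (N0 N1 : ℝ → ℝ) (x : Row) (t : ℝ) : Prop where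
  hm : ‖m t - x.M‖ < (x.e : ℝ) / 10000
  hQ : ‖Q t - x.Q‖ < (x.g : ℝ) / 10000
  hN0 : N0 t < (x.n0 : ℝ) / 10000
  hN1 : N1 t < (x.n1 : ℝ) / 10000

structure GoodC (m Q : ℝ → ℂ) (N1 : ℝ → ℝ) (t : ℝ) : Prop where
  hm : 0.3 ≤ (m t).re
  hre : ‖Q t‖ ^ 2 ≤ 10 * (Q t).re
  hQ : 0.05 ≤ ‖Q t‖
  hN : N1 t ≤ 6 * ‖Q t‖

theorem da_bound {κ ε K : ℝ} (hκ : |κ - K / 10000| ≤ 0.1) (hκ0 : 0 ≤ κ) (hK : 0 ≤ K)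
    (hε0 : 0 ≤ ε) (hε : ε ≤ 0.0001) :
    |κ ^ 2 - ε - (K / 10000) ^ 2| ≤ (1000 * (2 * K + 1000) + 10000) / 100000000 := by
  obtain ⟨h1, h2⟩ := abs_le.1 hκ
  have hb : (0:ℝ) ≤ K / 10000 := by positivity
  rw [abs_le]
  constructor <;> nlinarith

theorem good_of {c d c' d' vx vx' V g g' G n1 n1' n1m cm mu E : ℝ} {u : ℝ} {m Q : ℝ → ℂ} {N1 : ℝ → ℝ} {t : ℝ}
    (u0 : 0 ≤ u) (u1 : u ≤ 1) (Q6 : 0 ≤ vx) (Q7 : 0 ≤ vx') (Q8 : c ^ 2 + d ^ 2 ≤ vx ^ 2)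
    (Q9 : c' ^ 2 + d' ^ 2 ≤ vx' ^ 2) (hV0 : vx ≤ V) (hV1 : vx' ≤ V) (hg0 : g ≤ G) (hg1 : g' ≤ G)
    (hk0 : n1 ≤ n1m) (hk1 : n1' ≤ n1m) (hc0 : cm ≤ c) (hc1 : cm ≤ c')
    (G1 : 3000 ≤ mu - E) (G2 : 3000 ≤ n1m) (G3 : (V + G) ^ 2 ≤ 100000 * (cm - G))
    (G4 : 4 * (n1m + 6 * G) ^ 2 ≤ 36 * (4 * (c ^ 2 + d ^ 2) - ((c' - c) ^ 2 + (d' - d) ^ 2)))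
    (G5 : 4 * (n1m + 6 * G) ^ 2 ≤ 36 * (4 * (c' ^ 2 + d' ^ 2) - ((c' - c) ^ 2 + (d' - d) ^ 2)))
    (hG0 : 0 ≤ G) (h1 : mu / 10000 - E / 10000 ≤ (m t).re)
    (h2 : ‖Q t - ((⟨c/10000, d/10000⟩ : ℂ) + (u : ℂ) * ((⟨c'/10000, d'/10000⟩ : ℂ) - ⟨c/10000, d/10000⟩))‖
      < g / 10000 + u * (g' / 10000 - g / 10000))
    (h3 : N1 t < n1 / 10000 + u * (n1' / 10000 - n1 / 10000)) : GoodC m Q N1 t := by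
  set Qh : ℂ := (⟨c/10000, d/10000⟩ : ℂ) + (u : ℂ) * ((⟨c'/10000, d'/10000⟩ : ℂ) - ⟨c/10000, d/10000⟩) with hQh
  have hG : ‖Q t - Qh‖ ≤ G/10000 := h2.le.trans (lerp_le u0 u1 (by linarith) (by linarith))
  have hN1' : N1 t ≤ n1m/10000 := h3.le.trans (lerp_le u0 u1 (by linarith) (by linarith))
  have hQre : Qh.re = c/10000 + u * (c'/10000 - c/10000) := by simp [hQh]
  have hQim : Qh.im = d/10000 + u * (d'/10000 - d/10000) := by simp [hQh]
  have hQhV : ‖Qh‖ ≤ V/10000 := by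
    have h := lerp_res ⟨c/10000, d/10000⟩ ⟨c'/10000, d'/10000⟩ 0 u (V/10000) 0 u0 u1
      (by refine (norm_le_of_sq (r := vx/10000) (by positivity) ?_).trans (by linarith)
          simp only; linarith)
      (by refine (norm_le_of_sq (r := vx'/10000) (by positivity) ?_).trans (by linarith)
          simp only; linarith) (by simp)
    have heq : (1 - (u : ℂ)) * (⟨c/10000, d/10000⟩ : ℂ) + u * (⟨c'/10000, d'/10000⟩ : ℂ) + u * (1 - u) * 0 = Qh := by
      rw [hQh]; ring
    rw [heq] at h; linarith
  have hre2 : cm/10000 ≤ Qh.re := by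
    rw [hQre]; exact lerp_mem u0 u1 (by linarith) (by linarith)
  have hQup : ‖Q t‖ ≤ (V + G)/10000 := by
    have := norm_le_norm_add_norm_sub' (Q t) Qh
    linarith
  have hQreL : (cm - G)/10000 ≤ (Q t).re := by
    have := (abs_le.1 ((Complex.abs_re_le_norm (Q t - Qh)).trans hG)).1
    rw [Complex.sub_re] at this
    linarith
  have hlow : (n1m/6 + G)/10000 ≤ ‖Qh‖ := by
    apply abs_le_of_sq_le_sq' _ (norm_nonneg _) |>.2
    rw [norm_sq_eq, hQre, hQim]
    have huu : u * (1 - u) ≤ 1/4 := by nlinarith [sq_nonneg (u - 1/2)]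
    have e1 : (c/10000 + u * (c'/10000 - c/10000))^2 + (d/10000 + u * (d'/10000 - d/10000))^2
      = ((c^2 + d^2) + u * ((c'^2 + d'^2) - (c^2 + d^2))
        - u * (1 - u) * ((c' - c)^2 + (d' - d)^2)) / 100000000 := by ring
    rw [e1]
    have hD : 0 ≤ (c' - c)^2 + (d' - d)^2 := by positivity
    have e2 := mul_le_mul_of_nonneg_right huu hD
    have e3 : (n1m + 6 * G)^2/36 + ((c' - c)^2 + (d' - d)^2)/4 ≤ (c^2 + d^2) + u * ((c'^2 + d'^2) - (c^2 + d^2)) :=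
      lerp_mem u0 u1 (by linarith) (by linarith)
    have e4 : ((n1m/6 + G)/10000)^2 = (n1m + 6 * G)^2/36/100000000 := by ring
    rw [e4]
    linarith
  have hQlow : n1m/60000 ≤ ‖Q t‖ := by
    have := norm_le_norm_add_norm_sub' Qh (Q t)
    rw [norm_sub_rev] at this
    linarith
  refine ⟨by linarith, ?_, by linarith, by linarith⟩
  have : ‖Q t‖^2 ≤ ((V + G)/10000)^2 := pow_le_pow_left₀ (norm_nonneg _) hQup 2
  linarith

set_option maxHeartbeats 1000000 in
theorem cell_sound {κ ε : ℝ} {m Q : ℝ → ℂ} {N0 N1 : ℝ → ℝ} {K p : ℤ} {x y : Row}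
    (hκ : |κ - (K:ℝ) / 10000| ≤ 0.1) (hκ0 : 0 ≤ κ) (hK : 0 ≤ K)
    (hε0 : 0 ≤ ε) (hε : ε ≤ 0.0001)
    {bb : ℝ} (hb : bb ≤ (p:ℝ)/16 + 1/16) (hS : Sys κ ε m Q N0 N1 ((p:ℝ)/16) bb)
    (hoM : okM K p x y = true) (hoQ : okQ K x y = true) (hoN : okN x y = true)
    (hoG : okG x y = true) (hI : EncInv m Q N0 N1 x ((p:ℝ)/16)) :
    (bb = (p:ℝ)/16 + 1/16 → EncInv m Q N0 N1 y ((p:ℝ)/16 + 1/16)) ∧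
      ∀ t ∈ Icc ((p:ℝ)/16) bb, GoodC m Q N1 t := by
  simp only [okM, okQ, okN, okG, Bool.and_eq_true, decide_eq_true_eq] at hoM hoQ hoN hoG
  obtain ⟨⟨⟨⟨⟨⟨M1, M2⟩, M3⟩, M4⟩, M5⟩, M6⟩, M7⟩ := hoM
  obtain ⟨⟨⟨⟨⟨⟨⟨⟨⟨⟨Q1, Q2⟩, Q3⟩, Q4⟩, Q5⟩, Q6⟩, Q7⟩, Q8⟩, Q9⟩, Q10⟩, Q11⟩ := hoQ
  obtain ⟨⟨⟨⟨⟨⟨⟨A1, A2⟩, A3⟩, A4⟩, A5⟩, A6⟩, A7⟩, A8⟩ := hoN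
  obtain ⟨⟨⟨⟨G1, G2⟩, G3⟩, G4⟩, G5⟩ := hoG
  have hmu0 := min_le_left x.a y.a
  have hmu1 := min_le_right x.a y.a
  have hE0 := le_max_left x.e y.e
  have hE1 := le_max_right x.e y.e
  have hV0 := le_max_left x.V y.V
  have hV1 := le_max_right x.V y.V
  have hg0 := le_max_left x.g y.g
  have hg1 := le_max_right x.g y.g
  have hn0 := le_max_left x.n0 y.n0
  have hn1 := le_max_right x.n0 y.n0
  have hk0 := le_max_left x.n1 y.n1
  have hk1 := le_max_right x.n1 y.n1
  have hc0 := min_le_left x.c y.c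
  have hc1 := min_le_right x.c y.c
  generalize min x.a y.a = mu at *
  generalize max x.e y.e = E at *
  generalize max x.V y.V = V at *
  generalize max x.g y.g = G at *
  generalize max x.n0 y.n0 = n0m at *
  generalize max x.n1 y.n1 = n1m at *
  generalize min x.c y.c = cm at *
  obtain ⟨a, b, c, d, e, g, n0, n1, vx, r, rq⟩ := x
  obtain ⟨a', b', c', d', e', g', n0', n1', vx', r', rq'⟩ := y
  obtain ⟨I1, I2, I3, I4⟩ := hI
  simp only [Row.M, Row.Q] at *
  rify at *
  have hG0 : (0:ℝ) ≤ G := by linarith only [hg0, Q4]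
  have hda := da_bound hκ hκ0 hK hε0 hε
  set P : ℝ := (p:ℝ)/16 with hP
  have hp : (p:ℝ) = 16 * P := by rw [hP]; ring
  rw [hp] at M1 M2
  have hdM : ‖(⟨(a':ℝ)/10000, (b':ℝ)/10000⟩ : ℂ) - ⟨(a:ℝ)/10000, (b:ℝ)/10000⟩‖ ^ 2
      = (((a':ℝ) - a)^2 + ((b':ℝ) - b)^2) / 100000000 := by
    rw [norm_sq_eq]; simp only [Complex.sub_re, Complex.sub_im]; ring
  have hdQ : ‖(⟨(c':ℝ)/10000, (d':ℝ)/10000⟩ : ℂ) - ⟨(c:ℝ)/10000, (d:ℝ)/10000⟩‖ ^ 2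
      = (((c':ℝ) - c)^2 + ((d':ℝ) - d)^2) / 100000000 := by
    rw [norm_sq_eq]; simp only [Complex.sub_re, Complex.sub_im]; ring
  have hm := cell_m hb (kc := (K:ℝ)/10000) hS (M0 := ⟨(a:ℝ)/10000, (b:ℝ)/10000⟩)
    (M1 := ⟨(a':ℝ)/10000, (b':ℝ)/10000⟩) (e0 := (e:ℝ)/10000) (e1 := (e':ℝ)/10000)
    (r := (r:ℝ)/10000) (mu := (mu:ℝ)/10000) (E := (E:ℝ)/10000) hda
    (by
      apply norm_le_of_sq (by positivity)
      simp [pow_two]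
      simp only [pow_two] at M1
      linarith only [M1])
    (by
      apply norm_le_of_sq (by positivity)
      simp [pow_two]
      simp only [pow_two] at M2
      linarith only [M2])
    (by positivity) (by positivity) (by linarith only [hE0]) (by linarith only [hE1]) (by simp only; linarith only [hmu0])
    (by simp only; linarith only [hmu1]) (by rw [hdM]; linarith only [M6]) (by rw [hdM]; linarith only [M7]) I1
  have hQ := cell_Q hb (kc := (K:ℝ)/10000) (dk := 0.1) (kl := (K:ℝ)/10000 - 0.1) hS
    (by linarith only [(abs_le.1 hκ).1]) (M0 := ⟨(a:ℝ)/10000, (b:ℝ)/10000⟩)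
    (M1 := ⟨(a':ℝ)/10000, (b':ℝ)/10000⟩) (Q0 := ⟨(c:ℝ)/10000, (d:ℝ)/10000⟩)
    (Q1 := ⟨(c':ℝ)/10000, (d':ℝ)/10000⟩) (e0 := (e:ℝ)/10000) (e1 := (e':ℝ)/10000)
    (g0 := (g:ℝ)/10000) (g1 := (g':ℝ)/10000)
    (r := (rq:ℝ)/10000) (mu := (mu:ℝ)/10000) (E := (E:ℝ)/10000) (V := (V:ℝ)/10000) hκ
    (by
      apply norm_le_of_sq (by positivity)
      simp [pow_two]
      simp only [pow_two] at Q1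
      linarith only [Q1])
    (by
      apply norm_le_of_sq (by positivity)
      simp [pow_two]
      simp only [pow_two] at Q2
      linarith only [Q2])
    (by positivity) (by positivity) (by linarith only [hE0]) (by linarith only [hE1]) (by simp only; linarith only [hmu0])
    (by simp only; linarith only [hmu1])
    (by refine (norm_le_of_sq (r := (vx:ℝ)/10000) (by positivity) ?_).trans (by linarith only [hV0])
        simp only; linarith only [Q8])
    (by refine (norm_le_of_sq (r := (vx':ℝ)/10000) (by positivity) ?_).trans (by linarith only [hV1])
        simp only; linarith only [Q9])
    hm (by rw [hdM, hdQ]; linarith only [Q10]) (by rw [hdM, hdQ]; linarith only [Q11]) I2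
  have hre := cell_re hb (E := (E:ℝ)/10000) (mu := (mu:ℝ)/10000) (by linarith only [hE0]) (by linarith only [hE1])
    (by simp only; linarith only [hmu0]) (by simp only; linarith only [hmu1]) hm
  have hN0 := cell_N hb (μ := fun t => (m t).re) (S := fun _ => 1) (n0 := (n0:ℝ)/10000)
    (n1 := (n0':ℝ)/10000) (s := 1) (rate := ((mu:ℝ) - E)/10000) hS.hN0 (by positivity)
    (by positivity) (fun _ _ => le_rfl) (fun t ht => by linarith only [hre t ht])
    (by linarith only [A5]) (by linarith only [A6]) I3
  have hN1 := cell_N hb (μ := fun t => (m t).re) (S := N0) (n0 := (n1:ℝ)/10000)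
    (n1 := (n1':ℝ)/10000) (s := (n0m:ℝ)/10000) (rate := ((mu:ℝ) - E)/10000) hS.hN1 (by positivity)
    (by positivity) (fun t ht => by
      obtain ⟨u0, u1⟩ := cell_u hb ht
      exact (hN0 t ht).le.trans (lerp_le u0 u1 (by linarith only [hn0]) (by linarith only [hn1])))
    (fun t ht => by linarith only [hre t ht]) (by linarith only [A7]) (by linarith only [A8]) I4
  refine ⟨fun hbe => ?_, ?_⟩
  have hend : P + 1/16 ∈ Icc P bb := ⟨by linarith only, hbe.ge⟩
  refine ⟨?_, ?_, ?_, ?_⟩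
  · have h := hm _ hend
    convert h using 1
    · congr 1; simp only [Row.M]; push_cast; ring
    · simp only; ring
  · have h := hQ _ hend
    convert h using 1
    · congr 1; simp only [Row.Q]; push_cast; ring
    · simp only; ring
  · have h := hN0 _ hend
    convert h using 1
    simp only; ring
  · have h := hN1 _ hend
    convert h using 1
    simp only; ring
  · intro t ht
    obtain ⟨u0, u1⟩ := cell_u hb ht
    have h1 := hre t ht
    have h2 := hQ t ht
    have h3 := hN1 t ht
    set u := 16 * (t - P) with hu
    have hc : (16 * ((t : ℂ) - P)) = ((u : ℝ) : ℂ) := by rw [hu]; push_cast; ring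
    rw [hc] at h2
    exact good_of u0 u1 Q6 Q7 Q8 Q9 hV0 hV1 hg0 hg1 hk0 hk1 hc0 hc1 G1 G2 G3 G4 G5 hG0 h1 h2 h3

end Part5

section Part6

open Set

theorem chainOK_le {K : ℤ} : ∀ (l : List Row) (p : ℤ) (x : Row), chainOK K p (x :: l) = true → p ≤ 96
  | [], p, x, h => by
      simp only [chainOK, Bool.and_eq_true, decide_eq_true_eq] at h; omega
  | y :: l, p, x, h => by
      simp only [chainOK, Bool.and_eq_true] at h
      have := chainOK_le l (p+1) y h.2
      omega

theorem chain_sound {κ ε : ℝ} {m Q : ℝ → ℂ} {N0 N1 : ℝ → ℝ} {K : ℤ}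
    (hκ : |κ - (K:ℝ) / 10000| ≤ 0.1) (hκ0 : 0 ≤ κ) (hK : 0 ≤ K)
    (hε0 : 0 ≤ ε) (hε : ε ≤ 0.0001) :
    ∀ (l : List Row) (p : ℤ) (x : Row), chainOK K p (x :: l) = true →
    Sys κ ε m Q N0 N1 ((p:ℝ)/16) 6 → EncInv m Q N0 N1 x ((p:ℝ)/16) → 0 < (m ((p:ℝ)/16)).re →
    (∀ t ∈ Ico ((p:ℝ)/16) 6, GoodC m Q N1 t) ∧ 0 < (m 6).re ∧
      ∃ z, okEnd K z = true ∧ EncInv m Q N0 N1 z 6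
  | [], p, x, h, hS, hI, hm => by
      simp only [chainOK, Bool.and_eq_true, decide_eq_true_eq] at h
      obtain ⟨rfl, h⟩ := h
      have e : (((96:ℤ):ℝ)/16) = 6 := by norm_num
      rw [e] at hI hm ⊢
      exact ⟨fun t ht => absurd ht.2 (not_lt.2 ht.1), hm, x, h, hI⟩
  | y :: l, p, x, h, hS, hI, hm => by
      simp only [chainOK, Bool.and_eq_true] at h
      obtain ⟨⟨⟨⟨h1, h2⟩, h3⟩, h4⟩, h5⟩ := h
      have hp := chainOK_le l (p+1) y h5
      have hp' : (p:ℝ) + 1 ≤ 96 := by exact_mod_cast hp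
      obtain ⟨c1, c2⟩ := cell_sound hκ hκ0 hK hε0 hε le_rfl (hS.mono le_rfl (by linarith)) h1 h2 h3 h4 hI
      have c1 := c1 rfl
      have e : (((p+1:ℤ):ℝ)/16) = (p:ℝ)/16 + 1/16 := by push_cast; ring
      have hr := chain_sound hκ hκ0 hK hε0 hε l (p+1) y h5
        (by rw [e]; exact hS.mono (by linarith) le_rfl) (by rw [e]; exact c1)
        (by rw [e]; have := (c2 _ ⟨by linarith, le_rfl⟩).hm; linarith)
      refine ⟨?_, hr.2⟩
      intro t ht
      by_cases hc : t ≤ (p:ℝ)/16 + 1/16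
      · exact c2 t ⟨ht.1, hc⟩
      · exact hr.1 t ⟨by rw [e]; linarith, ht.2⟩

theorem chain_part {κ ε b : ℝ} {m Q : ℝ → ℂ} {N0 N1 : ℝ → ℝ} {K : ℤ}
    (hκ : |κ - (K:ℝ) / 10000| ≤ 0.1) (hκ0 : 0 ≤ κ) (hK : 0 ≤ K)
    (hε0 : 0 ≤ ε) (hε : ε ≤ 0.0001) (hb : b < 6) :
    ∀ (l : List Row) (p : ℤ) (x : Row), chainOK K p (x :: l) = true →
    Sys κ ε m Q N0 N1 ((p:ℝ)/16) b → EncInv m Q N0 N1 x ((p:ℝ)/16) →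
    ∀ t ∈ Icc ((p:ℝ)/16) b, GoodC m Q N1 t
  | [], p, x, h, hS, hI => by
      simp only [chainOK, Bool.and_eq_true, decide_eq_true_eq] at h
      obtain ⟨rfl, h⟩ := h
      intro t ht
      have := ht.1.trans ht.2
      norm_num at this; linarith
  | y :: l, p, x, h, hS, hI => by
      simp only [chainOK, Bool.and_eq_true] at h
      obtain ⟨⟨⟨⟨h1, h2⟩, h3⟩, h4⟩, h5⟩ := h
      by_cases hbb : b ≤ (p:ℝ)/16 + 1/16
      · exact (cell_sound hκ hκ0 hK hε0 hε hbb hS h1 h2 h3 h4 hI).2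
      push Not at hbb
      obtain ⟨c1, c2⟩ := cell_sound hκ hκ0 hK hε0 hε le_rfl (hS.mono le_rfl hbb.le) h1 h2 h3 h4 hI
      have c1 := c1 rfl
      have e : (((p+1:ℤ):ℝ)/16) = (p:ℝ)/16 + 1/16 := by push_cast; ring
      have hr := chain_part hκ hκ0 hK hε0 hε hb l (p+1) y h5
        (by rw [e]; exact hS.mono (by linarith) le_rfl) (by rw [e]; exact c1)
      intro t ht
      by_cases hc : t ≤ (p:ℝ)/16 + 1/16
      · exact c2 t ⟨ht.1, hc⟩
      · exact hr t ⟨by rw [e]; linarith, ht.2⟩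

/-- The defect `m² - a`. -/
noncomputable def dD (κ ε : ℝ) (m : ℝ → ℂ) (t : ℝ) : ℂ := m t ^ 2 - ((κ : ℂ) ^ 2 - ε + t * Complex.I)
noncomputable def dq (κ : ℝ) (m Q : ℝ → ℂ) (t : ℝ) : ℂ := 1 - (m t + κ) * Q t

theorem far_static {κ ε : ℝ} {m : ℝ → ℂ} {t : ℝ} (hκ0 : 0 ≤ κ) (hκ1 : κ ≤ 1) (hε0 : 0 ≤ ε)
    (hε : ε ≤ 0.0001) (ht : 6 ≤ |t|) (hm : 0 ≤ (m t).re) (hD : ‖dD κ ε m t‖ ≤ 0.7) :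
    0.619 * √|t| ≤ (m t).re ∧ 1.51 ≤ (m t).re ∧ 2.30 ≤ ‖m t‖ ∧ ‖m t‖ ≤ 1.135 * √|t| := by
  have hre := abs_le.1 ((Complex.abs_re_le_norm (dD κ ε m t)).trans hD)
  have hs : √|t| ^ 2 = |t| := Real.sq_sqrt (abs_nonneg t)
  have hs0 := Real.sqrt_nonneg |t|
  have hn0 := norm_nonneg (m t)
  have hns := norm_sq_eq (m t)
  have e1 : (dD κ ε m t).re = (m t).re ^ 2 - (m t).im ^ 2 - (κ ^ 2 - ε) := by
    simp [dD, pow_two]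
  rw [e1] at hre
  have e2 : ‖m t ^ 2‖ = ‖m t‖ ^ 2 := norm_pow _ _
  have hk2 : κ ^ 2 ≤ 1 := by nlinarith
  have hk0 : 0 ≤ κ ^ 2 := sq_nonneg κ
  have e3 : |t| ≤ ‖(κ : ℂ) ^ 2 - ε + t * Complex.I‖ := by
    have := Complex.abs_im_le_norm ((κ : ℂ) ^ 2 - ε + t * Complex.I)
    simpa [pow_two] using this
  have e4 : ‖(κ : ℂ) ^ 2 - ε + t * Complex.I‖ ≤ 1 + |t| := by
    refine (norm_add_le _ _).trans (add_le_add ?_ (by simp))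
    have : (κ : ℂ) ^ 2 - ε = ((κ ^ 2 - ε : ℝ) : ℂ) := by push_cast; ring
    rw [this, Complex.norm_real, Real.norm_eq_abs, abs_le]; constructor <;> linarith
  have e5 : ‖m t‖ ^ 2 ≤ ‖(κ : ℂ) ^ 2 - ε + t * Complex.I‖ + 0.7 := by
    rw [← e2]
    have := norm_le_norm_add_norm_sub' (m t ^ 2) ((κ : ℂ) ^ 2 - ε + t * Complex.I)
    unfold dD at hD; linarith
  have e6 : ‖(κ : ℂ) ^ 2 - ε + t * Complex.I‖ - 0.7 ≤ ‖m t‖ ^ 2 := by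
    rw [← e2]
    have := norm_le_norm_add_norm_sub' ((κ : ℂ) ^ 2 - ε + t * Complex.I) (m t ^ 2)
    rw [norm_sub_rev] at this
    unfold dD at hD; linarith
  refine ⟨?_, ?_, ?_, ?_⟩
  · apply abs_le_of_sq_le_sq' _ hm |>.2
    rw [mul_pow, hs]; linarith
  · apply abs_le_of_sq_le_sq' _ hm |>.2
    linarith
  · apply abs_le_of_sq_le_sq' _ hn0 |>.2
    linarith
  · apply abs_le_of_sq_le_sq' _ (by positivity) |>.2
    rw [mul_pow, hs]; linarith

structure Far (κ ε : ℝ) (m Q : ℝ → ℂ) (N0 N1 : ℝ → ℝ) (t : ℝ) : Prop where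
  hm : 0 < (m t).re
  hD : ‖dD κ ε m t‖ < 0.7
  hq : ‖dq κ m Q t‖ < 0.27
  hN0 : N0 t < 1.8 / √|t|
  hN1 : N1 t < 3.5 / |t|

theorem norm_add_nonneg_ge {z : ℂ} {κ : ℝ} (hz : 0 ≤ z.re) (hκ : 0 ≤ κ) : ‖z‖ ≤ ‖z + κ‖ := by
  apply abs_le_of_sq_le_sq' _ (norm_nonneg _) |>.2
  rw [norm_sq_eq, norm_sq_eq]; simp only [Complex.add_re, Complex.add_im, Complex.ofReal_re, Complex.ofReal_im]
  nlinarith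

theorem far_prop {κ ε a b σ : ℝ} {m Q : ℝ → ℂ} {N0 N1 : ℝ → ℝ} (hκ0 : 0 ≤ κ) (hκ1 : κ ≤ 1)
    (hε0 : 0 ≤ ε) (hε : ε ≤ 0.0001) (hS : Sys κ ε m Q N0 N1 a b) (hσ : σ = 1 ∨ σ = -1)
    (hab : ∀ t ∈ Icc a b, 6 ≤ σ * t) (h0 : Far κ ε m Q N0 N1 a) :
    ∀ t ∈ Icc a b, Far κ ε m Q N0 N1 t := by
  by_cases hne : a ≤ b
  swap
  · intro t ht; exact absurd (ht.1.trans ht.2) hne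
  have habs : ∀ t ∈ Icc a b, |t| = σ * t := by
    intro t ht
    have := hab t ht
    rcases hσ with rfl | rfl
    · rw [one_mul] at *; exact abs_of_nonneg (by linarith)
    · rw [abs_of_nonpos] <;> linarith
  have h6 : ∀ t ∈ Icc a b, 6 ≤ |t| := fun t ht => by rw [habs t ht]; exact hab t ht
  have hDd : ∀ t ∈ Icc a b, HasDerivAt (dD κ ε m) (-Complex.I - (2 * m t) * dD κ ε m t) t := by
    intro t ht
    have hI : HasDerivAt (fun s : ℝ => (κ : ℂ) ^ 2 - ε + (s : ℂ) * Complex.I) (1 * Complex.I) t :=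
      ((Complex.ofRealCLM.hasDerivAt (x := t)).mul_const Complex.I).const_add _
    have := ((hS.hm t ht).pow 2).sub hI
    refine HasDerivAt.congr_deriv this ?_
    simp only [dD]; push_cast; ring
  have hDb : ∀ t ∈ Icc a b, (∀ s ∈ Icc a t, 0 ≤ (m s).re) → ‖dD κ ε m t‖ < 0.7 := by
    intro t ht hpos
    refine disc_barrier (a := a) (b := t) (z := dD κ ε m) (r := fun _ => -Complex.I) (p := fun t => 2 * m t)
      (e := fun _ => 0.7) (e' := fun _ => 0) (fun s hs => hDd s ⟨hs.1, hs.2.trans ht.2⟩)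
      (fun s _ => hasDerivAt_const s _) (fun _ _ => by norm_num) h0.hD ?_ t ⟨ht.1, le_rfl⟩
    intro s hs he
    have := (far_static hκ0 hκ1 hε0 hε (h6 s ⟨hs.1.le, hs.2.trans ht.2⟩) (hpos s ⟨hs.1.le, hs.2⟩) he.le).2.1
    have e : (2 * m s).re = 2 * (m s).re := by simp
    rw [e]; simp only [norm_neg, Complex.norm_I]; linarith
  have hmc : ∀ t ∈ Icc a b, 0 < (m t).re := by
    refine first_exit (f := fun t => (m t).re) ?_ ?_ h0.hm
    · intro t ht
      exact (Complex.continuous_re.continuousAt.comp (hS.hm t ht).continuousAt).continuousWithinAt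
    · intro t ht hpos
      have := (far_static hκ0 hκ1 hε0 hε (h6 t ht) (hpos t ⟨ht.1, le_rfl⟩) (hDb t ht hpos).le).2.1
      linarith
  have hD : ∀ t ∈ Icc a b, ‖dD κ ε m t‖ < 0.7 := fun t ht =>
    hDb t ht (fun s hs => (hmc s ⟨hs.1, hs.2.trans ht.2⟩).le)
  have hst := fun t ht => far_static hκ0 hκ1 hε0 hε (h6 t ht) (hmc t ht).le (hD t ht).le
  have hq : ∀ t ∈ Icc a b, ‖dq κ m Q t‖ < 0.27 := by
    refine disc_barrier (z := dq κ m Q) (r := fun t => dD κ ε m t * Q t) (p := fun t => m t + κ)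
      (e := fun _ => 0.27) (e' := fun _ => 0) ?_
      (fun s _ => hasDerivAt_const s _) (fun _ _ => by norm_num) h0.hq ?_
    · intro t ht
      have := (((hS.hm t ht).add_const (κ : ℂ)).mul (hS.hQ t ht)).const_sub 1
      refine HasDerivAt.congr_deriv this ?_
      simp only [dq, dD]; ring
    · intro t ht he
      have htI : t ∈ Icc a b := ⟨ht.1.le, ht.2⟩
      obtain ⟨s1, s2, s3, s4⟩ := hst t htI
      have hn := norm_add_nonneg_ge (hmc t htI).le hκ0
      have e : (m t + κ).re = (m t).re + κ := by simp
      have hQ : ‖m t + κ‖ * ‖Q t‖ ≤ 1.27 := by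
        rw [← norm_mul]
        have : (m t + κ) * Q t = 1 - dq κ m Q t := by simp [dq]
        rw [this]
        refine (norm_sub_le _ _).trans ?_
        rw [norm_one, he]; norm_num
      have hQ2 : 2.30 * ‖Q t‖ ≤ 1.27 := by nlinarith [norm_nonneg (Q t)]
      rw [e, norm_mul]
      have : ‖dD κ ε m t‖ * ‖Q t‖ ≤ 0.7 * ‖Q t‖ :=
        mul_le_mul_of_nonneg_right (hD t htI).le (norm_nonneg _)
      nlinarith
  have hs2 : ∀ t ∈ Icc a b, 2.449 ≤ √|t| := fun t ht => by
    apply Real.le_sqrt_of_sq_le; have := h6 t ht; norm_num; linarith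
  have hsq : ∀ t, √|t| ^ 2 = |t| := fun t => Real.sq_sqrt (abs_nonneg t)
  have hsd : ∀ t ∈ Icc a b, HasDerivAt (fun t => √(σ * t)) (σ / (2 * √|t|)) t := by
    intro t ht
    have h1 : HasDerivAt (fun t => σ * t) σ t := by simpa using (hasDerivAt_id t).const_mul σ
    have := h1.sqrt (by have := hab t ht; linarith)
    rw [habs t ht]; exact this
  have hN0' : ∀ t ∈ Icc a b, N0 t < 1.8 / √(σ * t) := by
    refine upper_barrier (e := fun t => 1.8 / √(σ * t)) 
      (e' := fun t => 1.8 * (- (σ / (2 * √|t|)) / √(σ * t) ^ 2)) hS.hN0 ?_ ?_ ?_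
    · intro t ht
      have h := ((hsd t ht).inv (by rw [← habs t ht]; linarith [hs2 t ht])).const_mul 1.8
      simpa [div_eq_mul_inv] using h
    · have := h0.hN0; rwa [habs a ⟨le_rfl, hne⟩] at this
    · intro t ht hz
      have htI : t ∈ Icc a b := ⟨ht.1.le, ht.2⟩
      simp only [hz]
      rw [← habs t htI]
      obtain ⟨s1, -, -, -⟩ := hst t htI
      have hs := hs2 t htI
      set s := √|t|
      have hs0 : 0 < s := by linarith
      have e1 : 1.1142 ≤ (m t).re * (1.8 / s) := by
        rw [mul_div_assoc', le_div_iff₀ hs0]; nlinarith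
      have e2 : -0.07 ≤ 1.8 * (-(σ / (2 * s)) / s ^ 2) := by
        have e3 : 1.8 * (-(σ / (2 * s)) / s ^ 2) = - (0.9 * σ / s ^ 3) := by field_simp; ring
        rw [e3]
        have : 0.9 * σ / s ^ 3 ≤ 0.07 := by
          rw [div_le_iff₀ (by positivity)]
          have : (2.449:ℝ) ^ 3 ≤ s ^ 3 := pow_le_pow_left₀ (by norm_num) hs 3
          rcases hσ with rfl | rfl <;> norm_num at * <;> linarith
        linarith
      linarith
  have hN1' : ∀ t ∈ Icc a b, N1 t < 3.5 / (σ * t) := by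
    refine upper_barrier (e := fun t => 3.5 / (σ * t)) 
      (e' := fun t => 3.5 * (- σ / (σ * t) ^ 2)) hS.hN1 ?_ ?_ ?_
    · intro t ht
      have h1 : HasDerivAt (fun t => σ * t) σ t := by simpa using (hasDerivAt_id t).const_mul σ
      have h := (h1.inv (by have := hab t ht; linarith)).const_mul 3.5
      simpa [div_eq_mul_inv] using h
    · have := h0.hN1; rwa [habs a ⟨le_rfl, hne⟩] at this
    · intro t ht hz
      have htI : t ∈ Icc a b := ⟨ht.1.le, ht.2⟩
      simp only [hz]
      have hn := hN0' t htI
      rw [← habs t htI] at hn ⊢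
      obtain ⟨s1, -, -, -⟩ := hst t htI
      have hs := hs2 t htI
      rw [← hsq t]
      set s := √|t|
      have hs0 : 0 < s := by linarith
      have e1 : 2.1665 / s ≤ (m t).re * (3.5 / s ^ 2) := by
        rw [mul_div_assoc', div_le_div_iff₀ hs0 (by positivity)]; nlinarith
      have e2 : -(0.24 / s) ≤ 3.5 * (-σ / (s ^ 2) ^ 2) := by
        have e3 : 3.5 * (-σ / (s ^ 2) ^ 2) = - (3.5 * σ / s ^ 3 / s) := by field_simp
        rw [e3]
        have : 3.5 * σ / s ^ 3 ≤ 0.24 := by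
          rw [div_le_iff₀ (by positivity)]
          have : (2.449:ℝ) ^ 3 ≤ s ^ 3 := pow_le_pow_left₀ (by norm_num) hs 3
          rcases hσ with rfl | rfl <;> norm_num at * <;> linarith
        have := div_le_div_of_nonneg_right this hs0.le
        linarith
      have e4 : 0.1 / s = 2.1665 / s - 0.24 / s - 1.8 / s - 0.0265 / s := by ring
      have : 0 < 0.1 / s := by positivity
      have : 0 < 0.0265 / s := by positivity
      linarith
  intro t ht
  refine ⟨hmc t ht, hD t ht, hq t ht, ?_, ?_⟩
  · rw [habs t ht]; exact hN0' t ht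
  · rw [habs t ht]; exact hN1' t ht

end Part6

section Part7

open Set

noncomputable def ph (t : ℝ) : ℝ := √(√(1 + t ^ 2))

theorem ph_pos (t : ℝ) : 0 < ph t := Real.sqrt_pos.2 (Real.sqrt_pos.2 (by positivity))
theorem ph_sq (t : ℝ) : ph t ^ 2 = √(1 + t ^ 2) := Real.sq_sqrt (Real.sqrt_nonneg _)
theorem ph_four (t : ℝ) : ph t ^ 4 = 1 + t ^ 2 := by
  have : ph t ^ 4 = (ph t ^ 2) ^ 2 := by ring
  rw [this, ph_sq, Real.sq_sqrt (by positivity)]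
theorem ph_one_le (t : ℝ) : 1 ≤ ph t := by
  rw [ph, Real.one_le_sqrt, Real.one_le_sqrt]; nlinarith [sq_nonneg t]
theorem abs_le_ph_sq (t : ℝ) : |t| ≤ ph t ^ 2 := by
  rw [ph_sq]; apply Real.le_sqrt_of_sq_le; rw [sq_abs]; linarith

structure GoodF (m Q : ℝ → ℂ) (N1 : ℝ → ℝ) (t : ℝ) : Prop where
  hm : 0.12 * ph t ≤ (m t).re
  hre : ‖Q t‖ ^ 2 ≤ 10 * (Q t).re
  hQ : 0.05 ≤ ‖Q t‖ * ph t
  hN : N1 t ≤ 6 * ‖Q t‖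

theorem GoodC.good {m Q : ℝ → ℂ} {N1 : ℝ → ℝ} {t : ℝ} (h : GoodC m Q N1 t) (ht : |t| ≤ 6) :
    GoodF m Q N1 t := by
  have h1 := ph_one_le t
  have h4 := ph_four t
  have ht2 : t ^ 2 ≤ 36 := by rw [← sq_abs]; nlinarith [abs_nonneg t]
  refine ⟨?_, h.hre, ?_, h.hN⟩
  · have : ph t ≤ 2.5 := by
      by_contra hc
      push Not at hc
      have : (2.5:ℝ)^4 < ph t ^ 4 := pow_lt_pow_left₀ hc (by norm_num) (by norm_num)
      norm_num at this; linarith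
    have := h.hm
    linarith
  · have := h.hQ; nlinarith [norm_nonneg (Q t)]

theorem Far.good {κ ε : ℝ} {m Q : ℝ → ℂ} {N0 N1 : ℝ → ℝ} {t : ℝ} (h : Far κ ε m Q N0 N1 t)
    (hκ0 : 0 ≤ κ) (hκ1 : κ ≤ 1) (hε0 : 0 ≤ ε) (hε : ε ≤ 0.0001) (ht : 6 ≤ |t|) :
    GoodF m Q N1 t := by
  obtain ⟨s1, s2, s3, s4⟩ := far_static hκ0 hκ1 hε0 hε ht h.hm.le h.hD.le
  have hq := h.hq
  have hs : √|t| ^ 2 = |t| := Real.sq_sqrt (abs_nonneg t)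
  have hs2 : 2.449 ≤ √|t| := by
    apply Real.le_sqrt_of_sq_le; norm_num; linarith
  have hN1 := h.hN1
  rw [← hs] at hN1
  have h1 := ph_one_le t
  have h4 := ph_four t
  have hps : √|t| ≤ ph t := by
    apply abs_le_of_sq_le_sq' _ (ph_pos t).le |>.2
    rw [hs]; exact abs_le_ph_sq t
  have hps2 : ph t ≤ 1.1 * √|t| := by
    by_contra hc
    push Not at hc
    have : (1.1 * √|t|)^4 < ph t ^ 4 := pow_lt_pow_left₀ hc (by positivity) (by norm_num)
    have e : (1.1 * √|t|)^4 = 1.4641 * (√|t| ^ 2) ^ 2 := by ring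
    rw [e, hs, h4, sq_abs] at this
    have : t ^ 2 ≥ 36 := by rw [← sq_abs]; nlinarith
    linarith
  set s := √|t| with hsdef
  have hnQ : (m t + κ) * Q t = 1 - dq κ m Q t := by simp [dq]
  have hnup : ‖m t + κ‖ ≤ 1.55 * s := by
    refine (norm_add_le _ _).trans ?_
    rw [Complex.norm_real, Real.norm_of_nonneg hκ0]; linarith
  have hnlo := norm_add_nonneg_ge h.hm.le hκ0
  have hnpos : 0 < ‖m t + κ‖ := by linarith
  have hQn : ‖m t + κ‖ * ‖Q t‖ = ‖1 - dq κ m Q t‖ := by rw [← norm_mul, hnQ]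
  have hq1 : 0.73 ≤ ‖1 - dq κ m Q t‖ := by
    have := norm_sub_norm_le (1:ℂ) (dq κ m Q t)
    rw [norm_one] at this; linarith
  have hq2 : ‖1 - dq κ m Q t‖ ≤ 1.27 := by
    refine (norm_sub_le _ _).trans ?_
    rw [norm_one]; linarith
  have hQs : 0.47 ≤ ‖Q t‖ * s := by nlinarith [norm_nonneg (Q t)]
  refine ⟨by linarith, ?_, ?_, ?_⟩
  · have key : (Q t).re * ‖m t + κ‖ ^ 2 = ((1 - dq κ m Q t) * (starRingEnd ℂ) (m t + κ)).re := by
      rw [← hnQ, norm_sq_eq]; simp only [Complex.mul_re, Complex.mul_im, Complex.conj_re, Complex.conj_im]; ring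
    have k2 : ((1 - dq κ m Q t) * (starRingEnd ℂ) (m t + κ)).re
        = (m t + κ).re - (dq κ m Q t * (starRingEnd ℂ) (m t + κ)).re := by
      rw [sub_mul, one_mul, Complex.sub_re, Complex.conj_re]
    have k3 : (dq κ m Q t * (starRingEnd ℂ) (m t + κ)).re ≤ 0.27 * ‖m t + κ‖ := by
      refine (Complex.re_le_norm _).trans ?_
      rw [norm_mul, Complex.norm_conj]
      exact mul_le_mul_of_nonneg_right hq.le (norm_nonneg _)
    have k4 : ‖m t + κ‖ ≤ ‖m t‖ + κ := by
      refine (norm_add_le _ _).trans ?_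
      rw [Complex.norm_real, Real.norm_of_nonneg hκ0]
    have k5 : (m t + κ).re = (m t).re + κ := by simp
    have k6 : 0.2 ≤ (Q t).re * ‖m t + κ‖ ^ 2 := by
      rw [key, k2]; linarith
    have k7 : ‖Q t‖ ^ 2 * ‖m t + κ‖ ^ 2 ≤ 1.6129 := by
      have : ‖Q t‖ ^ 2 * ‖m t + κ‖ ^ 2 = (‖m t + κ‖ * ‖Q t‖) ^ 2 := by ring
      rw [this, hQn]; nlinarith [norm_nonneg (1 - dq κ m Q t)]
    have : ‖Q t‖ ^ 2 * ‖m t + κ‖ ^ 2 ≤ (10 * (Q t).re) * ‖m t + κ‖ ^ 2 := by linarith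
    exact le_of_mul_le_mul_right this (by positivity)
  · nlinarith [norm_nonneg (Q t)]
  · have : 3.5 / s ^ 2 ≤ 6 * ‖Q t‖ := by
      rw [div_le_iff₀ (by positivity)]; nlinarith
    linarith

theorem norm_mk_le {a b r : ℝ} (hr : 0 ≤ r) (h : a ^ 2 + b ^ 2 ≤ r ^ 2) : ‖(⟨a, b⟩ : ℂ)‖ ≤ r :=
  norm_le_of_sq hr h

theorem entry_sound {κ ε : ℝ} {m Q : ℝ → ℂ} {N0 N1 : ℝ → ℝ} {K : ℤ} {x : Row}
    (hκ : |κ - (K:ℝ) / 10000| ≤ 0.1) (hκ0 : 0 ≤ κ) (hκ1 : κ ≤ 1) (hK : 0 ≤ K)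
    (hε0 : 0 ≤ ε) (hε : ε ≤ 0.0001) (hF : Far κ ε m Q N0 N1 (-6)) (ho : okStart K x = true) :
    EncInv m Q N0 N1 x (-6) := by
  simp only [okStart, Bool.and_eq_true, decide_eq_true_eq] at ho
  obtain ⟨⟨⟨⟨⟨⟨⟨⟨o1, o2⟩, o3⟩, o4⟩, o5⟩, o6⟩, o7⟩, o8⟩, o9⟩ := ho
  obtain ⟨a, b, c, d, e, g, n0, n1, V, r, rq⟩ := x
  simp only at *
  rify at *
  have h6 : |(-6:ℝ)| = 6 := by norm_num
  obtain ⟨s1, s2, s3, s4⟩ := far_static hκ0 hκ1 hε0 hε (by rw [h6]) hF.hm.le hF.hD.le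
  have hda := da_bound hκ hκ0 hK hε0 hε
  have hN0 := hF.hN0
  have hN1 := hF.hN1
  rw [h6] at hN0 hN1
  have hs2 : 2.449 ≤ √(6:ℝ) := by apply Real.le_sqrt_of_sq_le; norm_num
  set M : ℂ := ⟨(a:ℝ)/10000, (b:ℝ)/10000⟩ with hM
  set Qz : ℂ := ⟨(c:ℝ)/10000, (d:ℝ)/10000⟩ with hQz
  have hr1 : ‖((K:ℝ)/10000 : ℂ) ^ 2 + (-6:ℝ) * Complex.I - M ^ 2‖ ≤ 0.01 := by
    apply norm_le_of_sq (by norm_num)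
    rw [hM]
    simp [pow_two]
    simp only [pow_two] at o1
    linarith only [o1]
  have hr2 : ‖1 - (M + ((K:ℝ)/10000 : ℂ)) * Qz‖ ≤ 0.01 := by
    apply norm_le_of_sq (by norm_num)
    rw [hM, hQz]
    simp [pow_two]
    simp only [pow_two] at o4
    linarith only [o4]
  have hV : ‖Qz‖ ≤ (V:ℝ)/10000 := by
    apply norm_mk_le (by positivity); linarith only [o9]
  have hm' : ‖m (-6) - M‖ < (e:ℝ)/10000 := by
    have e1 : (m (-6) - M) * (m (-6) + M) = dD κ ε m (-6)
        + (((K:ℝ)/10000 : ℂ) ^ 2 + (-6:ℝ) * Complex.I - M ^ 2)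
        + ((κ ^ 2 - ε - ((K:ℝ)/10000) ^ 2 : ℝ) : ℂ) := by
      simp only [dD]; push_cast; ring
    have e2 : ‖m (-6) - M‖ * ‖m (-6) + M‖ ≤ 0.7 + 0.01 + (1000 * (2 * (K:ℝ) + 1000) + 10000) / 100000000 := by
      rw [← norm_mul, e1]
      refine (norm_add₃_le).trans ?_
      rw [Complex.norm_real, Real.norm_eq_abs]
      linarith only [hF.hD, hr1, hda]
    have e3 : 1.51 + (a:ℝ)/10000 ≤ ‖m (-6) + M‖ := by
      refine le_trans ?_ (Complex.re_le_norm _)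
      rw [Complex.add_re, hM]; simp only; linarith only [s2]
    have e4 : ‖m (-6) - M‖ * (1.51 + (a:ℝ)/10000) < (e:ℝ)/10000 * (1.51 + (a:ℝ)/10000) := by
      have := mul_le_mul_of_nonneg_left e3 (norm_nonneg (m (-6) - M))
      linarith only [this, e2, o2]
    exact lt_of_mul_lt_mul_right e4 (by positivity)
  refine ⟨hm', ?_, ?_, ?_⟩
  · change ‖Q (-6) - Qz‖ < (g:ℝ)/10000
    have e1 : (m (-6) + κ) * (Q (-6) - Qz) = (1 - (M + ((K:ℝ)/10000 : ℂ)) * Qz) - dq κ m Q (-6)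
       - ((m (-6) - M) + ((κ - (K:ℝ)/10000 : ℝ) : ℂ)) * Qz := by
      simp only [dq]; push_cast; ring
    have e2 : ‖m (-6) + κ‖ * ‖Q (-6) - Qz‖ ≤ 0.01 + 0.27 + ((e:ℝ)/10000 + 0.1) * ((V:ℝ)/10000) := by
      rw [← norm_mul, e1]
      refine (norm_sub_le _ _).trans (add_le_add ((norm_sub_le _ _).trans (add_le_add hr2 hF.hq.le)) ?_)
      rw [norm_mul]
      apply mul_le_mul _ hV (norm_nonneg _) (by linarith only [norm_nonneg (m (-6) - M), hm'])
      refine (norm_add_le _ _).trans (add_le_add hm'.le ?_)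
      rw [Complex.norm_real]; exact hκ
    have e3 := norm_add_nonneg_ge hF.hm.le hκ0
    have e4 : 2.30 * ‖Q (-6) - Qz‖ ≤ ‖m (-6) + κ‖ * ‖Q (-6) - Qz‖ :=
      mul_le_mul_of_nonneg_right (by linarith only [e3, s3]) (norm_nonneg _)
    linarith only [e4, e2, o5]
  · have : 1.8 / √(6:ℝ) ≤ 0.735 := by rw [div_le_iff₀ (by linarith only [hs2])]; linarith only [hs2]
    simp only; linarith only [this, hN0, o6]
  · simp only; norm_num at hN1; linarith only [hN1, o7]

theorem exit_sound {κ ε : ℝ} {m Q : ℝ → ℂ} {N0 N1 : ℝ → ℝ} {K : ℤ} {x : Row}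
    (hκ : |κ - (K:ℝ) / 10000| ≤ 0.1) (hκ0 : 0 ≤ κ) (hK : 0 ≤ K)
    (hε0 : 0 ≤ ε) (hε : ε ≤ 0.0001) (hI : EncInv m Q N0 N1 x 6) (ho : okEnd K x = true)
    (hm0 : 0 < (m 6).re) : Far κ ε m Q N0 N1 6 := by
  simp only [okEnd, Bool.and_eq_true, decide_eq_true_eq] at ho
  obtain ⟨⟨⟨⟨⟨⟨⟨⟨⟨⟨o1, o2⟩, o3⟩, o4⟩, o5⟩, o6⟩, o7⟩, o8⟩, o9⟩, o10⟩, o11⟩ := ho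
  obtain ⟨a, b, c, d, e, g, n0, n1, V, r, rq⟩ := x
  obtain ⟨I1, I2, I3, I4⟩ := hI
  simp only [Row.M, Row.Q] at *
  rify at *
  have h6 : |(6:ℝ)| = 6 := by norm_num
  have hda := da_bound hκ hκ0 hK hε0 hε
  have hs2 : √(6:ℝ) ≤ 2.4495 := by rw [Real.sqrt_le_left (by norm_num)]; norm_num
  set M : ℂ := ⟨(a:ℝ)/10000, (b:ℝ)/10000⟩ with hM
  set Qz : ℂ := ⟨(c:ℝ)/10000, (d:ℝ)/10000⟩ with hQz
  have hr1 : ‖M ^ 2 - ((K:ℝ)/10000 : ℂ) ^ 2 - (6:ℝ) * Complex.I‖ ≤ (r:ℝ)/10000 := by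
    apply norm_le_of_sq (by positivity)
    rw [hM]
    simp [pow_two]
    simp only [pow_two] at o1
    linarith only [o1]
  have hr2 : ‖1 - (M + ((K:ℝ)/10000 : ℂ)) * Qz‖ ≤ (rq:ℝ)/10000 := by
    apply norm_le_of_sq (by positivity)
    rw [hM, hQz]
    simp [pow_two]
    simp only [pow_two] at o5
    linarith only [o5]
  have hV : ‖Qz‖ ≤ (V:ℝ)/10000 := by
    apply norm_mk_le (by positivity); linarith only [o8]
  have hMn : ‖M‖ ≤ 2.6 := by
    apply norm_mk_le (by norm_num); linarith only [o3]
  have he0 : 0 ≤ (e:ℝ)/10000 := (norm_nonneg _).trans I1.le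
  have hg0 : 0 ≤ (g:ℝ)/10000 := (norm_nonneg _).trans I2.le
  refine ⟨hm0, ?_, ?_, ?_, ?_⟩
  · have e1 : dD κ ε m 6 = (M ^ 2 - ((K:ℝ)/10000 : ℂ) ^ 2 - (6:ℝ) * Complex.I)
        + (m 6 - M) * (2 * M + (m 6 - M)) + (-((κ ^ 2 - ε - ((K:ℝ)/10000) ^ 2 : ℝ) : ℂ)) := by
      simp only [dD]; push_cast; ring
    have e2 : ‖2 * M + (m 6 - M)‖ ≤ 5.2 + (e:ℝ)/10000 := by
      refine (norm_add_le _ _).trans (add_le_add ?_ I1.le)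
      rw [norm_mul]; simp only [Complex.norm_ofNat]; linarith only [hMn]
    have e3 : ‖(m 6 - M) * (2 * M + (m 6 - M))‖ ≤ (e:ℝ)/10000 * (5.2 + (e:ℝ)/10000) := by
      rw [norm_mul]; exact mul_le_mul I1.le e2 (norm_nonneg _) he0
    rw [e1]
    refine (norm_add₃_le).trans_lt ?_
    rw [norm_neg, Complex.norm_real, Real.norm_eq_abs]
    linarith only [hr1, e3, hda, o4]
  · have e1 : dq κ m Q 6 = (1 - (M + ((K:ℝ)/10000 : ℂ)) * Qz)
       + (-(((m 6 - M) + ((κ - (K:ℝ)/10000 : ℝ) : ℂ)) * Qz))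
       + (-((M + (m 6 - M) + ((K:ℝ)/10000 : ℝ) + ((κ - (K:ℝ)/10000 : ℝ) : ℂ)) * (Q 6 - Qz))) := by
      simp only [dq]; push_cast; ring
    have e2 : ‖((m 6 - M) + ((κ - (K:ℝ)/10000 : ℝ) : ℂ)) * Qz‖ ≤ ((e:ℝ)/10000 + 0.1) * ((V:ℝ)/10000) := by
      rw [norm_mul]
      apply mul_le_mul _ hV (norm_nonneg _) (by linarith only [he0])
      refine (norm_add_le _ _).trans (add_le_add I1.le ?_)
      rw [Complex.norm_real]; exact hκ
    have e3 : ‖(M + (m 6 - M) + ((K:ℝ)/10000 : ℝ) + ((κ - (K:ℝ)/10000 : ℝ) : ℂ)) * (Q 6 - Qz)‖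
        ≤ (2.6 + (e:ℝ)/10000 + (K:ℝ)/10000 + 0.1) * ((g:ℝ)/10000) := by
      rw [norm_mul]
      apply mul_le_mul _ I2.le (norm_nonneg _) (by positivity)
      refine (norm_add_le _ _).trans (add_le_add ((norm_add_le _ _).trans (add_le_add
        ((norm_add_le _ _).trans (add_le_add hMn I1.le)) ?_)) ?_)
      · rw [Complex.norm_real, Real.norm_of_nonneg (by positivity)]
      · rw [Complex.norm_real]; exact hκ
    rw [e1]
    refine (norm_add₃_le).trans_lt ?_
    rw [norm_neg, norm_neg]
    linarith only [hr2, e2, e3, o9]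
  · rw [h6]
    have : 0.734 ≤ 1.8 / √(6:ℝ) := by rw [le_div_iff₀ (by positivity)]; linarith only [hs2]
    linarith only [this, I3, o10]
  · rw [h6]; norm_num; linarith only [I4, o11]

theorem table_sound {κ ε : ℝ} {m Q : ℝ → ℂ} {N0 N1 : ℝ → ℝ} {K : ℤ} {l : List Row}
    (hκ : |κ - (K:ℝ) / 10000| ≤ 0.1) (hκ0 : 0 ≤ κ) (hκ1 : κ ≤ 1) (hK : 0 ≤ K)
    (hε0 : 0 ≤ ε) (hε : ε ≤ 0.0001) (ho : tableOK K l = true)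
    (hF : Far κ ε m Q N0 N1 (-6)) :
    (∀ b < 6, Sys κ ε m Q N0 N1 (-6) b → ∀ t ∈ Icc (-6) b, GoodC m Q N1 t) ∧
    (Sys κ ε m Q N0 N1 (-6) 6 → Far κ ε m Q N0 N1 6) := by
  match l, ho with
  | x :: l, ho =>
    simp only [tableOK, Bool.and_eq_true] at ho
    have hI := entry_sound hκ hκ0 hκ1 hK hε0 hε hF ho.1
    have e : (((-96:ℤ):ℝ)/16) = -6 := by norm_num
    refine ⟨fun b hb hS => ?_, fun hS => ?_⟩
    · have := chain_part (m := m) (Q := Q) (N0 := N0) (N1 := N1)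
        hκ hκ0 hK hε0 hε hb l (-96) x ho.2 (by rw [e]; exact hS) (by rw [e]; exact hI)
      rwa [e] at this
    · obtain ⟨h1, h2, z, h3, h4⟩ := chain_sound (m := m) (Q := Q) (N0 := N0) (N1 := N1)
        hκ hκ0 hK hε0 hε l (-96) x ho.2 (by rw [e]; exact hS) (by rw [e]; exact hI) (by rw [e]; exact hF.hm)
      exact exit_sound hκ hκ0 hK hε0 hε h4 h3 h2

theorem middle_sound {κ ε : ℝ} {m Q : ℝ → ℂ} {N0 N1 : ℝ → ℝ} (hκ0 : 0 ≤ κ) (hκ1 : κ ≤ 1)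
    (hε0 : 0 ≤ ε) (hε : ε ≤ 0.0001) (hF : Far κ ε m Q N0 N1 (-6)) :
    (∀ b < 6, Sys κ ε m Q N0 N1 (-6) b → ∀ t ∈ Icc (-6) b, GoodC m Q N1 t) ∧
    (Sys κ ε m Q N0 N1 (-6) 6 → Far κ ε m Q N0 N1 6) := by
  have key : ∀ (K : ℤ) (l : List Row), tableOK K l = true → 0 ≤ K → |κ - (K:ℝ)/10000| ≤ 0.1 →
    (∀ b < 6, Sys κ ε m Q N0 N1 (-6) b → ∀ t ∈ Icc (-6) b, GoodC m Q N1 t) ∧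
    (Sys κ ε m Q N0 N1 (-6) 6 → Far κ ε m Q N0 N1 6) :=
    fun K l h1 h2 h3 => table_sound h3 hκ0 hκ1 h2 hε0 hε h1 hF
  by_cases c1 : κ ≤ 0.2
  · exact key 1000 _ tbl1000_ok (by norm_num) (by rw [abs_le]; constructor <;> norm_num <;> linarith)
  by_cases c2 : κ ≤ 0.4
  · exact key 3000 _ tbl3000_ok (by norm_num) (by rw [abs_le]; constructor <;> norm_num <;> linarith)
  by_cases c3 : κ ≤ 0.6
  · exact key 5000 _ tbl5000_ok (by norm_num) (by rw [abs_le]; constructor <;> norm_num <;> linarith)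
  by_cases c4 : κ ≤ 0.8
  · exact key 7000 _ tbl7000_ok (by norm_num) (by rw [abs_le]; constructor <;> norm_num <;> linarith)
  · exact key 9000 _ tbl9000_ok (by norm_num) (by rw [abs_le]; constructor <;> norm_num <;> linarith)

/-- All-time bounds for the Riccati system started in the far regime. -/
theorem sys_good {κ ε a b : ℝ} {m Q : ℝ → ℂ} {N0 N1 : ℝ → ℝ} (hκ0 : 0 ≤ κ) (hκ1 : κ ≤ 1)
    (hε0 : 0 ≤ ε) (hε : ε ≤ 0.0001) (ha : a ≤ -6)
    (hF : Far κ ε m Q N0 N1 a) (hS : Sys κ ε m Q N0 N1 a b) :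
    ∀ t ∈ Icc a b, GoodF m Q N1 t := by
  have f1 : ∀ t ∈ Icc a b, t ≤ -6 → Far κ ε m Q N0 N1 t := by
    intro t ht h6
    exact far_prop (b := t) (σ := -1) hκ0 hκ1 hε0 hε (hS.mono le_rfl ht.2) (Or.inr rfl)
      (fun s hs => by linarith [hs.2]) hF t ⟨ht.1, le_rfl⟩
  intro t ht
  by_cases c1 : t ≤ -6
  · exact (f1 t ht c1).good hκ0 hκ1 hε0 hε (by rw [abs_of_nonpos] <;> linarith)
  push Not at c1
  obtain ⟨f2, f3⟩ := middle_sound hκ0 hκ1 hε0 hε (f1 (-6) ⟨ha, by linarith [ht.2]⟩ le_rfl)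
  by_cases c2 : t < 6
  · exact (f2 t c2 (hS.mono ha ht.2) t ⟨c1.le, le_rfl⟩).good (by rw [abs_le]; constructor <;> linarith)
  push Not at c2
  have f4 := far_prop (a := 6) (b := t) (σ := 1) hκ0 hκ1 hε0 hε (hS.mono (by linarith) ht.2) (Or.inl rfl)
    (fun s hs => by linarith [hs.1]) (f3 (hS.mono ha (by linarith [ht.2])))
  exact (f4 t ⟨c2, le_rfl⟩).good hκ0 hκ1 hε0 hε (by rw [abs_of_nonneg] <;> linarith)

end Part7

section Part8

open Set

/-- coefficients of an entire power series -/
def Ent (c : ℕ → ℂ) : Prop := ∀ ρ : ℝ, 1 ≤ ρ → ∃ C : ℝ, ∀ n, ‖c n‖ * ρ ^ n ≤ C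

theorem Ent.summable {c : ℕ → ℂ} (h : Ent c) {R : ℝ} (hR : 1 ≤ R) :
    Summable (fun n : ℕ => ‖c n‖ * R ^ n) := by
  obtain ⟨C, hC⟩ := h (2 * R) (by linarith)
  refine Summable.of_nonneg_of_le (fun n => by positivity) (fun n => ?_)
    ((summable_geometric_of_lt_one (r := (1/2:ℝ)) (by norm_num) (by norm_num)).mul_left C)
  have := hC n
  rw [mul_pow] at this
  have h2 : (0:ℝ) < 2 ^ n := by positivity
  have e : (1/2:ℝ) ^ n = (2 ^ n)⁻¹ := by rw [one_div, inv_pow]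
  rw [e, ← div_eq_mul_inv, le_div_iff₀ h2]
  linarith

theorem Ent.shift {c : ℕ → ℂ} (h : Ent c) : Ent (fun n => ((n : ℂ) + 1) * c (n + 1)) := by
  intro ρ hρ
  obtain ⟨C, hC⟩ := h (2 * ρ) (by linarith)
  refine ⟨C, fun n => ?_⟩
  have h1 := hC (n + 1)
  rw [norm_mul]
  have e : ‖(n : ℂ) + 1‖ = n + 1 := by
    have : (n : ℂ) + 1 = ((n + 1 : ℝ) : ℂ) := by push_cast; ring
    rw [this, Complex.norm_real, Real.norm_of_nonneg (by positivity)]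
  rw [e]
  have h2 : (n : ℝ) + 1 ≤ 2 ^ (n + 1) := by exact_mod_cast (Nat.lt_two_pow_self (n := n+1)).le
  have h3 : ρ ^ n ≤ ρ ^ (n + 1) := pow_le_pow_right₀ hρ (by omega)
  calc ((n : ℝ) + 1) * ‖c (n + 1)‖ * ρ ^ n ≤ 2 ^ (n + 1) * ‖c (n + 1)‖ * ρ ^ (n + 1) := by gcongr
    _ = ‖c (n + 1)‖ * (2 * ρ) ^ (n + 1) := by rw [mul_pow]; ring
    _ ≤ C := h1

theorem Ent.summable' {c : ℕ → ℂ} (h : Ent c) (x : ℝ) : Summable (fun n : ℕ => c n * (x : ℂ) ^ n) := by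
  have := h.summable (R := 1 + |x|) (by linarith [abs_nonneg x])
  refine Summable.of_norm_bounded this (fun n => ?_)
  rw [norm_mul, norm_pow, Complex.norm_real, Real.norm_eq_abs]
  gcongr
  linarith

theorem Ent.hasDerivAt {c : ℕ → ℂ} (h : Ent c) (x : ℝ) :
    HasDerivAt (fun x : ℝ => ∑' n, c n * (x : ℂ) ^ n) (∑' n : ℕ, ((n : ℂ) + 1) * c (n + 1) * (x : ℂ) ^ n) x := by
  set R := 1 + |x| with hR
  have hs := h.shift.summable (R := R) (by linarith [abs_nonneg x])
  have hu : Summable (fun n : ℕ => ‖(n : ℂ) * c n‖ * R ^ (n - 1)) := by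
    rw [← summable_nat_add_iff 1]
    simpa using hs
  have key := hasDerivAt_tsum_of_isPreconnected (𝕜 := ℝ) (F := ℂ) (u := fun n : ℕ => ‖(n : ℂ) * c n‖ * R ^ (n - 1))
    (t := Ioo (-R) R) (g := fun n x => c n * (x : ℂ) ^ n)
    (g' := fun n x => (n : ℂ) * c n * (x : ℂ) ^ (n - 1)) (y₀ := x) (y := x) hu isOpen_Ioo isPreconnected_Ioo ?_ ?_ ?_ ?_ ?_
  · refine key.congr_deriv ?_
    have hs2 : Summable (fun n : ℕ => (n : ℂ) * c n * (x : ℂ) ^ (n - 1)) := by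
      rw [← summable_nat_add_iff 1]
      have := h.shift.summable' x
      simpa using this
    rw [hs2.tsum_eq_zero_add]
    simp
  · intro n y _
    have h1 : HasDerivAt (fun y : ℝ => (y : ℂ)) 1 y := Complex.ofRealCLM.hasDerivAt
    refine ((h1.pow n).const_mul (c n)).congr_deriv ?_
    ring
  · intro n y hy
    rw [norm_mul, norm_pow, Complex.norm_real, Real.norm_eq_abs]
    gcongr
    exact (abs_lt.2 hy).le
  · exact ⟨by linarith [neg_abs_le x], by linarith [le_abs_self x]⟩
  · exact h.summable' x
  · exact ⟨by linarith [neg_abs_le x], by linarith [le_abs_self x]⟩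

noncomputable def cf (a p q : ℂ) : ℕ → ℂ
  | 0 => p
  | 1 => q
  | 2 => a * p / 2
  | n + 3 => (a * cf a p q (n + 1) + Complex.I * cf a p q n) / (((n : ℂ) + 2) * ((n : ℂ) + 3))

theorem cf_ent (a p q : ℂ) : Ent (cf a p q) := by
  intro ρ hρ
  obtain ⟨N, hN⟩ := exists_nat_ge (‖a‖ * ρ ^ 2 + ρ ^ 3)
  refine ⟨∑ n ∈ Finset.range (N + 3), ‖cf a p q n‖ * ρ ^ n, ?_⟩
  intro n
  induction n using Nat.strong_induction_on with
  | _ n ih =>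
    by_cases hn : n < N + 3
    · exact Finset.single_le_sum (f := fun n => ‖cf a p q n‖ * ρ ^ n) (fun i _ => by positivity) (Finset.mem_range.2 hn)
    · obtain ⟨k, rfl⟩ : ∃ k, n = k + 3 := ⟨n - 3, by omega⟩
      have i1 := ih (k + 1) (by omega)
      have i0 := ih k (by omega)
      set C := ∑ n ∈ Finset.range (N + 3), ‖cf a p q n‖ * ρ ^ n
      have hC0 : 0 ≤ C := Finset.sum_nonneg (fun i _ => by positivity)
      rw [cf, norm_div]
      have e : ‖((k : ℂ) + 2) * ((k : ℂ) + 3)‖ = (k + 2) * (k + 3) := by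
        have : ((k : ℂ) + 2) * ((k : ℂ) + 3) = (((k + 2) * (k + 3) : ℝ) : ℂ) := by push_cast; ring
        rw [this, Complex.norm_real, Real.norm_of_nonneg (by positivity)]
      rw [e, div_mul_eq_mul_div, div_le_iff₀ (by positivity)]
      have hk : (N : ℝ) ≤ k := by exact_mod_cast (by omega : N ≤ k)
      have b1 : ‖a * cf a p q (k + 1) + Complex.I * cf a p q k‖ ≤ ‖a‖ * ‖cf a p q (k + 1)‖ + ‖cf a p q k‖ := by
        refine (norm_add_le _ _).trans ?_
        rw [norm_mul, norm_mul, Complex.norm_I, one_mul]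
      calc ‖a * cf a p q (k + 1) + Complex.I * cf a p q k‖ * ρ ^ (k + 3)
          ≤ (‖a‖ * ‖cf a p q (k + 1)‖ + ‖cf a p q k‖) * ρ ^ (k + 3) := by gcongr
        _ = ‖a‖ * ρ ^ 2 * (‖cf a p q (k + 1)‖ * ρ ^ (k + 1)) + ρ ^ 3 * (‖cf a p q k‖ * ρ ^ k) := by ring
        _ ≤ ‖a‖ * ρ ^ 2 * C + ρ ^ 3 * C := by gcongr
        _ = C * (‖a‖ * ρ ^ 2 + ρ ^ 3) := by ring
        _ ≤ C * ((k + 2) * (k + 3)) := by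
          apply mul_le_mul_of_nonneg_left _ hC0
          have : (0:ℝ) ≤ k := Nat.cast_nonneg k
          nlinarith

theorem exists_sol0 (a p q : ℂ) : ∃ W W' : ℝ → ℂ, W 0 = p ∧ W' 0 = q ∧
    (∀ x, HasDerivAt W (W' x) x) ∧ ∀ x : ℝ, HasDerivAt W' ((a + x * Complex.I) * W x) x := by
  have hE := cf_ent a p q
  refine ⟨fun x => ∑' n, cf a p q n * (x : ℂ) ^ n,
    fun x => ∑' n : ℕ, ((n : ℂ) + 1) * cf a p q (n + 1) * (x : ℂ) ^ n, ?_, ?_, fun x => hE.hasDerivAt x, ?_⟩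
  · simp only
    rw [tsum_eq_single 0]
    · simp [cf]
    · intro n hn; simp [hn]
  · simp only
    rw [tsum_eq_single 0]
    · simp [cf]
    · intro n hn; simp [hn]
  · intro x
    refine (hE.shift.hasDerivAt x).congr_deriv ?_
    have hs := hE.summable' x
    have hs1 := (hE.shift.shift).summable' x
    rw [hs1.tsum_eq_zero_add]
    have h2 : ∀ n : ℕ, ((n + 1 : ℕ) + 1 : ℂ) * (((n + 1 + 1 : ℕ) : ℂ) + 1) * cf a p q (n + 1 + 1 + 1) * (x : ℂ) ^ (n + 1)
       = a * (cf a p q (n + 1) * (x : ℂ) ^ (n + 1)) + x * Complex.I * (cf a p q n * (x : ℂ) ^ n) := by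
      intro n
      rw [cf]
      have hA : ((n : ℂ) + 2) ≠ 0 := by exact_mod_cast (by positivity : (0:ℝ) < n + 2).ne'
      have hB : ((n : ℂ) + 3) ≠ 0 := by exact_mod_cast (by positivity : (0:ℝ) < n + 3).ne'
      push_cast
      field_simp
      ring
    have h3 : (∑' n : ℕ, ((n + 1 : ℕ) + 1 : ℂ) * ((((n + 1 + 1 : ℕ) : ℂ) + 1) * cf a p q (n + 1 + 1 + 1)) * (x : ℂ) ^ (n + 1))
      = ∑' n : ℕ, (a * (cf a p q (n + 1) * (x : ℂ) ^ (n + 1)) + x * Complex.I * (cf a p q n * (x : ℂ) ^ n)) := by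
      apply tsum_congr; intro n; rw [← h2]; ring
    rw [h3, Summable.tsum_add (((summable_nat_add_iff 1).2 hs).mul_left a) (hs.mul_left _), tsum_mul_left, tsum_mul_left]
    beta_reduce
    have h4 := hs.tsum_eq_zero_add
    simp only [cf, pow_zero, mul_one] at h4
    generalize (∑' n : ℕ, cf a p q n * (x : ℂ) ^ n) = S at *
    generalize (∑' n : ℕ, cf a p q (n + 1) * (x : ℂ) ^ (n + 1)) = S1 at *
    simp [cf]
    rw [h4]
    ring

theorem exists_sol (κ ε s : ℝ) (p q : ℂ) : ∃ W W' : ℝ → ℂ, W s = p ∧ W' s = q ∧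
    (∀ t, HasDerivAt W (W' t) t) ∧
    ∀ t : ℝ, HasDerivAt W' (((κ : ℂ) ^ 2 - ε + t * Complex.I) * W t) t := by
  obtain ⟨W, W', h0, h1, h2, h3⟩ := exists_sol0 ((κ : ℂ) ^ 2 - ε + s * Complex.I) p q
  refine ⟨fun t => W (t - s), fun t => W' (t - s), by simpa, by simpa, fun t => ?_, fun t => ?_⟩
  · have := (h2 (t - s)).scomp t ((hasDerivAt_id t).sub_const s)
    exact HasDerivAt.congr_deriv this (by simp)
  · have := (h3 (t - s)).scomp t ((hasDerivAt_id t).sub_const s)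
    refine HasDerivAt.congr_deriv this ?_
    rw [one_smul]; push_cast; ring

end Part8

section Part9

open Set MeasureTheory intervalIntegral

structure IsSol (κ ε : ℝ) (W W' : ℝ → ℂ) : Prop where
  h1 : ∀ t, HasDerivAt W (W' t) t
  h2 : ∀ t : ℝ, HasDerivAt W' (((κ : ℂ) ^ 2 - ε + t * Complex.I) * W t) t

theorem IsSol.cont {κ ε : ℝ} {W W' : ℝ → ℂ} (h : IsSol κ ε W W') : Continuous W :=
  continuous_iff_continuousAt.2 (fun t => (h.h1 t).continuousAt)

theorem hasDerivAt_normsq {W W' : ℝ → ℂ} {t : ℝ} (h : HasDerivAt W (W' t) t) (h0 : W t ≠ 0) :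
    HasDerivAt (fun t => ‖W t‖ ^ 2) (2 * ((W' t / W t).re * ‖W t‖ ^ 2)) t := by
  refine h.norm_sq.congr_deriv ?_
  have hn : Complex.normSq (W t) ≠ 0 := by simpa using h0
  rw [Complex.inner, norm_sq_eq, Complex.div_re]
  have e : Complex.normSq (W t) = (W t).re ^ 2 + (W t).im ^ 2 := by rw [Complex.normSq_apply]; ring
  rw [e] at hn ⊢
  field_simp
  simp [Complex.mul_re]
  ring

theorem hasDerivAt_norm' {W W' : ℝ → ℂ} {t : ℝ} (h : HasDerivAt W (W' t) t) (h0 : W t ≠ 0) :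
    HasDerivAt (fun t => ‖W t‖) ((W' t / W t).re * ‖W t‖) t := by
  have hp : 0 < ‖W t‖ := norm_pos_iff.2 h0
  have := (hasDerivAt_normsq h h0).sqrt (by positivity)
  have e : (fun t => √(‖W t‖ ^ 2)) = fun t => ‖W t‖ := by
    funext s; exact Real.sqrt_sq (norm_nonneg _)
  rw [e] at this
  refine this.congr_deriv ?_
  rw [Real.sqrt_sq hp.le]; field_simp

section build
variable (κ a : ℝ) (W W' : ℝ → ℂ)

noncomputable def bm (t : ℝ) : ℂ := W' t / W t
noncomputable def bV (t : ℝ) : ℂ := Complex.exp (κ * t) * W t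
noncomputable def bF (t : ℝ) : ℂ := bV κ W a / (bm W W' a + κ) + ∫ s in a..t, bV κ W s
noncomputable def bQ (t : ℝ) : ℂ := bF κ a W W' t / bV κ W t
noncomputable def bA0 (t : ℝ) : ℝ := ∫ s in a..t, ‖W s‖
noncomputable def bA1 (t : ℝ) : ℝ := ∫ s in a..t, bA0 a W s
noncomputable def bN0 (t : ℝ) : ℝ := bA0 a W t / ‖W t‖
noncomputable def bN1 (t : ℝ) : ℝ := bA1 a W t / ‖W t‖

end build

theorem hasDerivAt_int {E : Type*} [NormedAddCommGroup E] [NormedSpace ℝ E] [CompleteSpace E]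
    {f : ℝ → E} (hf : Continuous f) (a t : ℝ) :
    HasDerivAt (fun t => ∫ s in a..t, f s) (f t) t :=
  intervalIntegral.integral_hasDerivAt_right (hf.intervalIntegrable _ _)
    (hf.stronglyMeasurableAtFilter _ _) hf.continuousAt

variable {κ ε a b : ℝ} {W W' : ℝ → ℂ}

theorem bV_cont (h : IsSol κ ε W W') : Continuous (bV κ W) := by
  have := h.cont
  unfold bV; fun_prop

theorem bA0_deriv (h : IsSol κ ε W W') (a t : ℝ) : HasDerivAt (bA0 a W) ‖W t‖ t :=
  hasDerivAt_int h.cont.norm a t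

theorem bA0_cont (h : IsSol κ ε W W') (a : ℝ) : Continuous (bA0 a W) :=
  continuous_iff_continuousAt.2 (fun t => (bA0_deriv h a t).continuousAt)

theorem bA1_deriv (h : IsSol κ ε W W') (a t : ℝ) : HasDerivAt (bA1 a W) (bA0 a W t) t :=
  hasDerivAt_int (bA0_cont h a) a t

theorem bV_ne {t : ℝ} (h0 : W t ≠ 0) : bV κ W t ≠ 0 := mul_ne_zero (Complex.exp_ne_zero _) h0

theorem bV_deriv (h : IsSol κ ε W W') {t : ℝ} (h0 : W t ≠ 0) :
    HasDerivAt (bV κ W) ((bm W W' t + κ) * bV κ W t) t := by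
  have h1 : HasDerivAt (fun t : ℝ => Complex.exp ((κ : ℂ) * t)) (Complex.exp ((κ : ℂ) * t) * ((κ : ℂ) * 1)) t :=
    ((Complex.ofRealCLM.hasDerivAt (x := t)).const_mul (κ : ℂ)).cexp
  refine (h1.mul (h.h1 t)).congr_deriv ?_
  simp only [bm, bV]
  field_simp
  ring

theorem sys_build (h : IsSol κ ε W W') (hne : ∀ t ∈ Icc a b, W t ≠ 0) :
    Sys κ ε (bm W W') (bQ κ a W W') (bN0 a W) (bN1 a W) a b := by
  refine ⟨fun t ht => ?_, fun t ht => ?_, fun t ht => ?_, fun t ht => ?_⟩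
  · have h0 := hne t ht
    refine ((h.h2 t).div (h.h1 t) h0).congr_deriv ?_
    simp only [bm]; field_simp
  · have h0 := hne t ht
    have hV := bV_ne (κ := κ) h0
    have hF : HasDerivAt (bF κ a W W') (bV κ W t) t :=
      (hasDerivAt_int (bV_cont h) a t).const_add _
    refine (hF.div (bV_deriv h h0) hV).congr_deriv ?_
    simp only [bQ]; field_simp
  · have h0 := hne t ht
    have hp : ‖W t‖ ≠ 0 := norm_ne_zero_iff.2 h0
    refine ((bA0_deriv h a t).div (hasDerivAt_norm' (h.h1 t) h0) hp).congr_deriv ?_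
    simp only [bN0, bm]; field_simp
  · have h0 := hne t ht
    have hp : ‖W t‖ ≠ 0 := norm_ne_zero_iff.2 h0
    refine ((bA1_deriv h a t).div (hasDerivAt_norm' (h.h1 t) h0) hp).congr_deriv ?_
    simp only [bN0, bN1, bm]; field_simp

theorem far_build (hκ0 : 0 ≤ κ) (ha : a ≤ -6) (hW : W a = 1)
    (hm : W' a ^ 2 = (κ : ℂ) ^ 2 - ε + a * Complex.I) (hre : 0 < (W' a).re) :
    Far κ ε (bm W W') (bQ κ a W W') (bN0 a W) (bN1 a W) a := by
  have hm' : bm W W' a = W' a := by simp [bm, hW]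
  have hn : W' a + κ ≠ 0 := by
    intro h
    have := congrArg Complex.re h
    simp at this; linarith
  have hV : bV κ W a ≠ 0 := bV_ne (by rw [hW]; exact one_ne_zero)
  have habs : 0 < |a| := abs_pos.2 (by linarith)
  refine ⟨by rw [hm']; exact hre, ?_, ?_, ?_, ?_⟩
  · simp [dD, hm', hm]
    norm_num
  · have : dq κ (bm W W') (bQ κ a W W') a = 0 := by
      simp only [dq, bQ, bF, hm', intervalIntegral.integral_same, add_zero]
      field_simp
      simp
    rw [this]; norm_num
  · simp [bN0, bA0]; positivity
  · simp [bN1, bA1]; positivity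

theorem nonvanish (hκ0 : 0 ≤ κ) (hκ1 : κ ≤ 1) (hε0 : 0 ≤ ε) (hε : ε ≤ 0.0001) (ha : a ≤ -6)
    (h : IsSol κ ε W W') (hW : W a = 1)
    (hm : W' a ^ 2 = (κ : ℂ) ^ 2 - ε + a * Complex.I) (hre : 0 < (W' a).re) (b : ℝ) :
    ∀ t ∈ Icc a b, W t ≠ 0 := by
  have hF := far_build hκ0 ha hW hm hre
  have key : ∀ t ∈ Icc a b, 0 < ‖W t‖ ^ 2 - 1 / 2 := by
    refine first_exit (f := fun t => ‖W t‖ ^ 2 - 1/2) ?_ ?_ (by rw [hW]; norm_num)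
    · have := h.cont
      fun_prop
    · intro t ht hpos
      have hne : ∀ s ∈ Icc a t, W s ≠ 0 := by
        intro s hs h0
        have := hpos s hs
        rw [h0] at this; norm_num at this
      have hg := sys_good hκ0 hκ1 hε0 hε ha hF (sys_build h hne)
      have hmono := mono_of_deriv (a := a) (b := t) (fun s hs => hasDerivAt_normsq (h.h1 s) (hne s hs)) (fun s hs => by
        have := (hg s hs).hm
        have h2 : 0 ≤ (W' s / W s).re := le_trans (by have := ph_pos s; positivity) this
        positivity) a ⟨le_rfl, ht.1⟩ t ⟨ht.1, le_rfl⟩ ht.1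
      rw [hW] at hmono
      simp only [norm_one, one_pow] at hmono
      show 0 < ‖W t‖ ^ 2 - 1 / 2
      linarith
  intro t ht h0
  have := key t ht
  rw [h0] at this; norm_num at this

theorem ph_deriv (t : ℝ) : HasDerivAt ph (t / (2 * ph t ^ 3)) t := by
  have h1 : HasDerivAt (fun t : ℝ => 1 + t ^ 2) (2 * t) t := by
    simpa using ((hasDerivAt_id t).pow 2).const_add 1
  have h2 := h1.sqrt (by positivity)
  have h3 := h2.sqrt (Real.sqrt_pos.2 (by positivity)).ne'
  refine h3.congr_deriv ?_
  have hp := ph_pos t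
  rw [← ph_sq]
  rw [Real.sqrt_sq hp.le]
  field_simp

theorem ph_mono {s t : ℝ} (h : |s| ≤ |t|) : ph s ≤ ph t := by
  apply Real.sqrt_le_sqrt; apply Real.sqrt_le_sqrt
  have := sq_le_sq.2 h
  linarith

theorem g_lower {s t : ℝ} (h : s ≤ t) : ph t * (t - s) / 2 ≤ t * ph t - s * ph s := by
  have hp := ph_pos t
  have hps := ph_pos s
  by_cases h1 : 0 ≤ s
  · have := ph_mono (s := s) (t := t) (by rw [abs_of_nonneg h1, abs_of_nonneg (h1.trans h)]; exact h)
    nlinarith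
  push Not at h1
  by_cases h2 : -s ≤ t
  · nlinarith
  push Not at h2
  have := ph_mono (s := t) (t := s) (by rw [abs_of_neg h1, abs_le]; constructor <;> linarith)
  nlinarith

structure Core (κ ε t0 t1 : ℝ) (W W' : ℝ → ℂ) (D : ℂ) : Prop where
  sol : IsSol κ ε W W'
  ne : ∀ t ∈ Icc t0 t1, W t ≠ 0
  hD : D = ∫ s in t0..t1, W s * Complex.exp (-(κ * (t1 - s)))
  decay : ∀ s ∈ Icc t0 t1, ‖W s‖ ≤ ‖W t1‖ * Real.exp (-(0.04 * ph t1 * (t1 - s)))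
  low : 0.03 * ‖W t1‖ ≤ ‖D‖ * ph t1
  mom : ∫ s in t0..t1, (t1 - s) * ‖W s‖ ≤ 8.61 * ‖D‖

theorem exists_sqrt_pos {z : ℂ} (hz : z.im ≠ 0) : ∃ w : ℂ, w ^ 2 = z ∧ 0 < w.re := by
  obtain ⟨w, hw⟩ := IsAlgClosed.exists_pow_nat_eq z (n := 2) (by norm_num)
  have h0 : w.re ≠ 0 := by
    intro h; apply hz; rw [← hw]; simp [pow_two, h]
  rcases lt_or_gt_of_ne h0 with h | h
  · exact ⟨-w, by rw [neg_sq, hw], by simpa using h⟩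
  · exact ⟨w, hw, h⟩

theorem exp_num : Real.exp (-(0.2 * 12)) ≤ 0.303 ^ 2 := by
  have h1 : Real.exp (-(0.2 * 12 : ℝ)) = (Real.exp 1 ^ 2 * Real.exp 0.4)⁻¹ := by
    rw [← Real.exp_nat_mul, ← Real.exp_add, ← Real.exp_neg]; norm_num
  rw [h1]
  have h2 := Real.exp_one_gt_d9
  have h3 := Real.quadratic_le_exp_of_nonneg (x := 0.4) (by norm_num)
  have h4 : 10.93 ≤ Real.exp 1 ^ 2 * Real.exp 0.4 := by
    have : (2.7182818283:ℝ)^2 ≤ Real.exp 1 ^ 2 := pow_le_pow_left₀ (by norm_num) h2.le 2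
    norm_num at h3 this
    nlinarith
  calc (Real.exp 1 ^ 2 * Real.exp 0.4)⁻¹ ≤ (10.93)⁻¹ := inv_anti₀ (by norm_num) h4
    _ ≤ 0.303 ^ 2 := by norm_num

theorem core_exists {t0 t1 : ℝ} (hκ0 : 0 ≤ κ) (hκ1 : κ ≤ 1) (hε0 : 0 ≤ ε) (hε : ε ≤ 0.0001)
    (hN : 12 ≤ t1 - t0) : ∃ W W' D, Core κ ε t0 t1 W W' D := by
  set a := min t0 (-6) with ha'
  have ha : a ≤ -6 := min_le_right _ _
  have hat : a ≤ t0 := min_le_left _ _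
  obtain ⟨m0, hm0, hre⟩ := exists_sqrt_pos (z := (κ : ℂ) ^ 2 - ε + a * Complex.I) (by
    simp [pow_two]; linarith)
  obtain ⟨W, W', hW, hW', h1, h2⟩ := exists_sol κ ε a 1 m0
  have hsol : IsSol κ ε W W' := ⟨h1, h2⟩
  rw [← hW'] at hm0 hre
  have hne := nonvanish hκ0 hκ1 hε0 hε ha hsol hW hm0 hre t1
  have hg := sys_good hκ0 hκ1 hε0 hε ha (far_build hκ0 ha hW hm0 hre) (sys_build hsol hne)
  have hsub : Icc t0 t1 ⊆ Icc a t1 := Icc_subset_Icc_left hat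
  have m1 : t1 ∈ Icc t0 t1 := ⟨by linarith, le_rfl⟩
  have m0' : t0 ∈ Icc t0 t1 := ⟨le_rfl, by linarith⟩
  set F := bF κ a W W' with hFdef
  have hFd : ∀ t, HasDerivAt F (bV κ W t) t := fun t =>
      (hasDerivAt_int (bV_cont hsol) a t).const_add _
  have hFQ : ∀ t ∈ Icc a t1, F t = bQ κ a W W' t * bV κ W t := by
    intro t ht
    have := bV_ne (κ := κ) (hne t ht)
    simp only [bQ]; field_simp; rfl
  -- growth of F
  have hFg : ‖F t0‖ ^ 2 * Real.exp (-(0.2 * t0)) ≤ ‖F t1‖ ^ 2 * Real.exp (-(0.2 * t1)) := by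
    refine mono_of_deriv (a := t0) (b := t1) (f := fun t => ‖F t‖ ^ 2 * Real.exp (-(0.2 * t)))
      (f' := fun t => 2 * inner ℝ (F t) (bV κ W t) * Real.exp (-(0.2 * t))
        + ‖F t‖ ^ 2 * (Real.exp (-(0.2 * t)) * (-(0.2 * 1)))) ?_ ?_ t0 m0' t1 m1 (by linarith)
    · intro t _
      exact (hFd t).norm_sq.mul (((hasDerivAt_id t).const_mul 0.2).neg.exp)
    · intro t ht
      have hta := hsub ht
      have hq := (hg t hta).hre
      have e1 : inner ℝ (F t) (bV κ W t) = (bQ κ a W W' t).re * ‖bV κ W t‖ ^ 2 := by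
        rw [hFQ t hta, Complex.inner, norm_sq_eq]; simp [Complex.mul_re]; ring
      have e2 : ‖F t‖ ^ 2 = ‖bQ κ a W W' t‖ ^ 2 * ‖bV κ W t‖ ^ 2 := by
        rw [hFQ t hta, norm_mul, mul_pow]
      rw [e1, e2]
      have : 0 ≤ (10 * (bQ κ a W W' t).re - ‖bQ κ a W W' t‖ ^ 2) * (‖bV κ W t‖ ^ 2 * Real.exp (-(0.2 * t))) :=
        mul_nonneg (by linarith) (by positivity)
      linarith
  have hF0 : ‖F t0‖ ≤ 0.303 * ‖F t1‖ := by
    apply abs_le_of_sq_le_sq' _ (by positivity) |>.2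
    have e1 : ‖F t0‖ ^ 2 ≤ ‖F t1‖ ^ 2 * Real.exp (-(0.2 * (t1 - t0))) := by
      have : Real.exp (-(0.2 * (t1 - t0))) = Real.exp (-(0.2 * t1)) * Real.exp (0.2 * t0) := by
        rw [← Real.exp_add]; congr 1; ring
      rw [this, ← mul_assoc]
      have h3 := mul_le_mul_of_nonneg_right hFg (Real.exp_pos (0.2 * t0)).le
      rw [mul_assoc, ← Real.exp_add, neg_add_cancel, Real.exp_zero, mul_one] at h3
      exact h3
    have e2 : Real.exp (-(0.2 * (t1 - t0))) ≤ 0.303 ^ 2 :=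
      (Real.exp_le_exp.2 (by linarith)).trans exp_num
    rw [mul_pow]
    nlinarith [sq_nonneg ‖F t1‖]
  set D : ℂ := ∫ s in t0..t1, W s * Complex.exp (-(κ * (t1 - s))) with hD
  have hDF : D = Complex.exp (-(κ * t1)) * (F t1 - F t0) := by
    have e1 : F t1 - F t0 = ∫ s in t0..t1, bV κ W s := by
      rw [intervalIntegral.integral_eq_sub_of_hasDerivAt (fun t _ => hFd t) ((bV_cont hsol).intervalIntegrable _ _)]
    rw [e1, hD, ← intervalIntegral.integral_const_mul]
    congr 1; funext s
    simp only [bV]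
    rw [← mul_assoc, ← Complex.exp_add, mul_comm]
    congr 2; ring
  have hnexp : ∀ x : ℝ, ‖Complex.exp (κ * x)‖ = Real.exp (κ * x) := by
    intro x; rw [Complex.norm_exp]; simp
  have hDlow : 0.697 * (‖bQ κ a W W' t1‖ * ‖W t1‖) ≤ ‖D‖ := by
    rw [hDF, norm_mul]
    have e1 : ‖Complex.exp (-((κ : ℂ) * t1))‖ = Real.exp (-(κ * t1)) := by
      have := hnexp (-t1); push_cast at this; rw [mul_neg] at this; rw [this]; congr 1; ring
    have e2 : ‖F t1‖ = ‖bQ κ a W W' t1‖ * (Real.exp (κ * t1) * ‖W t1‖) := by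
      rw [hFQ t1 (hsub m1), norm_mul, bV, norm_mul, hnexp]
    have e3 : 0.697 * ‖F t1‖ ≤ ‖F t1 - F t0‖ := by
      have := norm_sub_norm_le (F t1) (F t0); linarith
    rw [e1]
    have e4 := mul_le_mul_of_nonneg_left e3 (Real.exp_pos (-(κ * t1))).le
    refine le_trans (le_of_eq ?_) e4
    rw [e2]
    have : Real.exp (-(κ * t1)) * Real.exp (κ * t1) = 1 := by
      rw [← Real.exp_add, neg_add_cancel, Real.exp_zero]
    linear_combination (-(0.697 * (‖bQ κ a W W' t1‖ * ‖W t1‖))) * this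
  have hG1 := hg t1 (hsub m1)
  have hW1 : 0 < ‖W t1‖ := norm_pos_iff.2 (hne t1 (hsub m1))
  refine ⟨W, W', D, hsol, fun t ht => hne t (hsub ht), rfl, ?_, ?_, ?_⟩
  · -- decay
    have hmono := mono_of_deriv (a := t0) (b := t1) (f := fun t => ‖W t‖ * Real.exp (-(0.08 * (t * ph t))))
      (f' := fun t => (W' t / W t).re * ‖W t‖ * Real.exp (-(0.08 * (t * ph t)))
        + ‖W t‖ * (Real.exp (-(0.08 * (t * ph t))) * (-(0.08 * (1 * ph t + t * (t / (2 * ph t ^ 3)))))))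
      (fun t ht => (hasDerivAt_norm' (h1 t) (hne t (hsub ht))).mul
        ((((hasDerivAt_id t).mul (ph_deriv t)).const_mul 0.08).neg.exp)) ?_
    · intro s hs
      have hk := hmono s hs t1 m1 hs.2
      beta_reduce at hk
      have hgl := g_lower hs.2
      have e1 : ‖W s‖ ≤ ‖W t1‖ * Real.exp (0.08 * (s * ph s) - 0.08 * (t1 * ph t1)) := by
        have h3 := mul_le_mul_of_nonneg_right hk (Real.exp_pos (0.08 * (s * ph s))).le
        rw [mul_assoc, ← Real.exp_add, neg_add_cancel, Real.exp_zero, mul_one, mul_assoc, ← Real.exp_add] at h3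
        refine h3.trans (le_of_eq ?_)
        congr 2; ring
      refine e1.trans ?_
      gcongr
      linarith
    · intro t ht
      have hm := (hg t (hsub ht)).hm
      have hp := ph_pos t
      have e1 : t * (t / (2 * ph t ^ 3)) ≤ ph t / 2 := by
        rw [mul_div_assoc', div_le_iff₀ (by positivity)]
        have := ph_four t
        nlinarith
      have : 0 ≤ ((W' t / W t).re - 0.08 * (1 * ph t + t * (t / (2 * ph t ^ 3)))) * (‖W t‖ * Real.exp (-(0.08 * (t * ph t)))) :=
        mul_nonneg (by
          have e : (bm W W' t).re = (W' t / W t).re := rfl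
          rw [e] at hm; linarith) (by positivity)
      linarith
  · have := hG1.hQ
    have hp := ph_pos t1
    have h3 := mul_le_mul_of_nonneg_right hDlow hp.le
    have h4 := mul_le_mul_of_nonneg_right this hW1.le
    linarith
  · have e1 : ∫ s in t0..t1, (t1 - s) * ‖W s‖ = (t1 - t1) * bA0 a W t1 - (t1 - t0) * bA0 a W t0
        - ∫ s in t0..t1, (-1) * bA0 a W s :=
      intervalIntegral.integral_mul_deriv_eq_deriv_mul (u := fun s => t1 - s) (v := bA0 a W)
        (u' := fun _ => -1) (v' := fun s => ‖W s‖)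
        (fun s _ => by simpa using (hasDerivAt_id s).const_sub t1) (fun s _ => bA0_deriv hsol a s)
        (continuous_const.intervalIntegrable _ _) (hsol.cont.norm.intervalIntegrable _ _)
    have hA0 : ∀ t, a ≤ t → 0 ≤ bA0 a W t := fun t ht =>
      intervalIntegral.integral_nonneg ht (fun s _ => norm_nonneg _)
    have e2 : bA1 a W t1 = bA1 a W t0 + ∫ s in t0..t1, bA0 a W s :=
      (intervalIntegral.integral_add_adjacent_intervals ((bA0_cont hsol a).intervalIntegrable _ _)
        ((bA0_cont hsol a).intervalIntegrable _ _)).symm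
    have e3 : 0 ≤ bA1 a W t0 := intervalIntegral.integral_nonneg hat (fun s hs => hA0 s hs.1)
    have e4 : bA1 a W t1 ≤ 6 * ‖bQ κ a W W' t1‖ * ‖W t1‖ := by
      have := hG1.hN
      rw [bN1, div_le_iff₀ hW1] at this
      exact this
    have e5 : 0 ≤ (t1 - t0) * bA0 a W t0 := mul_nonneg (by linarith) (hA0 t0 hat)
    rw [e1, intervalIntegral.integral_const_mul, sub_self, zero_mul]
    have e6 : 0 ≤ ‖bQ κ a W W' t1‖ * ‖W t1‖ := by positivity
    linarith only [e2, e3, e4, e5, e6, hDlow]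

end Part9

section Part10

open Set MeasureTheory intervalIntegral

noncomputable def fP (κ t0 t1 : ℝ) (W : ℝ → ℂ) : ℂ :=
  ∫ s in t0..t1, W s * ((Real.sinh (κ * (s - t0)) / Real.sinh (κ * (t1 - t0)) : ℝ) : ℂ)
noncomputable def fM (κ t0 t1 : ℝ) (W : ℝ → ℂ) : ℂ :=
  ∫ s in t0..t1, W s * ((Real.sinh (κ * (t1 - s)) / Real.sinh (κ * (t1 - t0)) : ℝ) : ℂ)
noncomputable def mir (W : ℝ → ℂ) (t : ℝ) : ℂ := star (W (-t))

theorem fM_mir (κ t0 t1 : ℝ) (W : ℝ → ℂ) :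
    fM κ t0 t1 (mir W) = star (fP κ (-t1) (-t0) W) := by
  have e : star (fP κ (-t1) (-t0) W) = ∫ s in (-t1)..(-t0), star (W s *
      ((Real.sinh (κ * (s - -t1)) / Real.sinh (κ * (-t0 - -t1)) : ℝ) : ℂ)) := by
    rw [fP]
    simp only [intervalIntegral.intervalIntegral_eq_integral_uIoc, star_smul]
    congr 1
    exact (integral_conj (𝕜 := ℂ)).symm
  rw [e, fM, ← intervalIntegral.integral_comp_neg]
  congr 1; funext s
  simp only [mir, star_mul', Complex.star_def, Complex.conj_ofReal]
  congr 4 <;> ring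

theorem fP_mir (κ t0 t1 : ℝ) (W : ℝ → ℂ) :
    fP κ t0 t1 (mir W) = star (fM κ (-t1) (-t0) W) := by
  have h := fM_mir κ (-t1) (-t0) (mir W)
  have e : mir (mir W) = W := by funext t; simp [mir]
  rw [e, neg_neg, neg_neg] at h
  rw [h, star_star]

theorem IsSol.mir {κ ε : ℝ} {W W' : ℝ → ℂ} (h : IsSol κ ε W W') :
    IsSol κ ε (mir W) (fun t => - _root_.mir W' t) := by
  have key : ∀ (V : ℝ → ℂ) (d : ℂ) (t : ℝ), HasDerivAt V d (-t) →
      HasDerivAt (_root_.mir V) (- star d) t := by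
    intro V d t hV
    have h1 : HasDerivAt (fun s : ℝ => V (-s)) ((-1 : ℝ) • d) t :=
      HasDerivAt.scomp t hV (hasDerivAt_neg t)
    have h2 := h1.star
    refine h2.congr_deriv ?_
    simp
  constructor
  · intro t; exact key W _ t (h.h1 (-t))
  · intro t
    refine (key W' _ t (h.h2 (-t))).neg.congr_deriv ?_
    simp [_root_.mir]

theorem sinh_ratio {κ x N : ℝ} (hκ : 0 < κ) (hx : 0 ≤ x) (hxN : x ≤ N) (hN : 0 < N) :
    Real.sinh (κ * x) / Real.sinh (κ * N) ≤ x / N := by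
  have hc : ConvexOn ℝ (Ici (0:ℝ)) Real.sinh := by
    apply convexOn_of_deriv2_nonneg (convex_Ici 0) Real.continuous_sinh.continuousOn
      Real.differentiable_sinh.differentiableOn
    · rw [Real.deriv_sinh]; exact Real.differentiable_cosh.differentiableOn
    · intro x hx
      simp only [Function.iterate_succ, Function.iterate_zero, Function.comp, id]
      rw [Real.deriv_sinh, Real.deriv_cosh]
      rw [interior_Ici] at hx
      exact (Real.sinh_pos_iff.2 hx).le
  have hs : 0 < Real.sinh (κ * N) := Real.sinh_pos_iff.2 (by positivity)
  have h := hc.2 (show (0:ℝ) ∈ Ici (0:ℝ) by simp) (show κ * N ∈ Ici (0:ℝ) from mem_Ici.2 (by positivity))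
    (show 0 ≤ 1 - x / N by rw [sub_nonneg, div_le_one hN]; exact hxN) (show 0 ≤ x / N by positivity) (by ring)
  simp only [smul_eq_mul, mul_zero, zero_add, Real.sinh_zero] at h
  rw [div_le_iff₀ hs]
  refine le_trans (le_of_eq ?_) h
  congr 1; field_simp

theorem fP_eq {κ ε t0 t1 : ℝ} {W W' : ℝ → ℂ} {D : ℂ} (h : Core κ ε t0 t1 W W' D) (hκ : 0 < κ)
    (hN : 0 < t1 - t0) :
    fP κ t0 t1 W = D - ((Real.exp (-(κ * (t1 - t0))) : ℝ) : ℂ) * fM κ t0 t1 W := by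
  have hc := h.sol.cont
  have hs : Real.sinh (κ * (t1 - t0)) ≠ 0 := (Real.sinh_pos_iff.2 (by positivity)).ne'
  rw [h.hD, fP, fM, ← intervalIntegral.integral_const_mul, ← intervalIntegral.integral_sub]
  · congr 1; funext s
    have e : ((Real.sinh (κ * (s - t0)) / Real.sinh (κ * (t1 - t0)) : ℝ) : ℂ)
        = ((Real.exp (-(κ * (t1 - s))) - Real.exp (-(κ * (t1 - t0)))
          * (Real.sinh (κ * (t1 - s)) / Real.sinh (κ * (t1 - t0))) : ℝ) : ℂ) := by
      congr 1
      field_simp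
      have : κ * (s - t0) = κ * (t1 - t0) - κ * (t1 - s) := by ring
      rw [this]
      generalize κ * (t1 - t0) = A
      generalize κ * (t1 - s) = B
      rw [Real.sinh_eq, Real.sinh_eq, Real.sinh_eq]
      have e1 : A - B = A + -B := by ring
      have e2 : -(A - B) = -A + B := by ring
      rw [e2, e1, Real.exp_add, Real.exp_add]
      ring
    rw [e]; push_cast; ring
  · apply Continuous.intervalIntegrable; fun_prop
  · apply Continuous.intervalIntegrable
    have : Continuous fun s : ℝ => Real.sinh (κ * (t1 - s)) / Real.sinh (κ * (t1 - t0)) := by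
      have := Real.continuous_sinh
      fun_prop
    fun_prop

theorem fM_bd {κ ε t0 t1 : ℝ} {W W' : ℝ → ℂ} {D : ℂ} (h : Core κ ε t0 t1 W W' D) (hκ : 0 < κ)
    (hN : 0 < t1 - t0) : ‖fM κ t0 t1 W‖ ≤ 8.61 / (t1 - t0) * ‖D‖ := by
  have hc := h.sol.cont
  have h1 : ‖fM κ t0 t1 W‖ ≤ ∫ s in t0..t1, (1 / (t1 - t0)) * ((t1 - s) * ‖W s‖) := by
    refine intervalIntegral.norm_integral_le_of_norm_le (by linarith) ?_ ?_
    · refine ae_of_all _ (fun s hs => ?_)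
      rw [norm_mul, Complex.norm_real, Real.norm_eq_abs, abs_of_nonneg]
      · have := sinh_ratio hκ (x := t1 - s) (N := t1 - t0) (by linarith [hs.2]) (by linarith [hs.1]) hN
        calc _ ≤ ‖W s‖ * ((t1 - s) / (t1 - t0)) := by gcongr
          _ = _ := by ring
      · apply div_nonneg <;> apply Real.sinh_nonneg_iff.2
        · have := hs.2; exact mul_nonneg hκ.le (by linarith)
        · positivity
    · apply Continuous.intervalIntegrable; fun_prop
  rw [intervalIntegral.integral_const_mul] at h1
  refine h1.trans ?_
  have := h.mom
  calc _ ≤ 1 / (t1 - t0) * (8.61 * ‖D‖) := by gcongr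
    _ = _ := by ring

structure IsSolOn (κ ε t0 t1 : ℝ) (W W' : ℝ → ℂ) : Prop where
  h1 : ∀ t ∈ Icc t0 t1, HasDerivAt W (W' t) t
  h2 : ∀ t ∈ Icc t0 t1, HasDerivAt W' (((κ : ℂ) ^ 2 - ε + t * Complex.I) * W t) t

theorem IsSol.on {κ ε t0 t1 : ℝ} {W W' : ℝ → ℂ} (h : IsSol κ ε W W') : IsSolOn κ ε t0 t1 W W' :=
  ⟨fun t _ => h.h1 t, fun t _ => h.h2 t⟩

theorem const_of_deriv_zero {a b : ℝ} {f : ℝ → ℂ} (h : ∀ t ∈ Icc a b, HasDerivAt f 0 t) :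
    ∀ t ∈ Icc a b, f t = f a :=
  constant_of_has_deriv_right_zero (fun x hx => (h x hx).continuousAt.continuousWithinAt)
    (fun x hx => (h x ⟨hx.1, hx.2.le⟩).hasDerivWithinAt)

theorem wr_const {κ ε t0 t1 : ℝ} {u u' v v' : ℝ → ℂ} (hu : IsSolOn κ ε t0 t1 u u')
    (hv : IsSolOn κ ε t0 t1 v v') :
    ∃ c : ℂ, ∀ t ∈ Icc t0 t1, u t * v' t - u' t * v t = c := by
  refine ⟨_, const_of_deriv_zero (f := fun t => u t * v' t - u' t * v t) (fun t ht => ?_)⟩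
  refine (((hu.h1 t ht).mul (hv.h2 t ht)).sub ((hu.h2 t ht).mul (hv.h1 t ht))).congr_deriv ?_
  ring

theorem int_comb {t0 t1 : ℝ} (h01 : t0 ≤ t1) {u W1 W2 : ℝ → ℂ} {p : ℝ → ℂ} (hp : Continuous p)
    (c1 : ContinuousOn W1 (Icc t0 t1)) (c2 : ContinuousOn W2 (Icc t0 t1)) (ω a b : ℂ)
    (h : ∀ t ∈ Icc t0 t1, ω * u t = a * W1 t + b * W2 t) :
    ω * (∫ s in t0..t1, u s * p s) = a * (∫ s in t0..t1, W1 s * p s) + b * (∫ s in t0..t1, W2 s * p s) := by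
  rw [← intervalIntegral.integral_const_mul, ← intervalIntegral.integral_const_mul,
    ← intervalIntegral.integral_const_mul, ← intervalIntegral.integral_add]
  · apply intervalIntegral.integral_congr
    intro s hs
    rw [uIcc_of_le h01] at hs
    beta_reduce
    rw [← mul_assoc, h s hs]; ring
  · apply ContinuousOn.intervalIntegrable
    rw [uIcc_of_le h01]
    exact continuousOn_const.mul (c1.mul hp.continuousOn)
  · apply ContinuousOn.intervalIntegrable
    rw [uIcc_of_le h01]
    exact continuousOn_const.mul (c2.mul hp.continuousOn)

theorem invert {κ ε t0 t1 : ℝ} (h01 : t0 ≤ t1) {u u' W1 W1' W2 W2' : ℝ → ℂ}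
    (hu : IsSolOn κ ε t0 t1 u u') (hW1 : IsSolOn κ ε t0 t1 W1 W1') (hW2 : IsSolOn κ ε t0 t1 W2 W2')
    (hne : ∀ t ∈ Icc t0 t1, W1 t ≠ 0) {p m : ℝ → ℂ} (hp : Continuous p) (hm : Continuous m)
    {P M : (ℝ → ℂ) → ℂ} (hP : ∀ f, P f = ∫ s in t0..t1, f s * p s)
    (hM : ∀ f, M f = ∫ s in t0..t1, f s * m s) (α : ℂ) (hα : P u = α) (hβ : M u = 0)
    (hdet : P W1 * M W2 - P W2 * M W1 ≠ 0) :
    ∀ t ∈ Icc t0 t1, (P W1 * M W2 - P W2 * M W1) * u t = α * M W2 * W1 t - α * M W1 * W2 t := by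
  have c1 : ContinuousOn W1 (Icc t0 t1) := fun t ht => (hW1.h1 t ht).continuousAt.continuousWithinAt
  have c2 : ContinuousOn W2 (Icc t0 t1) := fun t ht => (hW2.h1 t ht).continuousAt.continuousWithinAt
  obtain ⟨ω, hω⟩ := wr_const hW1 hW2
  obtain ⟨a, ha⟩ := wr_const hu hW2
  obtain ⟨b, hb⟩ := wr_const hW1 hu
  have hω0 : ω ≠ 0 := by
    intro h0
    rw [h0] at hω
    have hc : ∀ t ∈ Icc t0 t1, W2 t / W1 t = W2 t0 / W1 t0 := by
      refine const_of_deriv_zero (fun t ht => ?_)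
      refine ((hW2.h1 t ht).div (hW1.h1 t ht) (hne t ht)).congr_deriv ?_
      rw [div_eq_zero_iff]; left
      have := hω t ht
      linear_combination this
    set c := W2 t0 / W1 t0
    have h2 : ∀ t ∈ Icc t0 t1, 1 * W2 t = c * W1 t + 0 * W1 t := by
      intro t ht
      rw [← hc t ht]
      have := hne t ht
      field_simp; ring
    have e1 := int_comb h01 hp c1 c1 1 c 0 h2
    have e2 := int_comb h01 hm c1 c1 1 c 0 h2
    rw [← hP, ← hP] at e1
    rw [← hM, ← hM] at e2
    apply hdet
    linear_combination (P W1) * e2 - (M W1) * e1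
  have hcomb : ∀ t ∈ Icc t0 t1, ω * u t = a * W1 t + b * W2 t := by
    intro t ht
    rw [← hω t ht, ← ha t ht, ← hb t ht]; ring
  have e1 := int_comb h01 hp c1 c2 ω a b hcomb
  have e2 := int_comb h01 hm c1 c2 ω a b hcomb
  rw [← hP, ← hP, ← hP, hα] at e1
  rw [← hM, ← hM, ← hM, hβ] at e2
  intro t ht
  apply mul_left_cancel₀ hω0
  have := hcomb t ht
  linear_combination (P W1 * M W2 - P W2 * M W1) * this - (M W2 * W1 t - M W1 * W2 t) * e1
    - (P W1 * W2 t - P W2 * W1 t) * e2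

end Part10

section Part11

open Set MeasureTheory intervalIntegral

theorem exp_num2 {x : ℝ} (hx : 2 ≤ x) : Real.exp (-x) ≤ 0.1354 := by
  have h1 : Real.exp (-2 : ℝ) = (Real.exp 1 ^ 2)⁻¹ := by
    rw [← Real.exp_nat_mul, ← Real.exp_neg]; norm_num
  have h2 := Real.exp_one_gt_d9
  have h3 : (2.7182818283:ℝ)^2 ≤ Real.exp 1 ^ 2 := pow_le_pow_left₀ (by norm_num) h2.le 2
  calc Real.exp (-x) ≤ Real.exp (-2) := Real.exp_le_exp.2 (by linarith)
    _ = (Real.exp 1 ^ 2)⁻¹ := h1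
    _ ≤ ((2.7182818283:ℝ)^2)⁻¹ := inv_anti₀ (by norm_num) h3
    _ ≤ 0.1354 := by norm_num

theorem core_facts {κ ε t0 t1 : ℝ} {W W' : ℝ → ℂ} {D : ℂ} (h : Core κ ε t0 t1 W W' D) (hκ : 0 < κ)
    (hN : 12 ≤ t1 - t0) (hκN : 2 ≤ κ * (t1 - t0)) :
    0 < ‖D‖ ∧ ‖fM κ t0 t1 W‖ ≤ 8.61 / (t1 - t0) * ‖D‖ ∧ ‖fM κ t0 t1 W‖ ≤ 0.7175 * ‖D‖ ∧
      0.9028 * ‖D‖ ≤ ‖fP κ t0 t1 W‖ ∧ ‖fP κ t0 t1 W‖ ≤ 1.1 * ‖D‖ ∧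
      ∀ s ∈ Icc t0 t1, ‖W s‖ ≤ ‖D‖ * (ph t1 / 0.03) * Real.exp (-(0.04 * ph t1 * (t1 - s))) := by
  have hp := ph_pos t1
  have hW : 0 < ‖W t1‖ := norm_pos_iff.2 (h.ne t1 ⟨by linarith, le_rfl⟩)
  have hlow := h.low
  have hDp : 0 < ‖D‖ := by
    by_contra hc
    have : ‖D‖ = 0 := le_antisymm (not_lt.1 hc) (norm_nonneg _)
    rw [this] at hlow; linarith
  have hM := fM_bd h hκ (by linarith)
  have hM2 : ‖fM κ t0 t1 W‖ ≤ 0.7175 * ‖D‖ := by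
    refine hM.trans ?_
    gcongr
    rw [div_le_iff₀ (by linarith)]; linarith
  have hP := fP_eq h hκ (by linarith)
  have hE : ‖((Real.exp (-(κ * (t1 - t0))) : ℝ) : ℂ) * fM κ t0 t1 W‖ ≤ 0.0972 * ‖D‖ := by
    rw [norm_mul, Complex.norm_real, Real.norm_eq_abs, abs_of_pos (Real.exp_pos _)]
    calc _ ≤ 0.1354 * (0.7175 * ‖D‖) := by
          gcongr; exact exp_num2 hκN
      _ ≤ _ := by linarith
  refine ⟨hDp, hM, hM2, ?_, ?_, ?_⟩
  · rw [hP]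
    have := norm_sub_norm_le D (((Real.exp (-(κ * (t1 - t0))) : ℝ) : ℂ) * fM κ t0 t1 W)
    linarith
  · rw [hP]
    have := norm_sub_le D (((Real.exp (-(κ * (t1 - t0))) : ℝ) : ℂ) * fM κ t0 t1 W)
    linarith
  · intro s hs
    refine (h.decay s hs).trans ?_
    gcongr
    rw [mul_div_assoc', le_div_iff₀ (by norm_num)]; linarith

theorem ph_neg (t : ℝ) : ph (-t) = ph t := by simp [ph]

theorem pointwise {κ ε t0 t1 : ℝ} (hκ : 0 < κ) (hκ1 : κ ≤ 1) (hε0 : 0 ≤ ε) (hε : ε ≤ 0.0001)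
    (hN : 12 ≤ t1 - t0) (hκN : 2 ≤ κ * (t1 - t0)) {u u' : ℝ → ℂ} (hu : IsSolOn κ ε t0 t1 u u')
    (α : ℂ) (hα : fP κ t0 t1 u = α) (hβ : fM κ t0 t1 u = 0) :
    ∀ t ∈ Icc t0 t1, ‖u t‖ ≤ ‖α‖ * (134 * (ph t1 * Real.exp (-(0.04 * ph t1 * (t1 - t))))
      + 1000 / (t1 - t0) * (ph t0 * Real.exp (-(0.04 * ph t0 * (t - t0))))) := by
  obtain ⟨W1, W1', D1, hC1⟩ := core_exists hκ.le hκ1 hε0 hε hN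
  obtain ⟨V, V', D2, hC2⟩ := core_exists (t0 := -t1) (t1 := -t0) hκ.le hκ1 hε0 hε (by linarith)
  have F1 := core_facts hC1 hκ hN hκN
  have F2 := core_facts hC2 hκ (by linarith) (by rw [show -t0 - -t1 = t1 - t0 by ring]; exact hκN)
  rw [show -t0 - -t1 = t1 - t0 by ring, ph_neg] at F2
  obtain ⟨d1, m1, m1', p1, -, w1⟩ := F1
  obtain ⟨d2, m2, m2', p2, p2', w2⟩ := F2
  have eM := fM_mir κ t0 t1 V
  have eP := fP_mir κ t0 t1 V
  have nM : ‖fM κ t0 t1 (mir V)‖ = ‖fP κ (-t1) (-t0) V‖ := by rw [eM, norm_star]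
  have nP : ‖fP κ t0 t1 (mir V)‖ = ‖fM κ (-t1) (-t0) V‖ := by rw [eP, norm_star]
  rw [← nM] at p2 p2'
  rw [← nP] at m2 m2'
  set P1 := fP κ t0 t1 W1
  set M1 := fM κ t0 t1 W1
  set P2 := fP κ t0 t1 (mir V)
  set M2 := fM κ t0 t1 (mir V)
  have hdet : 0.29 * (‖D1‖ * ‖D2‖) ≤ ‖P1 * M2 - P2 * M1‖ := by
    have h1 := norm_sub_norm_le (P1 * M2) (P2 * M1)
    have h2 : (0.9028 * ‖D1‖) * (0.9028 * ‖D2‖) ≤ ‖P1 * M2‖ := by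
      rw [norm_mul]; gcongr
    have h3 : ‖P2 * M1‖ ≤ (0.7175 * ‖D2‖) * (0.7175 * ‖D1‖) := by
      rw [norm_mul]; gcongr
    have h4 : 0 < ‖D1‖ * ‖D2‖ := by positivity
    linarith
  have hdet0 : P1 * M2 - P2 * M1 ≠ 0 := by
    intro h
    rw [h, norm_zero] at hdet
    have h4 : 0 < ‖D1‖ * ‖D2‖ := by positivity
    linarith
  have hcs := Real.continuous_sinh
  have key := invert (by linarith) hu hC1.sol.on hC2.sol.mir.on hC1.ne
    (p := fun s => ((Real.sinh (κ * (s - t0)) / Real.sinh (κ * (t1 - t0)) : ℝ) : ℂ))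
    (m := fun s => ((Real.sinh (κ * (t1 - s)) / Real.sinh (κ * (t1 - t0)) : ℝ) : ℂ))
    (by
      have : Continuous fun s : ℝ => Real.sinh (κ * (s - t0)) / Real.sinh (κ * (t1 - t0)) := by fun_prop
      exact Complex.continuous_ofReal.comp this)
    (by
      have : Continuous fun s : ℝ => Real.sinh (κ * (t1 - s)) / Real.sinh (κ * (t1 - t0)) := by fun_prop
      exact Complex.continuous_ofReal.comp this)
    (P := fP κ t0 t1) (M := fM κ t0 t1) (fun f => rfl) (fun f => rfl) α hα hβ hdet0
  intro t ht
  have hk := congrArg norm (key t ht)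
  rw [norm_mul] at hk
  have hw1 := w1 t ht
  have hw2 := w2 (-t) ⟨by linarith [ht.2], by linarith [ht.1]⟩
  have hmir : ‖mir V t‖ = ‖V (-t)‖ := by rw [mir, norm_star]
  rw [← hmir, show -t0 - -t = t - t0 by ring] at hw2
  have hph1 := ph_pos t1
  have hph0 := ph_pos t0
  set e1 := Real.exp (-(0.04 * ph t1 * (t1 - t)))
  set e2 := Real.exp (-(0.04 * ph t0 * (t - t0)))
  have he1 : 0 < e1 := Real.exp_pos _
  have he2 : 0 < e2 := Real.exp_pos _
  have hNp : 0 < t1 - t0 := by linarith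
  have h1 : ‖α * M2 * W1 t - α * M1 * mir V t‖ ≤
      ‖α‖ * (1.1 * ‖D2‖) * (‖D1‖ * (ph t1 / 0.03) * e1)
      + ‖α‖ * (8.61 / (t1 - t0) * ‖D1‖) * (‖D2‖ * (ph t0 / 0.03) * e2) := by
    refine (norm_sub_le _ _).trans ?_
    rw [norm_mul, norm_mul, norm_mul, norm_mul]
    gcongr
  have h2 : 0.29 * (‖D1‖ * ‖D2‖) * ‖u t‖ ≤ 0.29 * (‖D1‖ * ‖D2‖) * (‖α‖ * (134 * (ph t1 * e1)
      + 1000 / (t1 - t0) * (ph t0 * e2))) := by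
    calc _ ≤ ‖P1 * M2 - P2 * M1‖ * ‖u t‖ := by gcongr
      _ ≤ _ := hk.le.trans h1
      _ = (‖D1‖ * ‖D2‖) * (‖α‖ * ((1.1 / 0.03) * (ph t1 * e1) + (8.61 / 0.03) / (t1 - t0) * (ph t0 * e2))) := by
        field_simp
      _ ≤ (‖D1‖ * ‖D2‖) * (‖α‖ * ((0.29 * 134) * (ph t1 * e1) + (0.29 * 1000) / (t1 - t0) * (ph t0 * e2))) := by
        gcongr <;> norm_num
      _ = _ := by field_simp
  exact le_of_mul_le_mul_left h2 (by positivity)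

end Part11

section Part12

open Set MeasureTheory intervalIntegral

theorem fun_vals {κ t0 t1 : ℝ} (hκ : 0 < κ) (h01 : t0 < t1) {Φ Φ1 w : ℝ → ℂ}
    (h1 : ∀ t, HasDerivAt Φ (Φ1 t) t) (h2 : ∀ t, HasDerivAt Φ1 (w t + (κ : ℂ) ^ 2 * Φ t) t)
    (hw : Continuous w) (hΦ0 : Φ t0 = 0) (hΦ1 : Φ t1 = 0) :
    fP κ t0 t1 w = Φ1 t1 ∧ fM κ t0 t1 w = - Φ1 t0 := by
  have hs : Real.sinh (κ * (t1 - t0)) ≠ 0 :=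
    (Real.sinh_pos_iff.2 (mul_pos hκ (by linarith))).ne'
  have hs' : ((Real.sinh (κ * (t1 - t0)) : ℝ) : ℂ) ≠ 0 := by exact_mod_cast hs
  have hcs := Real.continuous_sinh
  constructor
  · have hd : ∀ t, HasDerivAt (fun t => Φ1 t * ((Real.sinh (κ * (t - t0)) : ℝ) : ℂ)
        - κ * Φ t * ((Real.cosh (κ * (t - t0)) : ℝ) : ℂ)) (w t * ((Real.sinh (κ * (t - t0)) : ℝ) : ℂ)) t := by
      intro t
      have hl : HasDerivAt (fun t : ℝ => κ * (t - t0)) (κ * 1) t := ((hasDerivAt_id t).sub_const t0).const_mul κ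
      refine (((h2 t).mul hl.sinh.ofReal_comp).sub (((h1 t).const_mul (κ : ℂ)).mul hl.cosh.ofReal_comp)).congr_deriv ?_
      push_cast; ring
    have hi := intervalIntegral.integral_eq_sub_of_hasDerivAt (a := t0) (b := t1) (fun t _ => hd t)
      (by
        apply Continuous.intervalIntegrable
        have : Continuous fun s : ℝ => Real.sinh (κ * (s - t0)) := by fun_prop
        exact hw.mul (Complex.continuous_ofReal.comp this))
    rw [hΦ0, hΦ1] at hi
    have e : fP κ t0 t1 w = (∫ t in t0..t1, w t * ((Real.sinh (κ * (t - t0)) : ℝ) : ℂ)) / ((Real.sinh (κ * (t1 - t0)) : ℝ) : ℂ) := by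
      rw [fP, ← intervalIntegral.integral_div]
      congr 1; funext s; rw [Complex.ofReal_div, mul_div_assoc]
    rw [e, hi]
    simp only [sub_self, mul_zero, Real.sinh_zero, Complex.ofReal_zero, zero_mul, sub_zero]
    field_simp
  · have hd : ∀ t, HasDerivAt (fun t => Φ1 t * ((Real.sinh (κ * (t1 - t)) : ℝ) : ℂ)
        + κ * Φ t * ((Real.cosh (κ * (t1 - t)) : ℝ) : ℂ)) (w t * ((Real.sinh (κ * (t1 - t)) : ℝ) : ℂ)) t := by
      intro t
      have hl : HasDerivAt (fun t : ℝ => κ * (t1 - t)) (κ * (-1)) t := ((hasDerivAt_id t).const_sub t1).const_mul κ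
      refine (((h2 t).mul hl.sinh.ofReal_comp).add (((h1 t).const_mul (κ : ℂ)).mul hl.cosh.ofReal_comp)).congr_deriv ?_
      push_cast; ring
    have hi := intervalIntegral.integral_eq_sub_of_hasDerivAt (a := t0) (b := t1) (fun t _ => hd t)
      (by
        apply Continuous.intervalIntegrable
        have : Continuous fun s : ℝ => Real.sinh (κ * (t1 - s)) := by fun_prop
        exact hw.mul (Complex.continuous_ofReal.comp this))
    rw [hΦ0, hΦ1] at hi
    have e : fM κ t0 t1 w = (∫ t in t0..t1, w t * ((Real.sinh (κ * (t1 - t)) : ℝ) : ℂ)) / ((Real.sinh (κ * (t1 - t0)) : ℝ) : ℂ) := by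
      rw [fM, ← intervalIntegral.integral_div]
      congr 1; funext s; rw [Complex.ofReal_div, mul_div_assoc]
    rw [e, hi]
    simp only [sub_self, mul_zero, Real.sinh_zero, Complex.ofReal_zero, zero_mul, zero_sub, add_zero, zero_add]
    field_simp

theorem comp_scale {f f' : ℝ → ℂ} {L lam : ℝ} (h : ∀ y, HasDerivAt f (f' y) y) (c : ℂ) (t : ℝ) :
    HasDerivAt (fun t : ℝ => c * f (lam + t / L)) ((c / L) * f' (lam + t / L)) t := by
  have h1 : HasDerivAt (fun t : ℝ => lam + t / L) (1 / L) t := ((hasDerivAt_id t).div_const L).const_add lam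
  refine ((HasDerivAt.scomp t (h (lam + t / L)) h1).const_mul c).congr_deriv ?_
  rw [Complex.real_smul]; push_cast; ring

theorem w_bound {k lam ε L : ℝ} (hk : 1 ≤ k) (hkL : k ≤ L) (hL : 6 ≤ L) (hε0 : 0 ≤ ε) (hε : ε ≤ 0.0001)
    {φ φ1 φ2 w w1 w2 : ℝ → ℂ} (h1 : ∀ y, HasDerivAt φ (φ1 y) y) (h2 : ∀ y, HasDerivAt φ1 (φ2 y) y)
    (hw : ∀ y, w y = φ2 y - (k:ℂ) ^ 2 * φ y)
    (hw1 : ∀ y, HasDerivAt w (w1 y) y) (hw2 : ∀ y, HasDerivAt w1 (w2 y) y)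
    (b1 : φ (-1) = 0) (b2 : φ 1 = 0) (b3 : φ1 1 = 1) (b4 : φ1 (-1) = 0)
    (hode : ∀ y ∈ Icc (-1:ℝ) 1, w2 y = ((k:ℂ) ^ 2 - ε * (L:ℂ) ^ 2 + (L:ℂ) ^ 3 * (y - lam) * Complex.I) * w y) :
    ∀ y ∈ Icc (-1:ℝ) 1, ‖w y‖ ≤ L * (134 * (ph (L * (1 - lam)) * Real.exp (-(0.04 * ph (L * (1 - lam)) * (L * (1 - y)))))
      + 1000 / (2 * L) * (ph (L * (-1 - lam)) * Real.exp (-(0.04 * ph (L * (-1 - lam)) * (L * (1 + y)))))) := by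
  have hL0 : 0 < L := by linarith
  have hLc : (L : ℂ) ≠ 0 := by exact_mod_cast hL0.ne'
  have hκ : 0 < k / L := by positivity
  have hd : L * (1 - lam) - L * (-1 - lam) = 2 * L := by ring
  have y1 : lam + L * (1 - lam) / L = 1 := by field_simp; ring
  have y0 : lam + L * (-1 - lam) / L = -1 := by field_simp; ring
  have hwc : Continuous w := continuous_iff_continuousAt.2 (fun t => (hw1 t).continuousAt)
  have hv := fun_vals (κ := k / L) (t0 := L * (-1 - lam)) (t1 := L * (1 - lam)) hκ (by linarith)
    (Φ := fun t => (L:ℂ) ^ 2 * φ (lam + t / L)) (Φ1 := fun t => (L:ℂ) ^ 2 / L * φ1 (lam + t / L))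
    (w := fun t => 1 * w (lam + t / L)) (comp_scale h1 _)
    (fun t => (comp_scale h2 ((L:ℂ) ^ 2 / L) t).congr_deriv (by
      rw [hw]; push_cast; field_simp; ring)) (by fun_prop)
    (by beta_reduce; rw [y0, b1, mul_zero]) (by beta_reduce; rw [y1, b2, mul_zero])
  beta_reduce at hv
  rw [y0, y1, b3, b4] at hv
  have hs : IsSolOn (k / L) ε (L * (-1 - lam)) (L * (1 - lam)) (fun t => 1 * w (lam + t / L))
      (fun t => 1 / (L:ℂ) * w1 (lam + t / L)) := by
    refine ⟨fun t _ => comp_scale hw1 1 t, fun t ht => (comp_scale hw2 (1 / (L:ℂ)) t).congr_deriv ?_⟩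
    rw [hode]
    · push_cast; field_simp; ring
    · constructor
      · rw [← y0]; gcongr; exact ht.1
      · rw [← y1]; gcongr; exact ht.2
  have key := pointwise hκ (by rw [div_le_one hL0]; exact hkL) hε0 hε (by rw [hd]; linarith)
    (by rw [hd]; field_simp; linarith) hs ((L:ℂ) ^ 2 / L * 1) hv.1 (by rw [hv.2]; simp)
  intro y hy
  have := key (L * (y - lam)) ⟨by gcongr; exact hy.1, by gcongr; exact hy.2⟩
  beta_reduce at this
  have e1 : lam + L * (y - lam) / L = y := by field_simp; ring
  have e2 : ‖(L:ℂ) ^ 2 / L * 1‖ = L := by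
    have : (L:ℂ) ^ 2 / L * 1 = L := by field_simp
    rw [this, Complex.norm_real, Real.norm_eq_abs, abs_of_pos hL0]
  rw [e1, e2, hd, one_mul] at this
  refine this.trans (le_of_eq ?_)
  congr 6
  · ring
  · ring

end Part12

section Part13

open Set MeasureTheory intervalIntegral

theorem gam_int {a r : ℝ} (ha : 0 < a) (hr : 0 < r) :
    IntegrableOn (fun t : ℝ => t ^ (a - 1) * Real.exp (-(r * t))) (Ioi 0) := by
  by_contra h
  have h1 := Real.integral_rpow_mul_exp_neg_mul_Ioi ha hr
  rw [integral_undef h] at h1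
  have := Real.Gamma_pos_of_pos ha
  have : 0 < (1 / r) ^ a * Real.Gamma a := by positivity
  linarith

theorem gam_x {a r : ℝ} (ha : 0 < a) (hr : 0 < r) :
    IntegrableOn (fun y : ℝ => (1 - y) ^ (a - 1) * Real.exp (-(r * (1 - y)))) (Ioo (-1) 1) ∧
    ∫ y in Ioo (-1:ℝ) 1, (1 - y) ^ (a - 1) * Real.exp (-(r * (1 - y))) ≤ (1 / r) ^ a * Real.Gamma a := by
  have h1 := gam_int ha hr
  have h2 : IntervalIntegrable (fun t : ℝ => t ^ (a - 1) * Real.exp (-(r * t))) volume 0 2 := by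
    rw [intervalIntegrable_iff_integrableOn_Ioc_of_le (by norm_num)]
    exact h1.mono_set Ioc_subset_Ioi_self
  constructor
  · have h3 := h2.comp_sub_left 1
    have h4 := h3.symm
    norm_num at h4
    rw [intervalIntegrable_iff_integrableOn_Ioc_of_le (by norm_num)] at h4
    exact h4.mono_set Ioo_subset_Ioc_self
  · rw [← integral_Ioc_eq_integral_Ioo, ← intervalIntegral.integral_of_le (by norm_num),
      intervalIntegral.integral_comp_sub_left (fun t : ℝ => t ^ (a - 1) * Real.exp (-(r * t))) 1,
      ← Real.integral_rpow_mul_exp_neg_mul_Ioi ha hr]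
    norm_num
    rw [intervalIntegral.integral_of_le (by norm_num)]
    refine setIntegral_mono_set h1 ?_ Ioc_subset_Ioi_self.eventuallyLE
    rw [Filter.EventuallyLE, ae_restrict_iff' measurableSet_Ioi]
    exact ae_of_all _ (fun t ht => by have : 0 < t := ht; positivity)

theorem gam_z {a r : ℝ} (ha : 0 < a) (hr : 0 < r) :
    IntegrableOn (fun y : ℝ => (1 + y) ^ (a - 1) * Real.exp (-(r * (1 + y)))) (Ioo (-1) 1) ∧
    ∫ y in Ioo (-1:ℝ) 1, (1 + y) ^ (a - 1) * Real.exp (-(r * (1 + y))) ≤ (1 / r) ^ a * Real.Gamma a := by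
  have h1 := gam_int ha hr
  have h2 : IntervalIntegrable (fun t : ℝ => t ^ (a - 1) * Real.exp (-(r * t))) volume 0 2 := by
    rw [intervalIntegrable_iff_integrableOn_Ioc_of_le (by norm_num)]
    exact h1.mono_set Ioc_subset_Ioi_self
  constructor
  · have h4 := h2.comp_add_left 1
    norm_num at h4
    rw [intervalIntegrable_iff_integrableOn_Ioc_of_le (by norm_num)] at h4
    exact h4.mono_set Ioo_subset_Ioc_self
  · rw [← integral_Ioc_eq_integral_Ioo, ← intervalIntegral.integral_of_le (by norm_num),
      intervalIntegral.integral_comp_add_left (fun t : ℝ => t ^ (a - 1) * Real.exp (-(r * t))) 1,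
      ← Real.integral_rpow_mul_exp_neg_mul_Ioi ha hr]
    norm_num
    rw [intervalIntegral.integral_of_le (by norm_num)]
    refine setIntegral_mono_set h1 ?_ Ioc_subset_Ioi_self.eventuallyLE
    rw [Filter.EventuallyLE, ae_restrict_iff' measurableSet_Ioi]
    exact ae_of_all _ (fun t ht => by have : 0 < t := ht; positivity)

theorem rho_pos {L y : ℝ} (hL : 6 ≤ L) (hy : y ∈ Ioo (-1:ℝ) 1) : 0 < rhoW L y := by
  have h1 := hy.1
  have h2 := hy.2
  unfold rhoW
  split_ifs
  · exact mul_pos (by linarith) (by linarith)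
  · norm_num
  · exact mul_pos (by linarith) (by linarith)

theorem rho_le {L y : ℝ} (hL : 6 ≤ L) (hy : y ∈ Ioo (-1:ℝ) 1) :
    rhoW L y ≤ L * (1 - y) ∧ rhoW L y ≤ L * (1 + y) := by
  have h1 := hy.1
  have h2 := hy.2
  have hL0 : 0 < L := by linarith
  have hi : L * (1 / L) = 1 := by field_simp
  have hi1 : 1 / L ≤ 1 / 6 := by gcongr
  unfold rhoW
  split_ifs with a b
  · constructor <;> apply mul_le_mul_of_nonneg_left _ hL0.le <;> linarith
  · constructor
    · nlinarith
    · nlinarith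
  · constructor <;> apply mul_le_mul_of_nonneg_left _ hL0.le <;> linarith

theorem rho_rpow {L y : ℝ} (hL : 6 ≤ L) (hy : y ∈ Ioo (-1:ℝ) 1) :
    rhoW L y ^ (-(1:ℝ)/2) ≤ (L * (1 - y)) ^ (-(1:ℝ)/2) + (L * (1 + y)) ^ (-(1:ℝ)/2) + 1 := by
  have h1 := hy.1
  have h2 := hy.2
  have e1 : 0 < L * (1 - y) := mul_pos (by linarith) (by linarith)
  have e2 : 0 < L * (1 + y) := mul_pos (by linarith) (by linarith)
  have f1 := Real.rpow_pos_of_pos e1 (-(1:ℝ)/2)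
  have f2 := Real.rpow_pos_of_pos e2 (-(1:ℝ)/2)
  unfold rhoW
  split_ifs with a b
  · rw [add_comm y 1]; linarith
  · rw [Real.one_rpow]; linarith
  · linarith

end Part13

section Part14

open Set MeasureTheory intervalIntegral

theorem cross {x z G : ℝ} (hx : 0 < x) (hz : 0 < z) (hG : 0 < G) :
    z ^ ((1/2:ℝ) - 1) * Real.exp (-(G * x)) ≤
      x ^ ((1/2:ℝ) - 1) * Real.exp (-(G * x)) + z ^ ((1/2:ℝ) - 1) * Real.exp (-(G * z)) := by
  have p1 : 0 < x ^ ((1/2:ℝ) - 1) := Real.rpow_pos_of_pos hx _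
  have p2 : 0 < z ^ ((1/2:ℝ) - 1) := Real.rpow_pos_of_pos hz _
  have q1 := Real.exp_pos (-(G * x))
  have q2 := Real.exp_pos (-(G * z))
  rcases le_total x z with h | h
  · have : z ^ ((1/2:ℝ) - 1) ≤ x ^ ((1/2:ℝ) - 1) :=
      Real.rpow_le_rpow_of_nonpos hx h (by norm_num)
    have h2 := mul_le_mul_of_nonneg_right this q1.le
    have := mul_pos p2 q2
    linarith
  · have : Real.exp (-(G * x)) ≤ Real.exp (-(G * z)) := by
      apply Real.exp_le_exp.2
      have := mul_le_mul_of_nonneg_left h hG.le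
      linarith
    have h2 := mul_le_mul_of_nonneg_left this p2.le
    have := mul_pos p1 q1
    linarith

theorem wt_bd {L y x z G : ℝ} (hL : 6 ≤ L) (hy : y ∈ Ioo (-1:ℝ) 1) (hx : 0 < x) (hz : 0 < z) (hG : 0 < G)
    (h : (L * (1 - y)) ^ (-(1:ℝ)/2) + (L * (1 + y)) ^ (-(1:ℝ)/2) = (L * x) ^ (-(1:ℝ)/2) + (L * z) ^ (-(1:ℝ)/2)) :
    rhoW L y ^ (-(1:ℝ)/2) * Real.exp (-(G * x)) ≤
      L ^ (-(1:ℝ)/2) * (2 * (x ^ ((1/2:ℝ) - 1) * Real.exp (-(G * x))) + z ^ ((1/2:ℝ) - 1) * Real.exp (-(G * z)))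
        + x ^ ((1:ℝ) - 1) * Real.exp (-(G * x)) := by
  have h1 := rho_rpow hL hy
  rw [h] at h1
  have hL0 : 0 < L := by linarith
  rw [Real.mul_rpow hL0.le hx.le, Real.mul_rpow hL0.le hz.le] at h1
  have h2 := mul_le_mul_of_nonneg_right h1 (Real.exp_pos (-(G * x))).le
  have h3 := mul_le_mul_of_nonneg_left (cross hx hz hG) (Real.rpow_pos_of_pos hL0 (-(1:ℝ)/2)).le
  rw [show (1/2:ℝ) - 1 = -(1:ℝ)/2 by norm_num] at h3 ⊢
  rw [show (1:ℝ) - 1 = 0 by norm_num, Real.rpow_zero]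
  linarith

/-- bound of the weighted exponential integrals -/
noncomputable def Bd (L G : ℝ) : ℝ := 3 * (L ^ (-(1:ℝ)/2) * ((1 / G) ^ (1/2:ℝ) * Real.Gamma (1/2))) + 1 / G

theorem half_x {L G : ℝ} (hL : 6 ≤ L) (hG : 0 < G) : ∃ h : ℝ → ℝ, IntegrableOn h (Ioo (-1) 1) ∧
    ∫ y in Ioo (-1:ℝ) 1, h y ≤ Bd L G ∧
    ∀ y ∈ Ioo (-1:ℝ) 1, rhoW L y ^ (-(1:ℝ)/2) * Real.exp (-(G * (1 - y))) ≤ h y := by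
  obtain ⟨i1, b1⟩ := gam_x (a := 1/2) (by norm_num) hG
  obtain ⟨i2, b2⟩ := gam_z (a := 1/2) (by norm_num) hG
  obtain ⟨i3, b3⟩ := gam_x (a := 1) (by norm_num) hG
  have hp : 0 < L ^ (-(1:ℝ)/2) := Real.rpow_pos_of_pos (by linarith) _
  refine ⟨_, (((i1.const_mul 2).add i2).const_mul (L ^ (-(1:ℝ)/2))).add i3, ?_, fun y hy =>
    wt_bd hL hy (by linarith [hy.2]) (by linarith [hy.1]) hG rfl⟩
  have e := MeasureTheory.integral_add (((i1.const_mul 2).add i2).const_mul (L ^ (-(1:ℝ)/2))) i3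
  refine (le_of_eq e).trans ?_
  rw [MeasureTheory.integral_const_mul]
  have e2 := MeasureTheory.integral_add (i1.const_mul 2) i2
  rw [MeasureTheory.integral_const_mul] at e2
  rw [Real.rpow_one, Real.Gamma_one, mul_one] at b3
  have e3 := mul_le_mul_of_nonneg_left (add_le_add (mul_le_mul_of_nonneg_left b1 (by norm_num : (0:ℝ) ≤ 2)) b2) hp.le
  rw [← e2] at e3
  unfold Bd
  refine (add_le_add e3 b3).trans (le_of_eq ?_)
  ring

theorem half_z {L G : ℝ} (hL : 6 ≤ L) (hG : 0 < G) : ∃ h : ℝ → ℝ, IntegrableOn h (Ioo (-1) 1) ∧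
    ∫ y in Ioo (-1:ℝ) 1, h y ≤ Bd L G ∧
    ∀ y ∈ Ioo (-1:ℝ) 1, rhoW L y ^ (-(1:ℝ)/2) * Real.exp (-(G * (1 + y))) ≤ h y := by
  obtain ⟨i1, b1⟩ := gam_z (a := 1/2) (by norm_num) hG
  obtain ⟨i2, b2⟩ := gam_x (a := 1/2) (by norm_num) hG
  obtain ⟨i3, b3⟩ := gam_z (a := 1) (by norm_num) hG
  have hp : 0 < L ^ (-(1:ℝ)/2) := Real.rpow_pos_of_pos (by linarith) _
  refine ⟨_, (((i1.const_mul 2).add i2).const_mul (L ^ (-(1:ℝ)/2))).add i3, ?_, fun y hy =>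
    wt_bd hL hy (by linarith [hy.1]) (by linarith [hy.2]) hG (add_comm _ _)⟩
  have e := MeasureTheory.integral_add (((i1.const_mul 2).add i2).const_mul (L ^ (-(1:ℝ)/2))) i3
  refine (le_of_eq e).trans ?_
  rw [MeasureTheory.integral_const_mul]
  have e2 := MeasureTheory.integral_add (i1.const_mul 2) i2
  rw [MeasureTheory.integral_const_mul] at e2
  rw [Real.rpow_one, Real.Gamma_one, mul_one] at b3
  have e3 := mul_le_mul_of_nonneg_left (add_le_add (mul_le_mul_of_nonneg_left b1 (by norm_num : (0:ℝ) ≤ 2)) b2) hp.le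
  rw [← e2] at e3
  unfold Bd
  refine (add_le_add e3 b3).trans (le_of_eq ?_)
  ring

theorem Bd_le {L p : ℝ} (hL : 6 ≤ L) (hp : 1 ≤ p) : p ^ 2 * Bd L (0.08 * p * L) ≤ 37 / L * (p ^ 2) ^ (3/4:ℝ) := by
  have hL0 : 0 < L := by linarith
  have hp0 : 0 < p := by linarith
  set r := √p with hr
  have hr1 : 1 ≤ r := by rw [hr, Real.one_le_sqrt]; exact hp
  have hr0 : 0 < r := by linarith
  have hrp : p = r ^ 2 := (Real.sq_sqrt hp0.le).symm
  have e1 : (p ^ 2) ^ (3/4:ℝ) = r ^ 3 := by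
    rw [hrp, ← pow_mul, ← Real.rpow_natCast, ← Real.rpow_mul hr0.le, ← Real.rpow_natCast]
    norm_num
  have e2 : L ^ (-(1:ℝ)/2) * ((1 / (0.08 * p * L)) ^ (1/2:ℝ) * Real.Gamma (1/2)) ≤ 8 / (L * r) := by
    have hG : Real.Gamma (1/2) ≤ 2 := by
      rw [Real.Gamma_one_half_eq, Real.sqrt_le_left (by norm_num)]
      have := Real.pi_lt_four; linarith
    have hGp : 0 < Real.Gamma (1/2) := Real.Gamma_pos_of_pos (by norm_num)
    have h1 : (1 / (0.08 * p * L)) ^ (1/2:ℝ) ≤ 4 / (r * √L) := by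
      rw [← Real.sqrt_eq_rpow]
      apply Real.sqrt_le_iff.2
      refine ⟨by positivity, ?_⟩
      rw [div_pow, mul_pow, Real.sq_sqrt hL0.le, ← hrp, div_le_div_iff₀ (by positivity) (by positivity)]
      have : 0 < p * L := by positivity
      linarith
    have h2 : L ^ (-(1:ℝ)/2) = 1 / √L := by
      rw [neg_div, Real.rpow_neg hL0.le, ← Real.sqrt_eq_rpow, one_div]
    have hs : 0 < √L := Real.sqrt_pos.2 hL0
    rw [h2]
    calc _ ≤ 1 / √L * (4 / (r * √L) * 2) := by gcongr
      _ = 8 / (√L ^ 2 * r) := by field_simp; norm_num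
      _ = _ := by rw [Real.sq_sqrt hL0.le]
  have e3 : 1 / (0.08 * p * L) ≤ 13 / (L * r) := by
    rw [hrp, div_le_div_iff₀ (by positivity) (by positivity)]
    have : L * r * 1 ≤ L * r * r := by gcongr
    have : 0 < L * r * r := by positivity
    nlinarith
  have e4 : Bd L (0.08 * p * L) ≤ 37 / (L * r) := by
    unfold Bd
    have : 37 / (L * r) = 3 * (8 / (L * r)) + 13 / (L * r) := by ring
    rw [this]; linarith
  rw [e1]
  calc _ ≤ p ^ 2 * (37 / (L * r)) := by gcongr
    _ = _ := by rw [hrp]; field_simp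

end Part14

section Part15

open Set MeasureTheory

theorem sq_bd {L p1 p0 y v : ℝ} (hL : 6 ≤ L) (hv : 0 ≤ v)
    (h : v ≤ L * (134 * (p1 * Real.exp (-(0.04 * p1 * (L * (1 - y)))))
      + 1000 / (2 * L) * (p0 * Real.exp (-(0.04 * p0 * (L * (1 + y))))))) :
    v ^ 2 ≤ (35912 * L ^ 2 * p1 ^ 2) * Real.exp (-((0.08 * p1 * L) * (1 - y)))
      + (500000 * p0 ^ 2) * Real.exp (-((0.08 * p0 * L) * (1 + y))) := by
  have e1 : Real.exp (-((0.08 * p1 * L) * (1 - y))) = Real.exp (-(0.04 * p1 * (L * (1 - y)))) ^ 2 := by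
    rw [← Real.exp_nat_mul]; congr 1; push_cast; ring
  have e2 : Real.exp (-((0.08 * p0 * L) * (1 + y))) = Real.exp (-(0.04 * p0 * (L * (1 + y)))) ^ 2 := by
    rw [← Real.exp_nat_mul]; congr 1; push_cast; ring
  rw [e1, e2]
  have hL0 : L ≠ 0 := by linarith
  generalize Real.exp (-(0.04 * p1 * (L * (1 - y)))) = a at *
  generalize Real.exp (-(0.04 * p0 * (L * (1 + y)))) = b at *
  have e3 : L * (134 * (p1 * a) + 1000 / (2 * L) * (p0 * b)) = 134 * (L * p1 * a) + 500 * (p0 * b) := by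
    field_simp; ring
  rw [e3] at h
  have h2 := pow_le_pow_left₀ hv h 2
  nlinarith [sq_nonneg (134 * (L * p1 * a) - 500 * (p0 * b))]

theorem intA {L p1 p0 : ℝ} {v : ℝ → ℝ} (hL : 6 ≤ L) (hp1 : 1 ≤ p1) (hp0 : 1 ≤ p0) (hv : ∀ y, 0 ≤ v y)
    (h : ∀ y ∈ Icc (-1:ℝ) 1, v y ≤ L * (134 * (p1 * Real.exp (-(0.04 * p1 * (L * (1 - y)))))
      + 1000 / (2 * L) * (p0 * Real.exp (-(0.04 * p0 * (L * (1 + y))))))) :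
    ∫ y in Icc (-1:ℝ) 1, rhoW L y ^ (-(1:ℝ)/2) * v y ^ 2 ≤
      1328744 * L * (p1 ^ 2) ^ (3/4:ℝ) + 18500000 / L * (p0 ^ 2) ^ (3/4:ℝ) := by
  have hL0 : 0 < L := by linarith
  have hp1' : 0 < p1 := by linarith
  have hp0' : 0 < p0 := by linarith
  obtain ⟨h1, i1, b1, c1⟩ := half_x hL (G := 0.08 * p1 * L) (by positivity)
  obtain ⟨h0, i0, b0, c0⟩ := half_z hL (G := 0.08 * p0 * L) (by positivity)
  rw [integral_Icc_eq_integral_Ioo]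
  have hm : ∫ y in Ioo (-1:ℝ) 1, rhoW L y ^ (-(1:ℝ)/2) * v y ^ 2 ≤
      ∫ y in Ioo (-1:ℝ) 1, ((35912 * L ^ 2 * p1 ^ 2) * h1 y + (500000 * p0 ^ 2) * h0 y) := by
    refine integral_mono_of_nonneg ?_ ((i1.const_mul _).add (i0.const_mul _)) ?_
    · filter_upwards [ae_restrict_mem measurableSet_Ioo] with y hy
      have := rho_pos hL hy
      show 0 ≤ _
      positivity
    · filter_upwards [ae_restrict_mem measurableSet_Ioo] with y hy
      have hr := Real.rpow_pos_of_pos (rho_pos hL hy) (-(1:ℝ)/2)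
      have hs := mul_le_mul_of_nonneg_left (sq_bd hL (hv y) (h y (Ioo_subset_Icc_self hy))) hr.le
      have k1 := mul_le_mul_of_nonneg_left (c1 y hy) (show 0 ≤ 35912 * L ^ 2 * p1 ^ 2 by positivity)
      have k0 := mul_le_mul_of_nonneg_left (c0 y hy) (show 0 ≤ 500000 * p0 ^ 2 by positivity)
      linarith
  refine hm.trans ?_
  rw [integral_add (i1.const_mul _) (i0.const_mul _), integral_const_mul, integral_const_mul]
  have k1 := Bd_le hL hp1
  have k0 := Bd_le hL hp0
  calc _ ≤ (35912 * L ^ 2 * p1 ^ 2) * Bd L (0.08 * p1 * L) + (500000 * p0 ^ 2) * Bd L (0.08 * p0 * L) := by gcongr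
    _ = 35912 * L ^ 2 * (p1 ^ 2 * Bd L (0.08 * p1 * L)) + 500000 * (p0 ^ 2 * Bd L (0.08 * p0 * L)) := by ring
    _ ≤ 35912 * L ^ 2 * (37 / L * (p1 ^ 2) ^ (3/4:ℝ)) + 500000 * (37 / L * (p0 ^ 2) ^ (3/4:ℝ)) := by gcongr
    _ = _ := by field_simp; ring

theorem intB {L p1 p0 : ℝ} {v : ℝ → ℝ} (hL : 6 ≤ L) (hp1 : 1 ≤ p1) (hp0 : 1 ≤ p0) (hv : ∀ y, 0 ≤ v y)
    (h : ∀ y ∈ Icc (-1:ℝ) 1, v y ≤ L * (134 * (p1 * Real.exp (-(0.04 * p1 * (L * (1 - y)))))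
      + 1000 / (2 * L) * (p0 * Real.exp (-(0.04 * p0 * (L * (1 + y))))))) :
    ∫ y in Icc (-1:ℝ) 1, rhoW L y * v y ^ 2 ≤ 100000000 * L := by
  have hL0 : 0 < L := by linarith
  have hp1' : 0 < p1 := by linarith
  have hp0' : 0 < p0 := by linarith
  obtain ⟨i1, b1⟩ := gam_x (a := 2) (r := 0.08 * p1 * L) (by norm_num) (by positivity)
  obtain ⟨i0, b0⟩ := gam_z (a := 2) (r := 0.08 * p0 * L) (by norm_num) (by positivity)
  rw [Real.Gamma_two, mul_one, Real.rpow_two] at b1 b0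
  rw [integral_Icc_eq_integral_Ioo]
  have hm : ∫ y in Ioo (-1:ℝ) 1, rhoW L y * v y ^ 2 ≤
      ∫ y in Ioo (-1:ℝ) 1, ((35912 * L ^ 3 * p1 ^ 2) * ((1 - y) ^ ((2:ℝ) - 1) * Real.exp (-(0.08 * p1 * L * (1 - y))))
        + (500000 * L * p0 ^ 2) * ((1 + y) ^ ((2:ℝ) - 1) * Real.exp (-(0.08 * p0 * L * (1 + y))))) := by
    refine integral_mono_of_nonneg ?_ ((i1.const_mul _).add (i0.const_mul _)) ?_
    · filter_upwards [ae_restrict_mem measurableSet_Ioo] with y hy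
      have := rho_pos hL hy
      show 0 ≤ _
      positivity
    · filter_upwards [ae_restrict_mem measurableSet_Ioo] with y hy
      have hr := rho_pos hL hy
      have hs := mul_le_mul_of_nonneg_left (sq_bd hL (hv y) (h y (Ioo_subset_Icc_self hy))) hr.le
      have hq := rho_le hL hy
      have k1 := mul_le_mul_of_nonneg_right hq.1 (show 0 ≤ (35912 * L ^ 2 * p1 ^ 2) * Real.exp (-(0.08 * p1 * L * (1 - y))) by positivity)
      have k0 := mul_le_mul_of_nonneg_right hq.2 (show 0 ≤ (500000 * p0 ^ 2) * Real.exp (-(0.08 * p0 * L * (1 + y))) by positivity)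
      rw [show (2:ℝ) - 1 = 1 by norm_num, Real.rpow_one, Real.rpow_one]
      linarith
  refine hm.trans ?_
  rw [integral_add (i1.const_mul _) (i0.const_mul _), integral_const_mul, integral_const_mul]
  calc _ ≤ (35912 * L ^ 3 * p1 ^ 2) * (1 / (0.08 * p1 * L)) ^ 2 + (500000 * L * p0 ^ 2) * (1 / (0.08 * p0 * L)) ^ 2 := by gcongr
    _ = 5611250 * L + 78125000 / L := by field_simp; ring
    _ ≤ 5611250 * L + 78125000 * L := by
      gcongr
      rw [div_le_iff₀ hL0]; nlinarith
    _ ≤ _ := by linarith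

theorem ph_sq_le (t : ℝ) : ph t ^ 2 ≤ 1 + |t| := by
  rw [ph_sq, Real.sqrt_le_left (by positivity)]
  have := sq_abs t
  nlinarith [abs_nonneg t]

theorem one_side {k lam ε L : ℝ} (hk : 1 ≤ k) (hkL : k ≤ L) (hL : 6 ≤ L) (hε0 : 0 ≤ ε) (hε : ε ≤ 0.0001)
    {φ φ1 φ2 w w1 w2 : ℝ → ℂ} (h1 : ∀ y, HasDerivAt φ (φ1 y) y) (h2 : ∀ y, HasDerivAt φ1 (φ2 y) y)
    (hw : ∀ y, w y = φ2 y - (k:ℂ) ^ 2 * φ y)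
    (hw1 : ∀ y, HasDerivAt w (w1 y) y) (hw2 : ∀ y, HasDerivAt w1 (w2 y) y)
    (b1 : φ (-1) = 0) (b2 : φ 1 = 0) (b3 : φ1 1 = 1) (b4 : φ1 (-1) = 0)
    (hode : ∀ y ∈ Icc (-1:ℝ) 1, w2 y = ((k:ℂ) ^ 2 - ε * (L:ℂ) ^ 2 + (L:ℂ) ^ 3 * (y - lam) * Complex.I) * w y) :
    (∫ y in Icc (-1:ℝ) 1, rhoW L y ^ (-(1:ℝ)/2) * ‖w y‖ ^ 2) ^ ((1:ℝ)/2)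
      ≤ 10000 * (L ^ ((1:ℝ)/2) * (1 + L * |lam - 1|) ^ ((3:ℝ)/8)) ∧
    (∫ y in Icc (-1:ℝ) 1, rhoW L y * ‖w y‖ ^ 2) ^ ((1:ℝ)/2) ≤ 10000 * L ^ ((1:ℝ)/2) := by
  have hL0 : 0 < L := by linarith
  have hb := w_bound hk hkL hL hε0 hε h1 h2 hw hw1 hw2 b1 b2 b3 b4 hode
  have hA := intA (v := fun y => ‖w y‖) hL (ph_one_le _) (ph_one_le _) (fun y => norm_nonneg _) hb
  have hB := intB (v := fun y => ‖w y‖) hL (ph_one_le _) (ph_one_le _) (fun y => norm_nonneg _) hb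
  beta_reduce at hA hB
  have n1 : 0 ≤ ∫ y in Icc (-1:ℝ) 1, rhoW L y ^ (-(1:ℝ)/2) * ‖w y‖ ^ 2 := by
    rw [integral_Icc_eq_integral_Ioo]
    refine setIntegral_nonneg measurableSet_Ioo (fun y hy => ?_)
    have := rho_pos hL hy
    positivity
  have n2 : 0 ≤ ∫ y in Icc (-1:ℝ) 1, rhoW L y * ‖w y‖ ^ 2 := by
    rw [integral_Icc_eq_integral_Ioo]
    refine setIntegral_nonneg measurableSet_Ioo (fun y hy => ?_)
    have := rho_pos hL hy
    positivity
  constructor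
  · have hT : |L * (1 - lam)| = L * |lam - 1| := by
      rw [abs_mul, abs_of_pos hL0, abs_sub_comm]
    set T := L * |lam - 1| with hTd
    have hT0 : 0 ≤ T := by positivity
    have q1 : (ph (L * (1 - lam)) ^ 2) ^ (3/4:ℝ) ≤ (1 + T) ^ (3/4:ℝ) := by
      apply Real.rpow_le_rpow (by positivity) _ (by norm_num)
      rw [← hT]; exact ph_sq_le _
    have q0 : (ph (L * (-1 - lam)) ^ 2) ^ (3/4:ℝ) ≤ (1 + T) ^ (3/4:ℝ) * L ^ 2 := by
      have e1 : ph (L * (-1 - lam)) ^ 2 ≤ (1 + T) * (1 + 2 * L) := by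
        refine (ph_sq_le _).trans ?_
        have : |L * (-1 - lam)| ≤ |L * (1 - lam)| + |2 * L| := by
          have : L * (-1 - lam) = L * (1 - lam) - 2 * L := by ring
          rw [this]; exact abs_sub _ _
        rw [hT, abs_of_pos (by linarith : 0 < 2 * L)] at this
        nlinarith [mul_nonneg hT0 hL0.le]
      calc _ ≤ ((1 + T) * (1 + 2 * L)) ^ (3/4:ℝ) := Real.rpow_le_rpow (by positivity) e1 (by norm_num)
        _ = (1 + T) ^ (3/4:ℝ) * (1 + 2 * L) ^ (3/4:ℝ) := Real.mul_rpow (by positivity) (by positivity)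
        _ ≤ (1 + T) ^ (3/4:ℝ) * L ^ 2 := by
          gcongr
          calc (1 + 2 * L) ^ (3/4:ℝ) ≤ (1 + 2 * L) ^ (1:ℝ) :=
                Real.rpow_le_rpow_of_exponent_le (by linarith) (by norm_num)
            _ = 1 + 2 * L := Real.rpow_one _
            _ ≤ L ^ 2 := by nlinarith
    have hX : 0 < (1 + T) ^ (3/4:ℝ) := Real.rpow_pos_of_pos (by linarith) _
    have hA2 : ∫ y in Icc (-1:ℝ) 1, rhoW L y ^ (-(1:ℝ)/2) * ‖w y‖ ^ 2 ≤ 10000 ^ 2 * (L * (1 + T) ^ (3/4:ℝ)) := by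
      refine hA.trans ?_
      calc _ ≤ 1328744 * L * (1 + T) ^ (3/4:ℝ) + 18500000 / L * ((1 + T) ^ (3/4:ℝ) * L ^ 2) := by gcongr
        _ = 19828744 * (L * (1 + T) ^ (3/4:ℝ)) := by field_simp; norm_num
        _ ≤ _ := by
          gcongr; norm_num
    calc _ ≤ (10000 ^ 2 * (L * (1 + T) ^ (3/4:ℝ))) ^ ((1:ℝ)/2) := Real.rpow_le_rpow n1 hA2 (by norm_num)
      _ = _ := by
        rw [Real.mul_rpow (by norm_num) (by positivity), Real.mul_rpow hL0.le hX.le,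
          ← Real.rpow_mul (by linarith), ← Real.rpow_natCast, ← Real.rpow_mul (by norm_num)]
        norm_num
  · calc _ ≤ (10000 ^ 2 * L) ^ ((1:ℝ)/2) := Real.rpow_le_rpow n2 (by linarith) (by norm_num)
      _ = _ := by
        rw [Real.mul_rpow (by norm_num) hL0.le, ← Real.rpow_natCast, ← Real.rpow_mul (by norm_num)]
        norm_num

end Part15

section Part16

open Set MeasureTheory

theorem L_facts {ν K L : ℝ} (hν : 0 < ν) (hK : 1 ≤ K) (hL : L = (K / ν) ^ ((1:ℝ)/3)) :
    0 < L ∧ ν = K / L ^ 3 ∧ ν ^ ((1:ℝ)/3) * K ^ ((2:ℝ)/3) = K / L := by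
  have hK0 : 0 < K := by linarith
  have hL0 : 0 < L := by rw [hL]; exact Real.rpow_pos_of_pos (by positivity) _
  have h3 : L ^ 3 = K / ν := by
    rw [hL, ← Real.rpow_natCast, ← Real.rpow_mul (by positivity)]; norm_num
  have hν' : ν = K / L ^ 3 := by rw [h3]; field_simp
  refine ⟨hL0, hν', ?_⟩
  have e1 : (L ^ 3) ^ ((1:ℝ)/3) = L := by
    rw [← Real.rpow_natCast, ← Real.rpow_mul hL0.le]; norm_num
  rw [hν', Real.div_rpow hK0.le (by positivity), e1, div_mul_eq_mul_div, ← Real.rpow_add hK0]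
  norm_num

theorem rhs_conv {ν K L d : ℝ} (hν : 0 < ν) (hK : 1 ≤ K) (hL : L = (K / ν) ^ ((1:ℝ)/3)) (hKL : K ≤ L)
    (hd : 0 ≤ d) : L ^ ((1:ℝ)/2) * (1 + L * d) ^ ((3:ℝ)/8) ≤
      ν ^ (-(7:ℝ)/24) * K ^ (-(1:ℝ)/12) * (1 + K * d) ^ ((3:ℝ)/8) := by
  obtain ⟨hL0, hν', -⟩ := L_facts hν hK hL
  have hK0 : 0 < K := by linarith
  have e1 : ν ^ (-(7:ℝ)/24) * K ^ (-(1:ℝ)/12) = L ^ ((1:ℝ)/2) * (L / K) ^ ((3:ℝ)/8) := by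
    have a1 : (L ^ 3) ^ (-(7:ℝ)/24) = L ^ (-(7:ℝ)/8) := by
      rw [← Real.rpow_natCast, ← Real.rpow_mul hL0.le]; norm_num
    have a2 : L ^ ((1:ℝ)/2) * L ^ ((3:ℝ)/8) = L ^ ((7:ℝ)/8) := by
      rw [← Real.rpow_add hL0]; norm_num
    have a3 : K ^ (-(7:ℝ)/24) * K ^ (-(1:ℝ)/12) * K ^ ((3:ℝ)/8) = 1 := by
      rw [← Real.rpow_add hK0, ← Real.rpow_add hK0]; norm_num
    have a4 : L ^ ((7:ℝ)/8) * L ^ (-(7:ℝ)/8) = 1 := by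
      rw [← Real.rpow_add hL0]; norm_num
    have p1 : 0 < L ^ (-(7:ℝ)/8) := Real.rpow_pos_of_pos hL0 _
    have p2 : 0 < K ^ ((3:ℝ)/8) := Real.rpow_pos_of_pos hK0 _
    rw [hν', Real.div_rpow hK0.le (by positivity), Real.div_rpow hL0.le hK0.le, a1,
      div_mul_eq_mul_div, mul_div_assoc', a2, div_eq_div_iff p1.ne' p2.ne', a3, a4]
  rw [e1, mul_assoc, ← Real.mul_rpow (by positivity) (by positivity)]
  gcongr
  rw [mul_add, mul_one, ← mul_assoc, div_mul_cancel₀ _ hK0.ne']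
  have : 1 ≤ L / K := by rw [le_div_iff₀ hK0]; linarith
  linarith

structure Dat (ν k lam e : ℝ) (φ φ1 φ2 w w1 w2 : ℝ → ℂ) : Prop where
  h1 : ∀ y, HasDerivAt φ (φ1 y) y
  h2 : ∀ y, HasDerivAt φ1 (φ2 y) y
  hw : ∀ y, w y = φ2 y - (k:ℂ) ^ 2 * φ y
  hw1 : ∀ y, HasDerivAt w (w1 y) y
  hw2 : ∀ y, HasDerivAt w1 (w2 y) y
  ode : ∀ y ∈ Icc (-1:ℝ) 1, -(ν : ℂ) * (w2 y - (k:ℂ)^2 * w y)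
            + Complex.I * (k:ℂ) * ((y:ℂ) - (lam:ℂ)) * w y - (e : ℂ) * w y = 0

theorem Dat.conj {ν k lam e : ℝ} {φ φ1 φ2 w w1 w2 : ℝ → ℂ} (h : Dat ν k lam e φ φ1 φ2 w w1 w2) :
    Dat ν (-k) lam e (fun y => star (φ y)) (fun y => star (φ1 y)) (fun y => star (φ2 y))
      (fun y => star (w y)) (fun y => star (w1 y)) (fun y => star (w2 y)) := by
  refine ⟨fun y => (h.h1 y).star, fun y => (h.h2 y).star, fun y => ?_, fun y => (h.hw1 y).star,
    fun y => (h.hw2 y).star, fun y hy => ?_⟩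
  · rw [h.hw]; simp
  · have := congrArg star (h.ode y hy)
    simp at this
    simp
    linear_combination this

theorem refl_deriv {f f' : ℝ → ℂ} (h : ∀ y, HasDerivAt f (f' y) y) (y : ℝ) :
    HasDerivAt (fun y => f (-y)) (- f' (-y)) y := by
  have h1 : HasDerivAt (fun s : ℝ => f (-s)) ((-1 : ℝ) • f' (-y)) y :=
    HasDerivAt.scomp y (h (-y)) (hasDerivAt_neg y)
  exact h1.congr_deriv (by simp)

/-- reflection together with a change of sign -/
theorem Dat.refl {ν k lam e : ℝ} {φ φ1 φ2 w w1 w2 : ℝ → ℂ} (h : Dat ν k lam e φ φ1 φ2 w w1 w2) :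
    Dat ν (-k) (-lam) e (fun y => - φ (-y)) (fun y => φ1 (-y)) (fun y => - φ2 (-y))
      (fun y => - w (-y)) (fun y => w1 (-y)) (fun y => - w2 (-y)) := by
  refine ⟨fun y => ?_, fun y => refl_deriv h.h2 y, fun y => ?_, fun y => ?_,
    fun y => refl_deriv h.hw2 y, fun y hy => ?_⟩
  · exact (refl_deriv h.h1 y).neg.congr_deriv (by simp)
  · rw [h.hw]; push_cast; ring
  · exact (refl_deriv h.hw1 y).neg.congr_deriv (by simp)
  · have := h.ode (-y) ⟨by linarith [hy.2], by linarith [hy.1]⟩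
    push_cast at this ⊢
    linear_combination -this

theorem Dat.bd_pos {ν k lam ε L : ℝ} {φ φ1 φ2 w w1 w2 : ℝ → ℂ}
    (h : Dat ν k lam (ε * ν ^ ((1:ℝ)/3) * k ^ ((2:ℝ)/3)) φ φ1 φ2 w w1 w2)
    (hν : 0 < ν) (hk : 1 ≤ k) (hL : L = (k / ν) ^ ((1:ℝ)/3)) (hkL : k ≤ L) (hL6 : 6 ≤ L)
    (hε0 : 0 ≤ ε) (hε : ε ≤ 0.0001)
    (b1 : φ (-1) = 0) (b2 : φ 1 = 0) (b3 : φ1 1 = 1) (b4 : φ1 (-1) = 0) :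
    (∫ y in Icc (-1:ℝ) 1, rhoW L y ^ (-(1:ℝ)/2) * ‖w y‖ ^ 2) ^ ((1:ℝ)/2)
      ≤ 10000 * (L ^ ((1:ℝ)/2) * (1 + L * |lam - 1|) ^ ((3:ℝ)/8)) ∧
    (∫ y in Icc (-1:ℝ) 1, rhoW L y * ‖w y‖ ^ 2) ^ ((1:ℝ)/2) ≤ 10000 * L ^ ((1:ℝ)/2) := by
  obtain ⟨hL0, hν', he⟩ := L_facts hν hk hL
  refine one_side hk hkL hL6 hε0 hε h.h1 h.h2 h.hw h.hw1 h.hw2 b1 b2 b3 b4 (fun y hy => ?_)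
  have ho := h.ode y hy
  rw [show ε * ν ^ ((1:ℝ)/3) * k ^ ((2:ℝ)/3) = ε * (k / L) by rw [mul_assoc, he], hν'] at ho
  have hkc : (k:ℂ) ≠ 0 := by
    have : k ≠ 0 := by linarith
    exact_mod_cast this
  have hLc : (L:ℂ) ≠ 0 := by exact_mod_cast hL0.ne'
  push_cast at ho
  have e1 : -((k:ℂ) / (L:ℂ) ^ 3) * (w2 y - (k:ℂ)^2 * w y) + Complex.I * (k:ℂ) * ((y:ℂ) - (lam:ℂ)) * w y
      - (ε:ℂ) * ((k:ℂ) / L) * w y = -((k:ℂ) / (L:ℂ) ^ 3) *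
      (w2 y - ((k:ℂ) ^ 2 - ε * (L:ℂ) ^ 2 + (L:ℂ) ^ 3 * (y - lam) * Complex.I) * w y) := by
    field_simp; ring
  rw [e1] at ho
  have e2 : -((k:ℂ) / (L:ℂ) ^ 3) ≠ 0 := neg_ne_zero.2 (div_ne_zero hkc (pow_ne_zero _ hLc))
  have := (mul_eq_zero.1 ho).resolve_left e2
  exact sub_eq_zero.1 this

theorem Dat.fin1 {ν k lam ε L : ℝ} {φ φ1 φ2 w w1 w2 : ℝ → ℂ}
    (h : Dat ν k lam (ε * ν ^ ((1:ℝ)/3) * |k| ^ ((2:ℝ)/3)) φ φ1 φ2 w w1 w2)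
    (hν : 0 < ν) (hk : 1 ≤ |k|) (hL : L = (|k| / ν) ^ ((1:ℝ)/3)) (hkL : |k| ≤ L) (hL6 : 6 ≤ L)
    (hε0 : 0 ≤ ε) (hε : ε ≤ 0.0001)
    (b1 : φ (-1) = 0) (b2 : φ 1 = 0) (b3 : φ1 1 = 1) (b4 : φ1 (-1) = 0) :
    (∫ y in Icc (-1:ℝ) 1, rhoW L y ^ (-(1:ℝ)/2) * ‖w y‖ ^ 2) ^ ((1:ℝ)/2)
      ≤ 20000 * ν ^ (-(7:ℝ)/24) * |k| ^ (-(1:ℝ)/12) * (1 + |k * (lam - 1)|) ^ ((3:ℝ)/8) ∧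
    (∫ y in Icc (-1:ℝ) 1, rhoW L y * ‖w y‖ ^ 2) ^ ((1:ℝ)/2) ≤ 10000 * L ^ ((1:ℝ)/2) := by
  have key : (∫ y in Icc (-1:ℝ) 1, rhoW L y ^ (-(1:ℝ)/2) * ‖w y‖ ^ 2) ^ ((1:ℝ)/2)
      ≤ 10000 * (L ^ ((1:ℝ)/2) * (1 + L * |lam - 1|) ^ ((3:ℝ)/8)) ∧
    (∫ y in Icc (-1:ℝ) 1, rhoW L y * ‖w y‖ ^ 2) ^ ((1:ℝ)/2) ≤ 10000 * L ^ ((1:ℝ)/2) := by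
    rcases le_total 0 k with h0 | h0
    · rw [abs_of_nonneg h0] at h hk hL hkL
      exact h.bd_pos hν hk hL hkL hL6 hε0 hε b1 b2 b3 b4
    · rw [abs_of_nonpos h0] at h hk hL hkL
      have := h.conj.bd_pos hν hk hL hkL hL6 hε0 hε (by rw [b1, star_zero]) (by rw [b2, star_zero])
        (by rw [b3, star_one]) (by rw [b4, star_zero])
      simpa only [norm_star] using this
  refine ⟨key.1.trans ?_, key.2⟩
  have hr := rhs_conv hν hk hL hkL (abs_nonneg (lam - 1))
  rw [abs_mul]
  have hp : 0 ≤ ν ^ (-(7:ℝ)/24) * |k| ^ (-(1:ℝ)/12) * (1 + |k| * |lam - 1|) ^ ((3:ℝ)/8) := by positivity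
  linarith

theorem rho_refl {L y : ℝ} (hL : 6 ≤ L) : rhoW L (-y) = rhoW L y := by
  have hL0 : 0 < L := by linarith
  have hi : L * (1 / L) = 1 := by field_simp
  have hi1 : 1 / L ≤ 1 / 6 := by gcongr
  unfold rhoW
  generalize 1 / L = δ at *
  split_ifs with a b c d e f g i
  all_goals first
    | linarith
    | (exfalso; linarith)
    | nlinarith

theorem int_refl (f : ℝ → ℝ) : ∫ y in Icc (-1:ℝ) 1, f (-y) = ∫ y in Icc (-1:ℝ) 1, f y := by
  rw [integral_Icc_eq_integral_Ioc, integral_Icc_eq_integral_Ioc,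
    ← intervalIntegral.integral_of_le (by norm_num), ← intervalIntegral.integral_of_le (by norm_num),
    intervalIntegral.integral_comp_neg, neg_neg]

theorem Dat.fin2 {ν k lam ε L : ℝ} {φ φ1 φ2 w w1 w2 : ℝ → ℂ}
    (h : Dat ν k lam (ε * ν ^ ((1:ℝ)/3) * |k| ^ ((2:ℝ)/3)) φ φ1 φ2 w w1 w2)
    (hν : 0 < ν) (hk : 1 ≤ |k|) (hL : L = (|k| / ν) ^ ((1:ℝ)/3)) (hkL : |k| ≤ L) (hL6 : 6 ≤ L)
    (hε0 : 0 ≤ ε) (hε : ε ≤ 0.0001)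
    (b1 : φ (-1) = 0) (b2 : φ 1 = 0) (b3 : φ1 (-1) = 1) (b4 : φ1 1 = 0) :
    (∫ y in Icc (-1:ℝ) 1, rhoW L y ^ (-(1:ℝ)/2) * ‖w y‖ ^ 2) ^ ((1:ℝ)/2)
      ≤ 20000 * ν ^ (-(7:ℝ)/24) * |k| ^ (-(1:ℝ)/12) * (1 + |k * (lam + 1)|) ^ ((3:ℝ)/8) ∧
    (∫ y in Icc (-1:ℝ) 1, rhoW L y * ‖w y‖ ^ 2) ^ ((1:ℝ)/2) ≤ 10000 * L ^ ((1:ℝ)/2) := by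
  have h' := h.refl
  rw [← abs_neg k] at h' hk hL hkL
  have key := h'.fin1 hν hk hL hkL hL6 hε0 hε (by rw [neg_neg, b2, neg_zero]) (by rw [b1, neg_zero])
    b3 (by rw [neg_neg, b4])
  have e1 := int_refl (fun y => rhoW L y ^ (-(1:ℝ)/2) * ‖w y‖ ^ 2)
  have e2 := int_refl (fun y => rhoW L y * ‖w y‖ ^ 2)
  simp only [rho_refl hL6] at e1 e2
  simp only [norm_neg] at key
  rw [e1, e2, abs_neg, show -k * (-lam - 1) = k * (lam + 1) by ring] at key
  exact key

theorem dat_of {ν k lam e : ℝ} {φ w : ℝ → ℂ} (hφ : ContDiff ℝ 4 φ)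
    (hw : w = fun y : ℝ => deriv (deriv φ) y - (k:ℂ)^2 * φ y)
    (ho : ∀ y ∈ Icc (-1:ℝ) 1, -(ν : ℂ) * (deriv (deriv w) y - (k:ℂ)^2 * w y)
            + Complex.I * (k:ℂ) * ((y:ℂ) - (lam:ℂ)) * w y - (e : ℂ) * w y = 0) :
    Dat ν k lam e φ (deriv φ) (deriv (deriv φ)) w (deriv w) (deriv (deriv w)) := by
  have c1 : ContDiff ℝ 3 (deriv φ) := hφ.deriv'
  have c2 : ContDiff ℝ 2 (deriv (deriv φ)) := c1.deriv'
  have cw : ContDiff ℝ 2 w := by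
    rw [hw]
    exact c2.sub (contDiff_const.mul (hφ.of_le (by norm_num)))
  have cw1 : ContDiff ℝ 1 (deriv w) := cw.deriv'
  exact ⟨fun y => ((hφ.differentiable (by norm_num)) y).hasDerivAt,
    fun y => ((c1.differentiable (by norm_num)) y).hasDerivAt, fun y => by rw [hw],
    fun y => ((cw.differentiable (by norm_num)) y).hasDerivAt,
    fun y => ((cw1.differentiable (by norm_num)) y).hasDerivAt, ho⟩

end Part16

/-- Weighted `L²` bounds on the vorticities `w₁, w₂` of the solutions of the homogeneous
Orr–Sommerfeld equation. -/
theorem statement8 :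
    ∃ k₀ δ₀ C : ℝ, 1 ≤ k₀ ∧ 0 < δ₀ ∧ 0 < C ∧
      ∀ (ν : ℝ) (k : ℤ) (lam ε L : ℝ) (φ₁ φ₂ w₁ w₂ : ℝ → ℂ),
        0 < ν → ν ≤ 1 → 1 ≤ |k| → 0 ≤ ε → ε < δ₀ →
        L = (|(k:ℝ)| / ν) ^ ((1:ℝ)/3) →
        (L ≥ 6 * |(k:ℝ)| ∨ (L ≥ |(k:ℝ)| ∧ |(k:ℝ)| ≥ k₀)) →
        ContDiff ℝ 4 φ₁ → ContDiff ℝ 4 φ₂ →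
        φ₁ (-1) = 0 → φ₁ 1 = 0 → deriv φ₁ 1 = 1 → deriv φ₁ (-1) = 0 →
        φ₂ (-1) = 0 → φ₂ 1 = 0 → deriv φ₂ (-1) = 1 → deriv φ₂ 1 = 0 →
        (w₁ = fun y : ℝ => deriv (deriv φ₁) y - (k:ℂ)^2 * φ₁ y) →
        (w₂ = fun y : ℝ => deriv (deriv φ₂) y - (k:ℂ)^2 * φ₂ y) →
        (∀ y ∈ Set.Icc (-1:ℝ) 1,
          -(ν : ℂ) * (deriv (deriv w₁) y - (k:ℂ)^2 * w₁ y)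
            + Complex.I * (k:ℂ) * ((y:ℂ) - (lam:ℂ)) * w₁ y
            - ((ε * ν ^ ((1:ℝ)/3) * |(k:ℝ)| ^ ((2:ℝ)/3) : ℝ) : ℂ) * w₁ y = 0) →
        (∀ y ∈ Set.Icc (-1:ℝ) 1,
          -(ν : ℂ) * (deriv (deriv w₂) y - (k:ℂ)^2 * w₂ y)
            + Complex.I * (k:ℂ) * ((y:ℂ) - (lam:ℂ)) * w₂ y
            - ((ε * ν ^ ((1:ℝ)/3) * |(k:ℝ)| ^ ((2:ℝ)/3) : ℝ) : ℂ) * w₂ y = 0) →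
        (∫ y in Set.Icc (-1:ℝ) 1, rhoW L y ^ (-(1:ℝ)/2) * ‖w₁ y‖^2) ^ ((1:ℝ)/2)
            ≤ C * ν ^ (-(7:ℝ)/24) * |(k:ℝ)| ^ (-(1:ℝ)/12)
                * (1 + |(k:ℝ) * (lam - 1)|) ^ ((3:ℝ)/8)
          ∧ (∫ y in Set.Icc (-1:ℝ) 1, rhoW L y ^ (-(1:ℝ)/2) * ‖w₂ y‖^2) ^ ((1:ℝ)/2)
            ≤ C * ν ^ (-(7:ℝ)/24) * |(k:ℝ)| ^ (-(1:ℝ)/12)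
                * (1 + |(k:ℝ) * (lam + 1)|) ^ ((3:ℝ)/8)
          ∧ (∫ y in Set.Icc (-1:ℝ) 1, rhoW L y * ‖w₁ y‖^2) ^ ((1:ℝ)/2)
              + (∫ y in Set.Icc (-1:ℝ) 1, rhoW L y * ‖w₂ y‖^2) ^ ((1:ℝ)/2)
            ≤ C * L ^ ((1:ℝ)/2) := by
  refine ⟨6, 0.0001, 20000, by norm_num, by norm_num, by norm_num, ?_⟩
  intro ν k lam ε L φ₁ φ₂ w₁ w₂ hν hν1 hk hε0 hε hL hLk hφ₁ hφ₂ a1 a2 a3 a4 b1 b2 b3 b4 hw₁ hw₂ o₁ o₂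
  have hk' : 1 ≤ |(k:ℝ)| := by exact_mod_cast hk
  have hkL : |(k:ℝ)| ≤ L := by
    rcases hLk with h | h
    · linarith
    · exact h.1
  have hL6 : 6 ≤ L := by
    rcases hLk with h | h
    · linarith
    · linarith [h.1, h.2]
  have hc : (k:ℂ) = ((k:ℝ):ℂ) := (Complex.ofReal_intCast k).symm
  rw [hc] at hw₁ hw₂
  simp only [hc] at o₁ o₂
  have f1 := (dat_of hφ₁ hw₁ o₁).fin1 hν hk' hL hkL hL6 hε0 hε.le a1 a2 a3 a4
  have f2 := (dat_of hφ₂ hw₂ o₂).fin2 hν hk' hL hkL hL6 hε0 hε.le b1 b2 b3 b4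
  exact ⟨f1.1, f2.1, by linarith [f1.2, f2.2]⟩
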